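/- arXiv:1406.0733 — 7 statements merged into one kernel-verified Lean document; each statement's English description precedes it below -/
import Mathlib

section
/- The Hilbert geometry of the open unit square (0,1)² in ℝ², equipped with its Hilbert distance, is not isometric to any normed vector space. -/
open Set Filter MeasureTheory

noncomputable section

abbrev Euc (n : ℕ) := EuclideanSpace ℝ (Fin n)

/-- `Ω` is a convex domain: a non-empty bounded open convex subset of `ℝⁿ`. -/
def IsConvexDomain {n : ℕ} (Ω : Set (Euc n)) : Prop :=
  Ω.Nonempty ∧ IsOpen Ω ∧ Bornology.IsBounded Ω ∧ Convex ℝ Ω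

/-- `d` is the Hilbert distance of the convex domain `Ω` : for distinct `p q ∈ Ω`, if `a` and
`b` are the points where the line through `p` and `q` meets `∂Ω`, in the order `a, p, q, b`
(`a = p + s•(q-p)` with `s < 0`, `b = p + t•(q-p)` with `t > 1`), then
`d p q = ½ log [a,p,q,b]`, and `d p p = 0`. -/
def IsHilbertDist {n : ℕ} (Ω : Set (Euc n)) (d : Euc n → Euc n → ℝ) : Prop :=
  (∀ p ∈ Ω, d p p = 0) ∧
  ∀ p ∈ Ω, ∀ q ∈ Ω, p ≠ q → ∀ a b : Euc n,
    a ∈ frontier Ω → b ∈ frontier Ω →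
    (∃ s t : ℝ, s < 0 ∧ 1 < t ∧ a = p + s • (q - p) ∧ b = p + t • (q - p)) →
    d p q = (1/2) * Real.log ((‖q - a‖ / ‖p - a‖) * (‖p - b‖ / ‖q - b‖))

/-- `M` is the largest of the ratios `L q / L p`, where `L` runs over the four affine functions
`x i`, `1 - x i` that cut out the unit square. -/
def IsMaxRatio (p q : Euc 2) (M : ℝ) : Prop :=
  (∀ i, q i ≤ M * p i ∧ 1 - q i ≤ M * (1 - p i)) ∧
    ∃ i, q i = M * p i ∨ 1 - q i = M * (1 - p i)

/-- The open unit square. -/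
def unitSquare : Set (Euc 2) := {x | ∀ i, x i ∈ Ioo (0 : ℝ) 1}

lemma exists_isMaxRatio {p q : Euc 2} (hp : p ∈ unitSquare) (hpq : p ≠ q) :
    ∃ M, 1 < M ∧ IsMaxRatio p q M := by
  have hp0 : ∀ i, 0 < p i := fun i => (hp i).1
  have hp1 : ∀ i, 0 < 1 - p i := fun i => sub_pos.2 (hp i).2
  let r : Fin 2 × Bool → ℝ := fun k =>
    if k.2 then q k.1 / p k.1 else (1 - q k.1) / (1 - p k.1)
  obtain ⟨k, hk⟩ := Finite.exists_max r
  have h0 : ∀ i, q i ≤ r k * p i := fun i => by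
    have := hk (i, true)
    simp only [r, if_true] at this
    exact (div_le_iff₀ (hp0 i)).1 this
  have h1 : ∀ i, 1 - q i ≤ r k * (1 - p i) := fun i => by
    have := hk (i, false)
    simp only [r, Bool.false_eq_true, if_false] at this
    exact (div_le_iff₀ (hp1 i)).1 this
  refine ⟨r k, ?_, fun i => ⟨h0 i, h1 i⟩, k.1, ?_⟩
  · by_contra! hle
    refine hpq (PiLp.ext fun i => ?_)
    nlinarith [h0 i, h1 i, hp0 i, hp1 i]
  · rcases hkb : k.2 with _ | _
    · right
      simp only [r, hkb, Bool.false_eq_true, if_false]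
      exact (div_mul_cancel₀ _ (hp1 _).ne').symm
    · left
      simp only [r, hkb, if_true]
      exact (div_mul_cancel₀ _ (hp0 _).ne').symm

/-- The line from `q` through `p` leaves the unit square at the parameter determined by the
maximal ratio. -/
lemma mem_frontier_of_isMaxRatio {p q : Euc 2} (hp : p ∈ unitSquare) {M : ℝ} (hM : 1 < M)
    (h : IsMaxRatio p q M) : p + (-(1 / (M - 1))) • (q - p) ∈ frontier unitSquare := by
  set a := p + (-(1 / (M - 1))) • (q - p) with ha
  have hM' : 0 < M - 1 := sub_pos.2 hM
  have hai : ∀ i, a i = (M * p i - q i) / (M - 1) := fun i => by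
    simp only [ha, PiLp.add_apply, PiLp.smul_apply, PiLp.sub_apply, smul_eq_mul]
    field_simp
    ring
  have hai' : ∀ i, 1 - a i = (M * (1 - p i) - (1 - q i)) / (M - 1) := fun i => by
    rw [hai]
    field_simp
    ring
  have ha0 : ∀ i, 0 ≤ a i := fun i => by
    rw [hai]
    exact div_nonneg (by linarith [(h.1 i).1]) hM'.le
  have ha1 : ∀ i, 0 ≤ 1 - a i := fun i => by
    rw [hai']
    exact div_nonneg (by linarith [(h.1 i).2]) hM'.le
  rw [frontier, Set.mem_sdiff]
  constructor
  · have hseg : openSegment ℝ p a ⊆ unitSquare := by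
      rintro _ ⟨s, t, hs, ht, hst, rfl⟩ i
      have e : (s • p + t • a) i = s * p i + t * a i := by simp
      have h0 := mul_pos hs (hp i).1
      have h1 := mul_pos hs (sub_pos.2 (hp i).2)
      have h2 := mul_nonneg ht.le (ha0 i)
      have h3 := mul_nonneg ht.le (ha1 i)
      rw [e]
      constructor <;> nlinarith
    have := closure_mono hseg
    rw [closure_openSegment] at this
    exact this (right_mem_segment ℝ p a)
  · intro hmem
    have hmem := interior_subset hmem
    obtain ⟨i, hi | hi⟩ := h.2
    · have := (hmem i).1
      rw [hai, hi, sub_self, zero_div] at this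
      exact lt_irrefl _ this
    · have := sub_pos.2 (hmem i).2
      rw [hai', hi, sub_self, zero_div] at this
      exact lt_irrefl _ this

lemma IsHilbertDist.eq_log {d : Euc 2 → Euc 2 → ℝ} (hd : IsHilbertDist unitSquare d)
    {p q : Euc 2} (hp : p ∈ unitSquare) (hq : q ∈ unitSquare) (hpq : p ≠ q) {M N : ℝ}
    (hM : 1 < M) (hN : 1 < N) (hMr : IsMaxRatio p q M) (hNr : IsMaxRatio q p N) :
    d p q = 1 / 2 * Real.log (M * N) := by
  have hM' : 0 < M - 1 := sub_pos.2 hM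
  have hN' : 0 < N - 1 := sub_pos.2 hN
  have hn : ‖q - p‖ ≠ 0 := norm_ne_zero_iff.2 (sub_ne_zero.2 hpq.symm)
  have hb : q + (-(1 / (N - 1))) • (p - q) = p + (1 + 1 / (N - 1)) • (q - p) := by module
  have key := hd.2 p hp q hq hpq _ _ (mem_frontier_of_isMaxRatio hp hM hMr)
    (hb ▸ mem_frontier_of_isMaxRatio hq hN hNr)
    ⟨_, _, neg_lt_zero.2 (one_div_pos.2 hM'), lt_add_of_pos_right _ (one_div_pos.2 hN'), rfl, rfl⟩
  have e1 : q - (p + (-(1 / (M - 1))) • (q - p)) = (1 + 1 / (M - 1)) • (q - p) := by module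
  have e2 : p - (p + (-(1 / (M - 1))) • (q - p)) = (1 / (M - 1)) • (q - p) := by module
  have e3 : p - (p + (1 + 1 / (N - 1)) • (q - p)) = (-(1 + 1 / (N - 1))) • (q - p) := by module
  have e4 : q - (p + (1 + 1 / (N - 1)) • (q - p)) = (-(1 / (N - 1))) • (q - p) := by module
  have p1 := one_div_pos.2 hM'
  have p2 := one_div_pos.2 hN'
  rw [key, e1, e2, e3, e4]
  simp only [norm_smul, norm_neg, Real.norm_eq_abs]
  rw [abs_of_pos p1, abs_of_pos p2, abs_of_pos (by linarith : 0 < 1 + 1 / (M - 1)),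
    abs_of_pos (by linarith : 0 < 1 + 1 / (N - 1))]
  congr 2
  field_simp
  ring

/-- Each product of two ratios of the defining affine functions is a lower bound for the
Hilbert distance. -/
lemma IsHilbertDist.ratio_le {d : Euc 2 → Euc 2 → ℝ} (hd : IsHilbertDist unitSquare d)
    {p q : Euc 2} (hp : p ∈ unitSquare) (hq : q ∈ unitSquare) {c : ℝ} (hc : 1 < c)
    (hdc : d p q = 1 / 2 * Real.log c) (i j : Fin 2) :
    q i * (1 - p j) ≤ c * (p i * (1 - q j)) := by
  have hpq : p ≠ q := by
    rintro rfl
    have := Real.log_pos hc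
    rw [hd.1 p hp] at hdc
    linarith
  obtain ⟨M, hM, hMr⟩ := exists_isMaxRatio hp hpq
  obtain ⟨N, hN, hNr⟩ := exists_isMaxRatio hq hpq.symm
  have hlog : Real.log (M * N) = Real.log c := by
    have := hd.eq_log hp hq hpq hM hN hMr hNr
    linarith
  have hMN : M * N = c :=
    Real.log_injOn_pos (mem_Ioi.2 (by nlinarith)) (mem_Ioi.2 (by linarith)) hlog
  have h1 := (hMr.1 i).1
  have h2 := (hNr.1 j).2
  calc q i * (1 - p j) ≤ (M * p i) * (N * (1 - q j)) :=
        mul_le_mul h1 h2 (sub_pos.2 (hp j).2).le (mul_pos (by linarith) (hp i).1).le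
    _ = c * (p i * (1 - q j)) := by rw [← hMN]; ring

/-- A ray from the vertex `(0, 0)` of the unit square to the midpoint of the side `x i = 1`. -/
def vertexRay (i : Fin 2) (E : ℝ) : Euc 2 :=
  WithLp.toLp 2 fun j => if j = i then 2 * E / (1 + 2 * E) else E / (1 + 2 * E)

lemma vertexRay_same (i : Fin 2) (E : ℝ) : vertexRay i E i = 2 * E / (1 + 2 * E) := by
  simp [vertexRay]

lemma vertexRay_other {i j : Fin 2} (h : j ≠ i) (E : ℝ) :
    vertexRay i E j = E / (1 + 2 * E) := by
  simp [vertexRay, h]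

lemma one_sub_vertexRay_same (i : Fin 2) {E : ℝ} (hE : 0 < E) :
    1 - vertexRay i E i = 1 / (1 + 2 * E) := by
  rw [vertexRay_same]
  field_simp
  ring

lemma one_sub_vertexRay_other {i j : Fin 2} (h : j ≠ i) {E : ℝ} (hE : 0 < E) :
    1 - vertexRay i E j = (1 + E) / (1 + 2 * E) := by
  rw [vertexRay_other h]
  field_simp
  ring

lemma vertexRay_mem (i : Fin 2) {E : ℝ} (hE : 0 < E) : vertexRay i E ∈ unitSquare := by
  intro j
  rw [mem_Ioo, ← sub_pos (b := vertexRay i E j)]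
  by_cases h : j = i
  · subst h
    rw [one_sub_vertexRay_same j hE, vertexRay_same]
    constructor <;> positivity
  · rw [one_sub_vertexRay_other h hE, vertexRay_other h]
    constructor <;> positivity

lemma IsHilbertDist.vertexRay_mul {d : Euc 2 → Euc 2 → ℝ} (hd : IsHilbertDist unitSquare d)
    (i : Fin 2) {E c : ℝ} (hE : 0 < E) (hc : 1 < c) :
    d (vertexRay i E) (vertexRay i (c * E)) = 1 / 2 * Real.log c := by
  have hc0 : 0 < c := by linarith
  have hcE : 0 < c * E := mul_pos hc0 hE
  have hM : 1 < c * (1 + 2 * E) / (1 + 2 * (c * E)) := by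
    rw [lt_div_iff₀ (by positivity)]; nlinarith
  have hN : 1 < (1 + 2 * (c * E)) / (1 + 2 * E) := by
    rw [lt_div_iff₀ (by positivity)]; nlinarith
  have hne : vertexRay i E ≠ vertexRay i (c * E) := fun h => by
    have h := congrArg (fun x : Euc 2 => 1 - x i) h
    simp only [one_sub_vertexRay_same i hE, one_sub_vertexRay_same i hcE] at h
    rw [div_eq_div_iff (by positivity) (by positivity)] at h
    nlinarith
  rw [hd.eq_log (vertexRay_mem i hE) (vertexRay_mem i hcE) hne hM hN]
  · congr 2
    field_simp
  · refine ⟨fun j => ?_, i, Or.inl ?_⟩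
    · by_cases h : j = i
      · subst h
        rw [one_sub_vertexRay_same j hE, one_sub_vertexRay_same j hcE, vertexRay_same,
          vertexRay_same]
        constructor
        · apply le_of_eq
          field_simp
        · field_simp
          nlinarith
      · rw [one_sub_vertexRay_other h hE, one_sub_vertexRay_other h hcE, vertexRay_other h,
          vertexRay_other h]
        constructor
        · apply le_of_eq
          field_simp
        · field_simp
          nlinarith
    · rw [vertexRay_same, vertexRay_same]
      field_simp
  · refine ⟨fun j => ?_, i, Or.inr ?_⟩
    · by_cases h : j = i
      · subst h
        rw [one_sub_vertexRay_same j hE, one_sub_vertexRay_same j hcE, vertexRay_same,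
          vertexRay_same]
        constructor
        · field_simp
          nlinarith
        · apply le_of_eq
          field_simp
      · rw [one_sub_vertexRay_other h hE, one_sub_vertexRay_other h hcE, vertexRay_other h,
          vertexRay_other h]
        constructor
        · field_simp
          nlinarith
        · field_simp
          nlinarith
    · rw [one_sub_vertexRay_same i hE, one_sub_vertexRay_same i hcE]
      field_simp

lemma isMaxRatio_vertexRay {i j : Fin 2} (hij : i ≠ j) {E : ℝ} (hE : 0 < E) :
    IsMaxRatio (vertexRay i E) (vertexRay j E) (max 2 (1 + E)) := by
  have h2 : 2 ≤ max 2 (1 + E) := le_max_left _ _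
  have h3 : 1 + E ≤ max 2 (1 + E) := le_max_right _ _
  constructor
  · intro k
    obtain rfl | hk := eq_or_ne k i
    · rw [one_sub_vertexRay_same k hE, vertexRay_same, one_sub_vertexRay_other hij hE,
        vertexRay_other hij]
      constructor
      · field_simp
        nlinarith
      · field_simp
        nlinarith
    · obtain rfl : k = j := by omega
      rw [one_sub_vertexRay_same k hE, vertexRay_same, one_sub_vertexRay_other hk hE,
        vertexRay_other hk]
      constructor
      · field_simp
        nlinarith
      · field_simp
        nlinarith
  · rcases max_choice 2 (1 + E) with h | h
    · refine ⟨j, Or.inl ?_⟩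
      rw [h, vertexRay_same, vertexRay_other hij.symm]
      field_simp
    · refine ⟨i, Or.inr ?_⟩
      rw [h, one_sub_vertexRay_same i hE, one_sub_vertexRay_other hij hE]
      field_simp

lemma IsHilbertDist.vertexRay_vertexRay {d : Euc 2 → Euc 2 → ℝ}
    (hd : IsHilbertDist unitSquare d) {E : ℝ} (hE : 0 < E) :
    d (vertexRay 0 E) (vertexRay 1 E) = Real.log (max 2 (1 + E)) := by
  have h2 : 2 ≤ max 2 (1 + E) := le_max_left _ _
  have h1 : 1 < max 2 (1 + E) := by linarith
  have hne : vertexRay 0 E ≠ vertexRay 1 E := fun h => by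
    have h := congrArg (fun x : Euc 2 => x 0) h
    simp only [vertexRay_same, vertexRay_other (zero_ne_one (α := Fin 2))] at h
    field_simp at h
    norm_num at h
  rw [hd.eq_log (vertexRay_mem 0 hE) (vertexRay_mem 1 hE) hne h1 h1
    (isMaxRatio_vertexRay zero_ne_one hE) (isMaxRatio_vertexRay one_ne_zero hE),
    Real.log_mul (by linarith) (by linarith)]
  ring

/-- Metric midpoints on a ray issuing from a vertex are unique. -/
lemma IsHilbertDist.eq_vertexRay {d : Euc 2 → Euc 2 → ℝ} (hd : IsHilbertDist unitSquare d)
    (i : Fin 2) {E : ℝ} (hE : 0 < E) {z : Euc 2} (hz : z ∈ unitSquare)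
    (h1 : d (vertexRay i E) z = 1 / 2 * Real.log 2)
    (h2 : d z (vertexRay i (2 * (2 * E))) = 1 / 2 * Real.log 2) :
    z = vertexRay i (2 * E) := by
  have hE4 : 0 < 2 * (2 * E) := by positivity
  have hle := fun j => hd.ratio_le (vertexRay_mem i hE) hz one_lt_two h1 j i
  have hge := fun j => hd.ratio_le hz (vertexRay_mem i hE4) one_lt_two h2 j i
  simp only [one_sub_vertexRay_same i hE, one_sub_vertexRay_same i hE4] at hle hge
  have hi : z i = 4 * E * (1 - z i) := by
    have a := hle i
    have b := hge i
    rw [vertexRay_same] at a b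
    field_simp at a b
    linarith
  have hzi : z i = 2 * (2 * E) / (1 + 2 * (2 * E)) := by
    rw [eq_div_iff (by positivity)]
    linarith
  ext j
  by_cases h : j = i
  · subst h
    rw [vertexRay_same, hzi]
  · have a := hle j
    have b := hge j
    rw [vertexRay_other h, hzi] at a b
    rw [vertexRay_other h]
    field_simp at a b ⊢
    linarith

lemma eq_zero_of_norm_add_nsmul_le {V : Type*} [NormedAddCommGroup V] [NormedSpace ℝ V]
    {v w : V} {C : ℝ} (h : ∀ n : ℕ, ‖v + n • w‖ ≤ C) : w = 0 := by
  by_contra hw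
  obtain ⟨n, hn⟩ := exists_nat_gt ((C + ‖v‖) / ‖w‖)
  rw [div_lt_iff₀ (norm_pos_iff.2 hw)] at hn
  have h1 : ‖n • w‖ = n * ‖w‖ := by
    rw [← Nat.cast_smul_eq_nsmul ℝ, norm_smul, Real.norm_natCast]
  have h2 : ‖n • w‖ ≤ ‖v + n • w‖ + ‖v‖ := by
    simpa using norm_sub_le (v + n • w) v
  linarith [h n]

/-- The Hilbert geometry of the open unit square `(0,1)² ⊆ ℝ²` is not isometric to any normed
vector space. -/
theorem unit_square_not_isometric_to_normed_space
    (Ω : Set (Euc 2))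
    (hΩ : Ω = {x : Euc 2 | x 0 ∈ Set.Ioo (0 : ℝ) 1 ∧ x 1 ∈ Set.Ioo (0 : ℝ) 1})
    (d : Euc 2 → Euc 2 → ℝ) (hd : IsHilbertDist Ω d)
    (V : Type*) [NormedAddCommGroup V] [NormedSpace ℝ V] :
    ¬ ∃ f : Euc 2 → V, Set.BijOn f Ω Set.univ ∧
        ∀ x ∈ Ω, ∀ y ∈ Ω, ‖f x - f y‖ = d x y := by
  rintro ⟨f, hf, hiso⟩
  obtain rfl : Ω = unitSquare := by
    rw [hΩ]
    ext x
    simp [unitSquare, Fin.forall_fin_two]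
  have hmid : ∀ (i : Fin 2) (E : ℝ), 0 < E →
      f (vertexRay i E) + f (vertexRay i (2 * (2 * E))) =
        f (vertexRay i (2 * E)) + f (vertexRay i (2 * E)) := by
    intro i E hE
    have hp := vertexRay_mem i hE
    have hq := vertexRay_mem i (by positivity : 0 < 2 * (2 * E))
    set p := vertexRay i E
    set q := vertexRay i (2 * (2 * E)) with hq_def
    obtain ⟨z, hz, hfz⟩ := hf.surjOn (mem_univ ((1 / 2 : ℝ) • (f p + f q)))
    have hpq : ‖f p - f q‖ = Real.log 2 := by
      rw [hiso p hp q hq, hq_def, ← mul_assoc, hd.vertexRay_mul i hE (by norm_num),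
        Real.log_mul two_ne_zero two_ne_zero]
      ring
    have hhalf : ‖(1 / 2 : ℝ) • (f p - f q)‖ = 1 / 2 * Real.log 2 := by
      rw [norm_smul, hpq, Real.norm_of_nonneg (by norm_num)]
    have hz_eq := hd.eq_vertexRay i hE hz
      (by rw [← hiso p hp z hz, hfz, ← hhalf]; congr 1; module)
      (by rw [← hiso z hz q hq, hfz, ← hhalf]; congr 1; module)
    rw [← hz_eq, hfz]
    module
  let w : ℕ → V := fun n => f (vertexRay 0 (2 / 2 ^ n)) - f (vertexRay 1 (2 / 2 ^ n))
  have hnorm : ∀ n, ‖w n‖ = Real.log (max 2 (1 + 2 / 2 ^ n)) := fun n => by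
    have hE : (0 : ℝ) < 2 / 2 ^ n := by positivity
    rw [hiso _ (vertexRay_mem 0 hE) _ (vertexRay_mem 1 hE), hd.vertexRay_vertexRay hE]
  have hstep : ∀ n, w (n + 2) + w n = w (n + 1) + w (n + 1) := fun n => by
    have hE : (0 : ℝ) < 2 / 2 ^ (n + 2) := by positivity
    have e1 : (2 : ℝ) * (2 / 2 ^ (n + 2)) = 2 / 2 ^ (n + 1) := by field_simp; ring
    have e2 : (2 : ℝ) * (2 / 2 ^ (n + 1)) = 2 / 2 ^ n := by field_simp; ring
    have h0 := hmid 0 _ hE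
    have h1 := hmid 1 _ hE
    rw [e1, e2] at h0 h1
    simp only [w]
    rw [sub_add_sub_comm, h0, h1, sub_add_sub_comm]
  have hdiff : ∀ n, w (n + 1) - w n = w 1 - w 0 := fun n => by
    induction n with
    | zero => rfl
    | succ n ih =>
      rw [← ih, sub_eq_sub_iff_add_eq_add]
      exact hstep n
  have hw : ∀ n, w n = w 0 + n • (w 1 - w 0) := fun n => by
    induction n with
    | zero => simp
    | succ n ih => rw [succ_nsmul, ← add_assoc, ← ih, ← hdiff n, add_sub_cancel]
  have hzero : w 1 - w 0 = 0 := by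
    refine eq_zero_of_norm_add_nsmul_le (v := w 0) (C := Real.log 3) fun n => ?_
    rw [← hw, hnorm]
    have hn : (2 : ℝ) / 2 ^ n ≤ 2 := div_le_self two_pos.le (one_le_pow₀ one_le_two)
    refine Real.log_le_log (by positivity) (max_le (by norm_num) (by linarith))
  have h0 := hnorm 0
  have h1 := hnorm 1
  rw [sub_eq_zero.1 hzero, h0] at h1
  norm_num at h1
  have := Real.log_lt_log two_pos (by norm_num : (2 : ℝ) < 3)
  linarith
end
end

section
/- For a convex domain Ω ⊂ ℝⁿ, the following are equivalent: (a) Ω is the interior of a bounded convex polytope; (b) there exist m ∈ ℕ, a norm ‖·‖ on ℝᵐ, and a map f : Ω → ℝᵐ such that ‖f(x) − f(y)‖ = d_Ω(x,y) for all x, y ∈ Ω (i.e., (Ω, d_Ω) embeds isometrically in a finite-dimensional normed vector space). -/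
open Set Filter MeasureTheory

noncomputable section

/-- `N` is a norm on `ℝᵐ`. -/
def IsNorm {m : ℕ} (N : (Fin m → ℝ) → ℝ) : Prop :=
  (∀ x, 0 ≤ N x) ∧ (∀ x, N x = 0 ↔ x = 0) ∧
  (∀ (c : ℝ) (x), N (c • x) = |c| * N x) ∧ ∀ x y, N (x + y) ≤ N x + N y

section Polyhedra

variable {E : Type*} [NormedAddCommGroup E] [InnerProductSpace ℝ E]

theorem extremePoint_eq_of_active_subset {W : Set E} (hW : W.Finite) {x y : E}
    (hx : x ∈ {x : E | ∀ w ∈ W, inner ℝ w x ≤ 1}.extremePoints ℝ)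
    (hy : ∀ w ∈ W, inner ℝ w y ≤ 1)
    (hxy : ∀ w ∈ W, inner ℝ w x = 1 → inner ℝ w y = 1) : x = y := by
  rw [mem_extremePoints] at hx
  obtain ⟨hxQ, hx⟩ := hx
  have hev : ∀ᶠ ε : ℝ in nhdsWithin 0 (Ioi 0), ∀ w ∈ W, inner ℝ w (x + ε • (x - y)) ≤ 1 := by
    rw [hW.eventually_all]
    intro w hw
    rcases (hxQ w hw).lt_or_eq with h | h
    · have hc : Continuous fun ε : ℝ => inner ℝ w (x + ε • (x - y)) := by fun_prop
      have := hc.tendsto 0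
      simp only [zero_smul, add_zero] at this
      filter_upwards [(this.eventually_lt_const h).filter_mono nhdsWithin_le_nhds] with ε hε
      exact hε.le
    · refine Eventually.of_forall fun ε => ?_
      rw [inner_add_right, inner_smul_right, inner_sub_right, h, hxy w hw h]
      simp
  obtain ⟨ε, hε, hpos⟩ := (hev.and self_mem_nhdsWithin).exists
  have hpos : 0 < ε := hpos
  refine (hx y hy _ hε ⟨ε / (1 + ε), 1 / (1 + ε), by positivity, by positivity, by
    field_simp; ring, ?_⟩).1.symm
  rw [smul_add, smul_smul, smul_sub]
  match_scalars
  all_goals field_simp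
  ring

theorem finite_extremePoints_polyhedron {W : Set E} (hW : W.Finite) :
    ({x : E | ∀ w ∈ W, inner ℝ w x ≤ 1}.extremePoints ℝ).Finite := by
  refine Set.Finite.of_finite_image (f := fun x => {w ∈ W | inner ℝ w x = 1})
    (hW.powerset.subset ?_) ?_
  · rintro _ ⟨x, -, rfl⟩
    exact sep_subset _ _
  · intro x hx y hy hxy
    refine extremePoint_eq_of_active_subset hW hx (extremePoints_subset hy) fun w hw h => ?_
    have : w ∈ {w ∈ W | inner ℝ w x = 1} := ⟨hw, h⟩
    rw [show {w ∈ W | inner ℝ w x = 1} = {w ∈ W | inner ℝ w y = 1} from hxy] at this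
    exact this.2

theorem convexHull_extremePoints_polyhedron [FiniteDimensional ℝ E] {W : Set E} (hW : W.Finite)
    (hb : Bornology.IsBounded {x : E | ∀ w ∈ W, inner ℝ w x ≤ 1}) :
    convexHull ℝ ({x : E | ∀ w ∈ W, inner ℝ w x ≤ 1}.extremePoints ℝ) =
      {x : E | ∀ w ∈ W, inner ℝ w x ≤ 1} := by
  have hQ : {x : E | ∀ w ∈ W, inner ℝ w x ≤ 1} = ⋂ w ∈ W, {x : E | inner ℝ w x ≤ 1} := by
    ext; simp
  have hc : IsClosed {x : E | ∀ w ∈ W, inner ℝ w x ≤ 1} := by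
    rw [hQ]
    exact isClosed_biInter fun w _ => isClosed_le (by fun_prop) continuous_const
  have hconv : Convex ℝ {x : E | ∀ w ∈ W, inner ℝ w x ≤ 1} := by
    rw [hQ]
    exact convex_iInter₂ fun w _ => convex_halfSpace_le (innerₛₗ ℝ w).isLinear 1
  rw [← ((finite_extremePoints_polyhedron hW).isClosed_convexHull ℝ).closure_eq]
  exact closure_convexHull_extremePoints (Metric.isCompact_of_isClosed_isBounded hc hb) hconv

theorem inner_lt_one_of_mem_isOpen {Ω : Set E} (hΩ : IsOpen Ω) {w x : E}
    (hw : ∀ y ∈ Ω, inner ℝ w y ≤ 1) (hx : x ∈ Ω) : inner ℝ w x < 1 := by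
  have hc : Continuous fun ε : ℝ => (1 + ε) • x := by fun_prop
  have h0 : ∀ᶠ ε : ℝ in nhdsWithin 0 (Ioi 0), (1 + ε) • x ∈ Ω :=
    (hc.continuousAt.eventually_mem (by simpa using hΩ.mem_nhds hx)).filter_mono
      nhdsWithin_le_nhds
  obtain ⟨ε, hε, hpos⟩ := (h0.and self_mem_nhdsWithin).exists
  have hpos : 0 < ε := hpos
  have := hw _ hε
  rw [inner_smul_right] at this
  by_contra! h
  nlinarith

theorem exists_polytope_of_polyhedron [FiniteDimensional ℝ E] {Ω : Set E} (hO : IsOpen Ω)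
    (hb : Bornology.IsBounded Ω) {W : Set E} (hW : W.Finite)
    (hΩ : ∀ x, x ∈ Ω ↔ ∀ w ∈ W, inner ℝ w x < 1) :
    ∃ F : Finset E, Ω = interior (convexHull ℝ (F : Set E)) := by
  have hcl : {x : E | ∀ w ∈ W, inner ℝ w x ≤ 1} ⊆ closure Ω := by
    intro x hx
    have hc : Continuous fun ε : ℝ => ε • x := by fun_prop
    have := (hc.tendsto 1).mono_left (nhdsWithin_le_nhds (s := Iio 1))
    rw [one_smul] at this
    refine mem_closure_of_tendsto this ?_
    filter_upwards [Ioo_mem_nhdsLT (show (0 : ℝ) < 1 by norm_num)] with t ht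
    refine (hΩ _).2 fun w hw => ?_
    rw [inner_smul_right]
    nlinarith [hx w hw, ht.1, ht.2]
  refine ⟨(finite_extremePoints_polyhedron hW).toFinset, ?_⟩
  rw [Finite.coe_toFinset, convexHull_extremePoints_polyhedron hW (hb.closure.subset hcl)]
  refine subset_antisymm (interior_maximal (fun x hx w hw => ((hΩ x).1 hx w hw).le) hO) ?_
  refine fun x hx => (hΩ x).2 fun w hw => inner_lt_one_of_mem_isOpen isOpen_interior
    (fun y hy => (interior_subset hy : _ ∈ {x : E | ∀ w ∈ W, inner ℝ w x ≤ 1}) w hw) hx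

theorem exists_polyhedron_of_polytope [FiniteDimensional ℝ E] {F : Finset E}
    (h0 : (0 : E) ∈ interior (convexHull ℝ (F : Set E))) :
    ∃ W : Finset E, ∀ x, x ∈ interior (convexHull ℝ (F : Set E)) ↔ ∀ w ∈ W, inner ℝ w x < 1 := by
  set K : Set E := {y : E | ∀ v ∈ (F : Set E), inner ℝ v y ≤ 1} with hK
  have hpol : ∀ y ∈ K, ∀ x ∈ convexHull ℝ (F : Set E), inner ℝ y x ≤ 1 := by
    intro y hy x hx
    refine convexHull_min (t := {x : E | inner ℝ y x ≤ 1}) (fun v hv => ?_)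
      (convex_halfSpace_le (innerₛₗ ℝ y).isLinear 1) hx
    change inner ℝ y v ≤ 1
    rw [real_inner_comm]
    exact hy v hv
  have hb : Bornology.IsBounded K := by
    obtain ⟨r, hr, hball⟩ := Metric.isOpen_iff.1 isOpen_interior 0 h0
    refine (Metric.isBounded_closedBall (x := (0 : E)) (r := 2 / r)).subset fun y hy => ?_
    rw [mem_closedBall_zero_iff]
    by_cases hy0 : y = 0
    · rw [hy0, norm_zero]; positivity
    have hn : 0 < ‖y‖ := norm_pos_iff.2 hy0
    have hmem : (r / (2 * ‖y‖)) • y ∈ convexHull ℝ (F : Set E) := by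
      refine interior_subset (hball ?_)
      rw [mem_ball_zero_iff, norm_smul, Real.norm_of_nonneg (by positivity)]
      field_simp
      linarith
    have := hpol y hy _ hmem
    rw [inner_smul_right, real_inner_self_eq_norm_sq] at this
    rw [le_div_iff₀ hr]
    field_simp at this
    linarith
  refine ⟨(finite_extremePoints_polyhedron F.finite_toSet).toFinset, fun x => ⟨?_, ?_⟩⟩
  · intro hx w hw
    rw [Finite.mem_toFinset] at hw
    exact inner_lt_one_of_mem_isOpen isOpen_interior
      (fun y hy => hpol w (extremePoints_subset hw) y (interior_subset hy)) hx
  · intro hx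
    refine interior_maximal (s := convexHull ℝ (F : Set E))
      (t := ⋂ w ∈ (finite_extremePoints_polyhedron F.finite_toSet).toFinset,
        {x : E | inner ℝ w x < 1}) ?_
      (isOpen_biInter_finset fun w _ => isOpen_lt (by fun_prop) continuous_const)
      (by simpa using hx)
    intro z hz
    by_contra hzF
    obtain ⟨l, s, hl, hs⟩ := geometric_hahn_banach_closed_point (convex_convexHull ℝ (F : Set E))
      (F.finite_toSet.isClosed_convexHull ℝ) hzF
    have hs0 : 0 < s := by simpa using hl 0 (interior_subset h0)
    set y := (InnerProductSpace.toDual ℝ E).symm l with hy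
    have hyl : ∀ v, inner ℝ y v = l v := fun v => InnerProductSpace.toDual_symm_apply
    have hyK : s⁻¹ • y ∈ K := by
      intro v hv
      rw [real_inner_comm, real_inner_smul_left, hyl, inv_mul_le_iff₀ hs0, mul_one]
      exact (hl v (subset_convexHull ℝ _ hv)).le
    rw [hK, ← convexHull_extremePoints_polyhedron F.finite_toSet hb] at hyK
    have hle : inner ℝ (s⁻¹ • y) z ≤ 1 := by
      refine convexHull_min (t := {y : E | inner ℝ y z ≤ 1}) (fun v hv => ?_) ?_ hyK
      · simp only [mem_iInter] at hz
        exact le_of_lt (show inner ℝ v z < 1 from hz v ((Finite.mem_toFinset _).2 hv))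
      · simp_rw [real_inner_comm]
        exact convex_halfSpace_le (innerₛₗ ℝ z).isLinear 1
    rw [real_inner_smul_left, hyl, inv_mul_le_iff₀ hs0] at hle
    linarith

end Polyhedra

section HilbertDistance

theorem exists_frontier_on_ray {E : Type*} [NormedAddCommGroup E] [NormedSpace ℝ E] {Ω : Set E}
    (hO : IsOpen Ω) (hb : Bornology.IsBounded Ω) (hc : Convex ℝ Ω) {y v : E} (hy : y ∈ Ω)
    (hv : v ≠ 0) : ∃ r : ℝ, 0 < r ∧ y + r • v ∈ frontier Ω := by
  let e := Homeomorph.addLeft y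
  have hS : IsOpen (e ⁻¹' Ω) := hO.preimage e.continuous
  have h0 : (0 : E) ∈ e ⁻¹' Ω := by simpa [e] using hy
  have hSc : Convex ℝ (e ⁻¹' Ω) := hc.translate_preimage_right y
  have hSb : Bornology.IsBounded (e ⁻¹' Ω) := by
    rw [← e.image_symm, show e.symm = Homeomorph.addLeft (-y) from Homeomorph.addLeft_symm y]
    exact (LipschitzWith.of_dist_le_mul (K := 1) (fun a b => by simp)).isBounded_image hb
  have hg : 0 < gauge (e ⁻¹' Ω) v :=
    (gauge_pos (absorbent_nhds_zero (hS.mem_nhds h0))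
      ((NormedSpace.isVonNBounded_iff ℝ).2 hSb)).2 hv
  refine ⟨(gauge (e ⁻¹' Ω) v)⁻¹, by positivity, ?_⟩
  have := (gauge_eq_one_iff_mem_frontier (x := (gauge (e ⁻¹' Ω) v)⁻¹ • v) hSc
    (hS.mem_nhds h0)).1 (by
      rw [gauge_smul_of_nonneg (by positivity), smul_eq_mul, inv_mul_cancel₀ hg.ne'])
  rwa [← e.preimage_frontier] at this

variable {n : ℕ} {Ω : Set (Euc n)} {d : Euc n → Euc n → ℝ}

theorem IsHilbertDist.exists_eq_log (hΩ : IsConvexDomain Ω) (hd : IsHilbertDist Ω d)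
    {x y : Euc n} (hx : x ∈ Ω) (hy : y ∈ Ω) (hxy : x ≠ y) :
    ∃ s t : ℝ, s < 0 ∧ 1 < t ∧ x + s • (y - x) ∈ frontier Ω ∧ x + t • (y - x) ∈ frontier Ω ∧
      d x y = (1 / 2) * Real.log ((1 - s) / (-s) * (t / (t - 1))) := by
  obtain ⟨-, hO, hb, hc⟩ := hΩ
  obtain ⟨r, hr, hrf⟩ := exists_frontier_on_ray hO hb hc hx (sub_ne_zero.2 hxy)
  obtain ⟨r', hr', hrf'⟩ := exists_frontier_on_ray hO hb hc hy (sub_ne_zero.2 hxy.symm)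
  have ha : x + (-r) • (y - x) ∈ frontier Ω := by
    convert hrf using 2
    rw [neg_smul, ← smul_neg, neg_sub]
  have hb : x + (1 + r') • (y - x) ∈ frontier Ω := by
    convert hrf' using 1
    rw [add_smul, one_smul]
    abel
  have hn : 0 < ‖y - x‖ := norm_pos_iff.2 (sub_ne_zero.2 hxy.symm)
  refine ⟨-r, 1 + r', by linarith, by linarith, ha, hb, ?_⟩
  rw [hd.2 x hx y hy hxy _ _ ha hb ⟨-r, 1 + r', by linarith, by linarith, rfl, rfl⟩]
  have h1 : y - (x + (-r) • (y - x)) = (1 + r) • (y - x) := by module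
  have h2 : x - (x + (-r) • (y - x)) = r • (y - x) := by module
  have h3 : x - (x + (1 + r') • (y - x)) = -((1 + r') • (y - x)) := by module
  have h4 : y - (x + (1 + r') • (y - x)) = -(r' • (y - x)) := by module
  rw [h1, h2, h3, h4, norm_neg, norm_neg]
  simp only [norm_smul, Real.norm_eq_abs]
  rw [abs_of_pos hr, abs_of_pos hr', abs_of_pos (by linarith : 0 < 1 + r),
    abs_of_pos (by linarith : 0 < 1 + r')]
  congr 2
  rw [mul_div_mul_right _ _ hn.ne', mul_div_mul_right _ _ hn.ne']
  congr 2 <;> ring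

theorem le_one_of_mem_frontier {w : Euc n} (hw : ∀ z ∈ Ω, inner ℝ w z < 1) {z : Euc n}
    (hz : z ∈ frontier Ω) : inner ℝ w z ≤ 1 :=
  closure_minimal (t := {z | inner ℝ w z ≤ 1}) (fun z hz => (hw z hz).le)
    (isClosed_le (by fun_prop) continuous_const) (frontier_subset_closure hz)

theorem IsHilbertDist.log_le (hΩ : IsConvexDomain Ω) (hd : IsHilbertDist Ω d)
    {v w : Euc n} (hv : ∀ z ∈ Ω, inner ℝ v z < 1) (hw : ∀ z ∈ Ω, inner ℝ w z < 1)
    {x y : Euc n} (hx : x ∈ Ω) (hy : y ∈ Ω) (hxy : x ≠ y) :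
    (1 / 2) * Real.log ((1 - inner ℝ v y) / (1 - inner ℝ v x) *
      ((1 - inner ℝ w x) / (1 - inner ℝ w y))) ≤ d x y := by
  obtain ⟨s, t, hs, ht, ha, hb, h⟩ := hd.exists_eq_log hΩ hx hy hxy
  rw [h]
  have hvx := hv x hx
  have hvy := hv y hy
  have hwx := hw x hx
  have hwy := hw y hy
  have ha' := le_one_of_mem_frontier hv ha
  have hb' := le_one_of_mem_frontier hw hb
  rw [inner_add_right, inner_smul_right, inner_sub_right] at ha' hb'
  have h1 : 0 < (1 - inner ℝ v y) / (1 - inner ℝ v x) := div_pos (by linarith) (by linarith)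
  have h2 : 0 < (1 - inner ℝ w x) / (1 - inner ℝ w y) := div_pos (by linarith) (by linarith)
  have h3 : (1 - inner ℝ v y) / (1 - inner ℝ v x) ≤ (1 - s) / (-s) := by
    rw [div_le_div_iff₀ (by linarith) (by linarith)]
    nlinarith
  have h4 : (1 - inner ℝ w x) / (1 - inner ℝ w y) ≤ t / (t - 1) := by
    rw [div_le_div_iff₀ (by linarith) (by linarith)]
    nlinarith
  have h5 : 0 ≤ (1 - s) / (-s) := h1.le.trans h3
  gcongr

theorem IsHilbertDist.exists_eq_log_of_polyhedron (hΩ : IsConvexDomain Ω)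
    (hd : IsHilbertDist Ω d) {W : Finset (Euc n)} (hW : ∀ x, x ∈ Ω ↔ ∀ w ∈ W, inner ℝ w x < 1)
    {x y : Euc n} (hx : x ∈ Ω) (hy : y ∈ Ω) (hxy : x ≠ y) :
    ∃ v ∈ W, ∃ w ∈ W, d x y = (1 / 2) * Real.log ((1 - inner ℝ v y) / (1 - inner ℝ v x) *
      ((1 - inner ℝ w x) / (1 - inner ℝ w y))) := by
  obtain ⟨s, t, hs, ht, ha, hb, h⟩ := hd.exists_eq_log hΩ hx hy hxy
  have key : ∀ z ∈ frontier Ω, ∃ w ∈ W, inner ℝ w z = 1 := by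
    intro z hz
    have hzn : z ∉ Ω := fun h => (hΩ.2.1.inter_frontier_eq.le ⟨h, hz⟩)
    rw [hW] at hzn
    push Not at hzn
    obtain ⟨w, hw, hwz⟩ := hzn
    exact ⟨w, hw, le_antisymm (le_one_of_mem_frontier (fun x hx => (hW x).1 hx w hw) hz) hwz⟩
  obtain ⟨v, hv, hva⟩ := key _ ha
  obtain ⟨w, hw, hwb⟩ := key _ hb
  refine ⟨v, hv, w, hw, ?_⟩
  rw [h]
  have hvx := (hW x).1 hx v hv
  have hwy := (hW y).1 hy w hw
  rw [inner_add_right, inner_smul_right, inner_sub_right] at hva hwb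
  congr 3
  · rw [div_eq_div_iff (by linarith) (by linarith)]
    linarith
  · rw [div_eq_div_iff (by linarith) (by linarith)]
    linarith

theorem exists_isometric_embedding_of_polyhedron (hΩ : IsConvexDomain Ω)
    (hd : IsHilbertDist Ω d) {W : Finset (Euc n)}
    (hW : ∀ x, x ∈ Ω ↔ ∀ w ∈ W, inner ℝ w x < 1) :
    ∃ (m : ℕ) (Nm : (Fin m → ℝ) → ℝ), IsNorm Nm ∧
      ∃ f : Euc n → (Fin m → ℝ), ∀ x ∈ Ω, ∀ y ∈ Ω, Nm (f x - f y) = d x y := by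
  let e := Fintype.equivFin (W × W)
  refine ⟨Fintype.card (W × W), fun z => (1 / 2) * ‖z‖,
    ⟨fun z => by positivity, fun z => by simp, fun c z => by simp only [norm_smul, Real.norm_eq_abs]; ring,
      fun z z' => by linarith [norm_add_le z z']⟩,
    fun x k => Real.log ((1 - inner ℝ ((e.symm k).2 : Euc n) x) /
      (1 - inner ℝ ((e.symm k).1 : Euc n) x)), fun x hx y hy => ?_⟩
  by_cases hxy : x = y
  · subst hxy
    simp [hd.1 x hx]
  have hpos : ∀ w ∈ W, ∀ z ∈ Ω, 0 < 1 - inner ℝ w z := fun w hw z hz =>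
    sub_pos.2 ((hW z).1 hz w hw)
  have hlog : ∀ v ∈ W, ∀ w ∈ W, Real.log ((1 - inner ℝ v y) / (1 - inner ℝ v x) *
      ((1 - inner ℝ w x) / (1 - inner ℝ w y))) =
      Real.log ((1 - inner ℝ w x) / (1 - inner ℝ v x)) -
        Real.log ((1 - inner ℝ w y) / (1 - inner ℝ v y)) := by
    intro v hv w hw
    have h1 := hpos v hv x hx
    have h2 := hpos v hv y hy
    have h3 := hpos w hw x hx
    have h4 := hpos w hw y hy
    rw [← Real.log_div (by positivity) (by positivity)]
    congr 1
    field_simp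
  have hle : ∀ v ∈ W, ∀ w ∈ W, Real.log ((1 - inner ℝ w x) / (1 - inner ℝ v x)) -
      Real.log ((1 - inner ℝ w y) / (1 - inner ℝ v y)) ≤ 2 * d x y := by
    intro v hv w hw
    have := hd.log_le hΩ (fun z hz => (hW z).1 hz v hv) (fun z hz => (hW z).1 hz w hw) hx hy hxy
    rw [hlog v hv w hw] at this
    linarith
  have hswap : ∀ v w z : Euc n, Real.log ((1 - inner ℝ w z) / (1 - inner ℝ v z)) =
      -Real.log ((1 - inner ℝ v z) / (1 - inner ℝ w z)) := by
    intro v w z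
    rw [← Real.log_inv, inv_div]
  obtain ⟨v, hv, w, hw, h⟩ := hd.exists_eq_log_of_polyhedron hΩ hW hx hy hxy
  rw [hlog v hv w hw] at h
  refine le_antisymm ?_ ?_
  · have hd0 : 0 ≤ 2 * d x y := by simpa using hle v hv v hv
    change 1 / 2 * ‖_‖ ≤ _
    rw [one_div, inv_mul_le_iff₀ two_pos, pi_norm_le_iff_of_nonneg hd0]
    intro k
    rw [Real.norm_eq_abs, Pi.sub_apply, abs_le]
    refine ⟨?_, hle _ (e.symm k).1.2 _ (e.symm k).2.2⟩
    have := hle _ (e.symm k).2.2 _ (e.symm k).1.2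
    rw [hswap, hswap _ _ y] at this
    linarith
  · rw [h]
    change _ ≤ 1 / 2 * ‖_‖
    refine mul_le_mul_of_nonneg_left ?_ (by norm_num)
    refine le_trans ?_ (norm_le_pi_norm _ (e ⟨⟨v, hv⟩, ⟨w, hw⟩⟩))
    simpa only [Pi.sub_apply, Equiv.symm_apply_apply] using Real.le_norm_self _

end HilbertDistance

section Gauge

variable {E : Type*} [NormedAddCommGroup E] [NormedSpace ℝ E] {Ω : Set E}

theorem fderiv_gauge_le (hc : Convex ℝ Ω) (h0 : Ω ∈ nhds 0) {p : E} {l : E →L[ℝ] ℝ}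
    (hp : HasFDerivAt (gauge Ω) l p) (q : E) : l q ≤ gauge Ω q := by
  have hline : HasDerivAt (fun t : ℝ => gauge Ω (p + t • q)) (l q) 0 := by
    have h1 : HasDerivAt (fun t : ℝ => p + t • q) q 0 := by
      simpa using ((hasDerivAt_id (0 : ℝ)).smul_const q).const_add p
    exact HasFDerivAt.comp_hasDerivAt (0 : ℝ) (by simpa using hp) h1
  refine le_of_tendsto hline.tendsto_slope_zero_right ?_
  filter_upwards [self_mem_nhdsWithin] with t ht
  have ht : 0 < t := ht
  rw [smul_eq_mul, inv_mul_le_iff₀ ht, zero_add, zero_smul, add_zero]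
  have h := gauge_add_le hc (absorbent_nhds_zero h0) p (t • q)
  rw [gauge_smul_of_nonneg ht.le, smul_eq_mul] at h
  linarith

theorem fderiv_gauge_self {p : E} {l : E →L[ℝ] ℝ} (hp : HasFDerivAt (gauge Ω) l p) :
    l p = gauge Ω p := by
  have hline : HasDerivAt (fun t : ℝ => gauge Ω (t • p)) (l p) 1 := by
    have h1 : HasDerivAt (fun t : ℝ => t • p) p 1 := by
      simpa using (hasDerivAt_id (1 : ℝ)).smul_const p
    exact HasFDerivAt.comp_hasDerivAt (1 : ℝ) (by simpa using hp) h1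
  have h2 : HasDerivAt (fun t : ℝ => t * gauge Ω p) (gauge Ω p) 1 := by
    simpa using (hasDerivAt_id (1 : ℝ)).mul_const (gauge Ω p)
  refine hline.unique (h2.congr_of_eventuallyEq ?_)
  filter_upwards [lt_mem_nhds (zero_lt_one (α := ℝ))] with t ht
  rw [gauge_smul_of_nonneg ht.le, smul_eq_mul]

theorem eq_fderiv_gauge {p : E} {l l' : E →L[ℝ] ℝ} (hp : HasFDerivAt (gauge Ω) l p)
    (hl' : ∀ q, l' q ≤ gauge Ω q) (h : gauge Ω p ≤ l' p) : l' = l := by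
  have hmin : IsLocalMin (fun q => gauge Ω q - l' q) p :=
    Eventually.of_forall fun q => by linarith [hl' q]
  exact (sub_eq_zero.1 (hmin.hasFDerivAt_eq_zero (hp.sub l'.hasFDerivAt))).symm

end Gauge

theorem card_le_of_separated_norm {m : ℕ} {N : (Fin m → ℝ) → ℝ} (hN : IsNorm N) {ι : Type*}
    (s : Finset ι) (v : ι → Fin m → ℝ) {L : ℝ} (hL : 0 < L) (h1 : ∀ i ∈ s, N (v i) ≤ L)
    (h2 : ∀ i ∈ s, ∀ j ∈ s, i ≠ j → L / 2 ≤ N (v i - v j)) : s.card ≤ 5 ^ m := by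
  have main : ∀ {E : Type} [AddCommGroup E] [Module ℝ E] [FiniteDimensional ℝ E] (N : E → ℝ)
      (v : ι → E), (∀ x, 0 ≤ N x) → (∀ x, N x = 0 ↔ x = 0) →
      (∀ (c : ℝ) (x), N (c • x) = |c| * N x) → (∀ x y, N (x + y) ≤ N x + N y) →
      (∀ i ∈ s, N (v i) ≤ L) → (∀ i ∈ s, ∀ j ∈ s, i ≠ j → L / 2 ≤ N (v i - v j)) →
      s.card ≤ 5 ^ Module.finrank ℝ E := by
    intro E _ _ _ N v hN0 hNz hNs hNa h1 h2
    let : Norm E := ⟨N⟩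
    have core : NormedSpace.Core ℝ E :=
      { norm_nonneg := hN0, norm_smul := hNs, norm_triangle := hNa, norm_eq_zero_iff := hNz }
    let : NormedAddCommGroup E := NormedAddCommGroup.ofCore core
    let : NormedSpace ℝ E := NormedSpace.ofCore core
    classical
    have hnorm : ∀ x : E, ‖(2 / L) • x‖ = 2 / L * N x := fun x => by
      rw [norm_smul, Real.norm_of_nonneg (by positivity)]
      rfl
    have hsep : ∀ i ∈ s, ∀ j ∈ s, i ≠ j → 1 ≤ ‖(2 / L) • v i - (2 / L) • v j‖ := by
      intro i hi j hj hij
      rw [← smul_sub, hnorm]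
      have := h2 i hi j hj hij
      rw [div_mul_eq_mul_div, le_div_iff₀ hL]
      linarith
    have hinj : Set.InjOn (fun i => (2 / L) • v i) s := by
      intro i hi j hj hij
      by_contra hne
      have := hsep i hi j hj hne
      rw [show (2 / L) • v i = (2 / L) • v j from hij, sub_self, norm_zero] at this
      linarith
    rw [← Finset.card_image_of_injOn hinj]
    refine Besicovitch.card_le_of_separated _ ?_ ?_
    · simp only [Finset.forall_mem_image]
      intro i hi
      rw [hnorm, div_mul_eq_mul_div, div_le_iff₀ hL]
      linarith [h1 i hi]
    · simp only [Finset.forall_mem_image]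
      intro i hi j hj hij
      exact hsep i hi j hj fun h => hij (by rw [h])
  simpa using main N v hN.1 hN.2.1 hN.2.2.1 hN.2.2.2 h1 h2

section SmoothPoints

variable {n : ℕ} {Ω : Set (Euc n)} {d : Euc n → Euc n → ℝ}

/-- The vectors representing the differentials of the gauge of `Ω` at the points where it is
differentiable and positive. -/
def gaugeGradients (Ω : Set (Euc n)) : Set (Euc n) :=
  {w | ∃ p, 0 < gauge Ω p ∧ HasFDerivAt (gauge Ω) (innerSL ℝ w) p}

theorem inner_le_gauge (hΩ : IsConvexDomain Ω) (h0 : 0 ∈ Ω) {w : Euc n}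
    (hw : w ∈ gaugeGradients Ω) (q : Euc n) : inner ℝ w q ≤ gauge Ω q := by
  obtain ⟨p, -, hp⟩ := hw
  simpa using fderiv_gauge_le hΩ.2.2.2 (hΩ.2.1.mem_nhds h0) hp q

theorem mem_iff_gauge_lt_one (hΩ : IsConvexDomain Ω) (h0 : 0 ∈ Ω) (x : Euc n) :
    x ∈ Ω ↔ gauge Ω x < 1 :=
  ⟨fun hx => interior_subset_gauge_lt_one Ω (hΩ.2.1.interior_eq.symm ▸ hx),
    fun hx => setOfPred_gauge_lt_one_subset_self hΩ.2.2.2 h0 (absorbent_nhds_zero (hΩ.2.1.mem_nhds h0)) hx⟩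

theorem exists_contact_point (hΩ : IsConvexDomain Ω) (h0 : 0 ∈ Ω) {w : Euc n}
    (hw : w ∈ gaugeGradients Ω) :
    ∃ u, gauge Ω u = 1 ∧ inner ℝ w u = 1 ∧ ∀ v ∈ gaugeGradients Ω, v ≠ w → inner ℝ v u < 1 := by
  obtain ⟨p, hp0, hp⟩ := hw
  refine ⟨(gauge Ω p)⁻¹ • p, ?_, ?_, fun v hv hvw => ?_⟩
  · rw [gauge_smul_of_nonneg (by positivity), smul_eq_mul, inv_mul_cancel₀ hp0.ne']
  · have : inner ℝ w p = gauge Ω p := by simpa using fderiv_gauge_self hp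
    rw [inner_smul_right, this, inv_mul_cancel₀ hp0.ne']
  · by_contra! h
    rw [inner_smul_right, le_inv_mul_iff₀ hp0, mul_one] at h
    have heq : innerSL ℝ v = innerSL ℝ w :=
      eq_fderiv_gauge hp (fun q => by simpa using inner_le_gauge hΩ h0 hv q) (by simpa using h)
    exact hvw (ext_inner_right ℝ fun q => by simpa using DFunLike.congr_fun heq q)

theorem mem_iff_forall_gaugeGradients (hΩ : IsConvexDomain Ω) (h0 : 0 ∈ Ω)
    (hfin : (gaugeGradients Ω).Finite) (x : Euc n) :
    x ∈ Ω ↔ ∀ w ∈ gaugeGradients Ω, inner ℝ w x < 1 := by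
  rw [mem_iff_gauge_lt_one hΩ h0]
  refine ⟨fun hx w hw => (inner_le_gauge hΩ h0 hw x).trans_lt hx, fun hx => ?_⟩
  obtain ⟨K, hK⟩ := hΩ.2.2.2.lipschitz_gauge (hΩ.2.1.mem_nhds h0)
  have hdense := Measure.dense_of_ae (hK.ae_differentiableAt (μ := volume))
  have hclosed : IsClosed ({p | gauge Ω p ≤ 0} ∪
      ⋃ w ∈ gaugeGradients Ω, {p | gauge Ω p ≤ inner ℝ w p}) :=
    (isClosed_le hK.continuous continuous_const).union
      (hfin.isClosed_biUnion fun w _ => isClosed_le hK.continuous (by fun_prop))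
  have hsub : {p | DifferentiableAt ℝ (gauge Ω) p} ⊆ {p | gauge Ω p ≤ 0} ∪
      ⋃ w ∈ gaugeGradients Ω, {p | gauge Ω p ≤ inner ℝ w p} := by
    intro p hp
    by_cases hp0 : gauge Ω p ≤ 0
    · exact Or.inl hp0
    · have hp' : DifferentiableAt ℝ (gauge Ω) p := hp
      have hw : HasFDerivAt (gauge Ω)
          (innerSL ℝ ((InnerProductSpace.toDual ℝ (Euc n)).symm (fderiv ℝ (gauge Ω) p))) p := by
        exact ((InnerProductSpace.toDual ℝ (Euc n)).apply_symm_apply _).symm ▸ hp'.hasFDerivAt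
      refine Or.inr (mem_biUnion (x := (InnerProductSpace.toDual ℝ (Euc n)).symm
        (fderiv ℝ (gauge Ω) p)) ⟨p, not_le.1 hp0, hw⟩ ?_)
      exact (fderiv_gauge_self hw).ge
  have hmem := hclosed.closure_subset_iff.2 hsub (hdense x)
  rcases hmem with h | h
  · exact lt_of_le_of_lt h zero_lt_one
  · simp only [mem_iUnion] at h
    obtain ⟨w, hw, h⟩ := h
    exact lt_of_le_of_lt h (hx w hw)

theorem IsHilbertDist.zero_smul_le (hΩ : IsConvexDomain Ω) (hd : IsHilbertDist Ω d)
    (h0 : 0 ∈ Ω) {u : Euc n} (hu : gauge Ω u = 1) {t : ℝ} (ht0 : 0 < t) (ht1 : t < 1) :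
    d 0 (t • u) ≤ (1 / 2) * (Real.log (1 + gauge Ω (-u)) - Real.log (1 - t)) := by
  have hnhds := hΩ.2.1.mem_nhds h0
  have hu0 : u ≠ 0 := by
    rintro rfl
    simp at hu
  have htu : t • u ∈ Ω := by
    rw [mem_iff_gauge_lt_one hΩ h0, gauge_smul_of_nonneg ht0.le, hu]
    simpa using ht1
  obtain ⟨s, r, hs, hr, ha, hb, h⟩ := hd.exists_eq_log hΩ h0 htu (smul_ne_zero ht0.ne' hu0).symm
  rw [zero_add, sub_zero, ← gauge_eq_one_iff_mem_frontier hΩ.2.2.2 hnhds] at ha hb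
  rw [smul_smul, gauge_smul_of_nonneg (by nlinarith), hu, smul_eq_mul, mul_one] at hb
  rw [smul_smul, show (s * t) • u = (-s * t) • (-u) by module,
    gauge_smul_of_nonneg (by nlinarith), smul_eq_mul] at ha
  have hg : 0 ≤ gauge Ω (-u) := gauge_nonneg _
  rw [h, ← Real.log_div (by positivity) (by linarith)]
  have e1 : (1 - s) / (-s) = 1 + t * gauge Ω (-u) := by
    rw [div_eq_iff (by linarith)]
    linear_combination -ha
  have e2 : r / (r - 1) = 1 / (1 - t) := by
    rw [div_eq_div_iff (by linarith) (by linarith)]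
    linear_combination -hb
  rw [e1, e2, mul_one_div]
  have h1t : 0 < 1 - t := by linarith
  gcongr
  nlinarith

theorem IsHilbertDist.le_smul_smul (hΩ : IsConvexDomain Ω) (hd : IsHilbertDist Ω d) (h0 : 0 ∈ Ω)
    {v w : Euc n} (hv : ∀ q, inner ℝ v q ≤ gauge Ω q) (hw : ∀ q, inner ℝ w q ≤ gauge Ω q)
    {x y : Euc n} (hx : gauge Ω x = 1) (hy : gauge Ω y = 1)
    (hvx : inner ℝ v x = 1) (hwy : inner ℝ w y = 1) {δ : ℝ} (hδ0 : 0 < δ) (hδ1 : δ < 1)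
    (hvy : inner ℝ v y ≤ 1 - δ) (hwx : inner ℝ w x ≤ 1 - δ)
    {t : ℝ} (ht0 : 0 < t) (ht1 : t < 1) :
    Real.log δ - Real.log (1 - t) ≤ d (t • x) (t • y) := by
  have hmem : ∀ z, gauge Ω z = 1 → t • z ∈ Ω := by
    intro z hz
    rw [mem_iff_gauge_lt_one hΩ h0, gauge_smul_of_nonneg ht0.le, hz]
    simpa using ht1
  have hlt : ∀ v : Euc n, (∀ q, inner ℝ v q ≤ gauge Ω q) → ∀ z ∈ Ω, inner ℝ v z < 1 :=
    fun v hv z hz => (hv z).trans_lt ((mem_iff_gauge_lt_one hΩ h0 z).1 hz)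
  have hne : t • x ≠ t • y := by
    intro h
    rw [smul_right_injective _ ht0.ne' h] at hvx
    linarith
  refine le_trans ?_ (hd.log_le hΩ (hlt v hv) (hlt w hw) (hmem x hx) (hmem y hy) hne)
  rw [inner_smul_right, inner_smul_right, inner_smul_right, inner_smul_right, hvx, hwy, mul_one]
  have h1t : 0 < 1 - t := by linarith
  have h1 : δ ≤ 1 - t * inner ℝ v y := by nlinarith
  have h2 : δ ≤ 1 - t * inner ℝ w x := by nlinarith
  have h3 : Real.log δ - Real.log (1 - t) = 1 / 2 * Real.log (δ / (1 - t) * (δ / (1 - t))) := by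
    rw [Real.log_mul (by positivity) (by positivity), Real.log_div (by positivity) (by positivity)]
    ring
  have h4 : 0 ≤ (1 - t * inner ℝ v y) / (1 - t) := div_nonneg (hδ0.le.trans h1) h1t.le
  rw [h3]
  gcongr

theorem finite_gaugeGradients (hΩ : IsConvexDomain Ω) (hd : IsHilbertDist Ω d) (h0 : 0 ∈ Ω)
    {m : ℕ} {N : (Fin m → ℝ) → ℝ} (hN : IsNorm N) {f : Euc n → Fin m → ℝ}
    (hf : ∀ x ∈ Ω, ∀ y ∈ Ω, N (f x - f y) = d x y) : (gaugeGradients Ω).Finite := by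
  by_contra hinf
  obtain ⟨s, hs, hcard⟩ := Set.Infinite.exists_subset_card_eq hinf (5 ^ m + 1)
  choose! u hu1 hu2 hu3 using fun w (hw : w ∈ gaugeGradients Ω) => exists_contact_point hΩ h0 hw
  have ht : ∀ L : ℝ, 0 < L → 0 < 1 - Real.exp (-L) ∧ 1 - Real.exp (-L) < 1 := fun L hL =>
    ⟨by simpa using hL, by simpa using Real.exp_pos (-L)⟩
  have hlog : ∀ L : ℝ, Real.log (1 - (1 - Real.exp (-L))) = -L := fun L => by
    rw [sub_sub_cancel, Real.log_exp]
  have hmem : ∀ L : ℝ, 0 < L → ∀ w ∈ s, (1 - Real.exp (-L)) • u w ∈ Ω := fun L hL w hw => by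
    rw [mem_iff_gauge_lt_one hΩ h0, gauge_smul_of_nonneg (ht L hL).1.le, hu1 w (hs hw),
      smul_eq_mul, mul_one]
    exact (ht L hL).2
  have hnear : ∀ᶠ L : ℝ in atTop, ∀ w ∈ s, d 0 ((1 - Real.exp (-L)) • u w) ≤ L := by
    rw [Filter.eventually_all_finset]
    intro w hw
    filter_upwards [eventually_gt_atTop 0,
      eventually_ge_atTop (Real.log (1 + gauge Ω (-u w)))] with L hL hL'
    have := hd.zero_smul_le hΩ h0 (hu1 w (hs hw)) (ht L hL).1 (ht L hL).2
    rw [hlog] at this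
    linarith
  have hfar : ∀ᶠ L : ℝ in atTop, ∀ v ∈ s, ∀ w ∈ s, v ≠ w →
      L / 2 ≤ d ((1 - Real.exp (-L)) • u v) ((1 - Real.exp (-L)) • u w) := by
    rw [Filter.eventually_all_finset]
    intro v hv
    rw [Filter.eventually_all_finset]
    intro w hw
    by_cases hvw : v = w
    · simp [hvw]
    have hvy := hu3 w (hs hw) v (hs hv) hvw
    have hwx := hu3 v (hs hv) w (hs hw) (Ne.symm hvw)
    obtain ⟨δ, hδ0, hδ⟩ := exists_between
      (show 0 < min 1 (min (1 - inner ℝ v (u w)) (1 - inner ℝ w (u v))) from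
        lt_min one_pos (lt_min (by linarith) (by linarith)))
    rw [lt_min_iff, lt_min_iff] at hδ
    filter_upwards [eventually_gt_atTop 0, eventually_ge_atTop (-2 * Real.log δ)] with L hL hL' _
    have := hd.le_smul_smul hΩ h0 (inner_le_gauge hΩ h0 (hs hv)) (inner_le_gauge hΩ h0 (hs hw))
      (hu1 v (hs hv)) (hu1 w (hs hw)) (hu2 v (hs hv)) (hu2 w (hs hw)) hδ0 hδ.1
      (by linarith) (by linarith) (ht L hL).1 (ht L hL).2
    rw [hlog] at this
    linarith
  obtain ⟨L, hL1, hL2, hL⟩ := (hnear.and (hfar.and (eventually_gt_atTop 0))).exists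
  have := card_le_of_separated_norm hN s
    (fun w => f 0 - f ((1 - Real.exp (-L)) • u w)) hL
    (fun w hw => by
      rw [hf 0 h0 _ (hmem L hL w hw)]
      exact hL1 w hw)
    (fun v hv w hw hvw => by
      rw [sub_sub_sub_cancel_left, hf _ (hmem L hL w hw) _ (hmem L hL v hv)]
      exact hL2 w hw v hv (Ne.symm hvw))
  omega

theorem polytope_iff_isometric_embedding_of_zero_mem (hΩ : IsConvexDomain Ω)
    (hd : IsHilbertDist Ω d) (h0 : 0 ∈ Ω) :
    (∃ F : Finset (Euc n), Ω = interior (convexHull ℝ (↑F : Set (Euc n)))) ↔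
    (∃ (m : ℕ) (Nm : (Fin m → ℝ) → ℝ), IsNorm Nm ∧
      ∃ f : Euc n → (Fin m → ℝ), ∀ x ∈ Ω, ∀ y ∈ Ω, Nm (f x - f y) = d x y) := by
  constructor
  · rintro ⟨F, rfl⟩
    obtain ⟨W, hW⟩ := exists_polyhedron_of_polytope h0
    exact exists_isometric_embedding_of_polyhedron hΩ hd hW
  · rintro ⟨m, N, hN, f, hf⟩
    have hfin := finite_gaugeGradients hΩ hd h0 hN hf
    exact exists_polytope_of_polyhedron hΩ.2.1 hΩ.2.2.1 hfin
      (mem_iff_forall_gaugeGradients hΩ h0 hfin)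

end SmoothPoints

section Translation

variable {n : ℕ} {Ω : Set (Euc n)} {d : Euc n → Euc n → ℝ}

theorem IsConvexDomain.preimage_add (hΩ : IsConvexDomain Ω) (o : Euc n) :
    IsConvexDomain ((o + ·) ⁻¹' Ω) := by
  obtain ⟨hne, hO, hb, hc⟩ := hΩ
  refine ⟨hne.preimage (add_left_surjective o), hO.preimage (continuous_const_add o), ?_,
    hc.translate_preimage_right o⟩
  have : (o + ·) ⁻¹' Ω = (-o + ·) '' Ω := by simp
  rw [this]
  exact (LipschitzWith.of_dist_le_mul (K := 1) (fun a b => by simp)).isBounded_image hb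

theorem IsHilbertDist.preimage_add (hd : IsHilbertDist Ω d) (o : Euc n) :
    IsHilbertDist ((o + ·) ⁻¹' Ω) (fun x y => d (o + x) (o + y)) := by
  refine ⟨fun p hp => hd.1 _ hp, fun p hp q hq hpq a b ha hb ⟨s, t, hs, ht, hsa, htb⟩ => ?_⟩
  have hfr := (Homeomorph.addLeft o).preimage_frontier Ω
  have ha' : o + a ∈ frontier Ω := hfr.symm.le ha
  have hb' : o + b ∈ frontier Ω := hfr.symm.le hb
  have := hd.2 _ hp _ hq (fun h => hpq (add_left_cancel h)) _ _ ha' hb'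
    ⟨s, t, hs, ht, by rw [hsa]; module, by rw [htb]; module⟩
  simpa only [add_sub_add_left_eq_sub] using this

theorem exists_polytope_preimage_add_iff (o : Euc n) :
    (∃ F : Finset (Euc n), (o + ·) ⁻¹' Ω = interior (convexHull ℝ (↑F : Set (Euc n)))) ↔
      ∃ F : Finset (Euc n), Ω = interior (convexHull ℝ (↑F : Set (Euc n))) := by
  have key : ∀ (o : Euc n) (Ω : Set (Euc n)),
      (∃ F : Finset (Euc n), Ω = interior (convexHull ℝ (↑F : Set (Euc n)))) →
      ∃ F : Finset (Euc n), (o + ·) '' Ω = interior (convexHull ℝ (↑F : Set (Euc n))) := by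
    rintro o _ ⟨F, rfl⟩
    classical
    refine ⟨F.image (o + ·), ?_⟩
    rw [Finset.coe_image]
    exact ((Homeomorph.addLeft o).image_interior _).trans
      (congrArg interior (convexHull_vadd (𝕜 := ℝ) o (F : Set (Euc n))).symm)
  constructor
  · intro h
    have := key o _ h
    rwa [image_preimage_eq _ (add_left_surjective o)] at this
  · intro h
    have := key (-o) _ h
    have e : (o + ·) ⁻¹' Ω = (-o + ·) '' Ω := by simp
    rwa [e]

end Translation

/-- **Lins / Colbois–Verovic.**  For a convex domain `Ω ⊆ ℝⁿ` the following are equivalent: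
(a) `Ω` is the interior of a bounded convex polytope; (b) the Hilbert geometry `(Ω, d_Ω)` can
be isometrically embedded in a finite-dimensional normed vector space. -/
theorem polytope_iff_isometric_embedding {n : ℕ}
    (Ω : Set (Euc n)) (hΩ : IsConvexDomain Ω)
    (d : Euc n → Euc n → ℝ) (hd : IsHilbertDist Ω d) :
    (∃ F : Finset (Euc n), Ω = interior (convexHull ℝ (↑F : Set (Euc n)))) ↔
    (∃ (m : ℕ) (Nm : (Fin m → ℝ) → ℝ), IsNorm Nm ∧
      ∃ f : Euc n → (Fin m → ℝ), ∀ x ∈ Ω, ∀ y ∈ Ω, Nm (f x - f y) = d x y) := by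
  obtain ⟨o, ho⟩ := hΩ.1
  rw [← exists_polytope_preimage_add_iff o, polytope_iff_isometric_embedding_of_zero_mem
    (hΩ.preimage_add o) (hd.preimage_add o) (by simpa using ho)]
  refine exists_congr fun m => exists_congr fun N => and_congr_right fun _ => ⟨?_, ?_⟩
  · rintro ⟨f, hf⟩
    refine ⟨fun x => f (-o + x), fun x hx y hy => ?_⟩
    simpa using hf (-o + x) (by simpa using hx) (-o + y) (by simpa using hy)
  · rintro ⟨f, hf⟩
    exact ⟨fun x => f (o + x), fun x hx y hy => hf _ hx _ hy⟩
end
end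

section
/- Let P be a bounded convex polytope in ℝⁿ with non-empty interior and exactly N+1 faces of dimension n−1. Then there exist an N-dimensional simplex S_N in ℝᴺ and an n-dimensional affine subspace A_n of ℝᴺ such that P is affinely equivalent to A_n ∩ S_N (i.e., there is an injective affine map from ℝⁿ to ℝᴺ mapping P onto A_n ∩ S_N). -/
open Set Filter MeasureTheory

noncomputable section

/-- Two points `A, B` of a convex set `K` are in the same face if `A = B` or there is a
segment `[C,D] ⊆ K` containing `[A,B]` with `C ≠ A, B` and `D ≠ A, B`. -/
def FaceRel {V : Type*} [AddCommGroup V] [Module ℝ V] (K : Set V) (A B : V) : Prop :=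
  A = B ∨ ∃ C D : V, segment ℝ C D ⊆ K ∧ segment ℝ A B ⊆ segment ℝ C D ∧
    C ≠ A ∧ C ≠ B ∧ D ≠ A ∧ D ≠ B

/-- The face of the convex set `K` containing the point `A`: its equivalence class under
`FaceRel`. -/
def faceOf {V : Type*} [AddCommGroup V] [Module ℝ V] (K : Set V) (A : V) : Set V :=
  {B ∈ K | FaceRel K A B}

/-- The set of `k`-dimensional faces of the convex set `K`. -/
def facesOfDim {V : Type*} [AddCommGroup V] [Module ℝ V] [Module.Finite ℝ V]
    (K : Set V) (k : ℕ) : Set (Set V) :=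
  {s | ∃ A ∈ K, s = faceOf K A ∧ Module.finrank ℝ (affineSpan ℝ s).direction = k}

/-- A family of affine functions cutting out a compact set on which they are simultaneously
positive somewhere satisfies a linear relation with positive coefficients: differentiate the
product of the functions at its maximum. -/
theorem exists_pos_sum_smul_linear_eq_zero {ι E : Type*} [Fintype ι] [NormedAddCommGroup E]
    [NormedSpace ℝ E] [FiniteDimensional ℝ E] (b : ι → E →ᵃ[ℝ] ℝ)
    (hcomp : IsCompact {x | ∀ i, 0 ≤ b i x}) {x₀ : E} (hx₀ : ∀ i, 0 < b i x₀) :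
    ∃ c : ι → ℝ, (∀ i, 0 < c i) ∧ ∑ i, c i • (b i).linear = 0 := by
  classical
  have hb : ∀ i, Continuous (b i) := fun i => (b i).continuous_of_finiteDimensional
  obtain ⟨z, hz, hmax⟩ := hcomp.exists_isMaxOn ⟨x₀, fun i => (hx₀ i).le⟩
    (f := fun x => ∏ i, b i x) (by fun_prop)
  have hprod : 0 < ∏ i, b i z :=
    (Finset.prod_pos fun i _ => hx₀ i).trans_le (hmax fun i => (hx₀ i).le)
  have hzpos : ∀ i, 0 < b i z := fun i =>
    (hz i).lt_of_ne' fun h => hprod.ne' (Finset.prod_eq_zero (Finset.mem_univ i) h)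
  refine ⟨fun i => ∏ j ∈ Finset.univ.erase i, b j z,
    fun i => Finset.prod_pos fun j _ => hzpos j, ?_⟩
  ext v
  have hline : ∀ i (t : ℝ), b i (z + t • v) = b i z + t * (b i).linear v := fun i t => by
    rw [add_comm z, ← vadd_eq_add, AffineMap.map_vadd]
    simp [add_comm]
  have hderiv : HasDerivAt (fun t : ℝ => ∏ i, b i (z + t • v))
      (∑ i, (∏ j ∈ Finset.univ.erase i, b j z) • (b i).linear v) 0 := by
    have h := HasDerivAt.fun_finsetProd (u := Finset.univ) (x := (0 : ℝ))
      (f := fun i t => b i (z + t • v)) (f' := fun i => (b i).linear v) fun i _ => by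
        simpa [hline] using ((hasDerivAt_id (0 : ℝ)).mul_const ((b i).linear v)).const_add (b i z)
    simpa using h
  have hloc : IsLocalMax (fun t : ℝ => ∏ i, b i (z + t • v)) 0 := by
    have hev : ∀ᶠ t : ℝ in nhds 0, ∀ i, 0 < b i (z + t • v) := by
      refine Filter.eventually_all.2 fun i => ?_
      have hc : Continuous fun t : ℝ => b i (z + t • v) := (hb i).comp (by fun_prop)
      exact hc.continuousAt.eventually (lt_mem_nhds (by simpa using hzpos i))
    filter_upwards [hev] with t ht
    simpa using hmax (fun i => (ht i).le)
  simpa using hloc.hasDerivAt_eq_zero hderiv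

/-- A bounded set with positive points cut out by `N + 1` affine inequalities is affinely
equivalent to a slice of an `N`-dimensional simplex. -/
theorem exists_affineMap_image_eq_inter_convexHull {E V : Type*} {N : ℕ}
    [NormedAddCommGroup E] [NormedSpace ℝ E] [FiniteDimensional ℝ E]
    [AddCommGroup V] [Module ℝ V] [FiniteDimensional ℝ V] (hV : Module.finrank ℝ V = N)
    (b : Fin (N + 1) → E →ᵃ[ℝ] ℝ) (hcomp : IsCompact {x | ∀ i, 0 ≤ b i x})
    {x₀ : E} (hx₀ : ∀ i, 0 < b i x₀) :
    ∃ w : Fin (N + 1) → V, AffineIndependent ℝ w ∧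
      ∃ A : AffineSubspace ℝ V, Module.finrank ℝ A.direction = Module.finrank ℝ E ∧
        ∃ f : E →ᵃ[ℝ] V, Function.Injective f ∧
          f '' {x | ∀ i, 0 ≤ b i x} = (A : Set V) ∩ convexHull ℝ (Set.range w) := by
  obtain ⟨c, hc, hlin⟩ := exists_pos_sum_smul_linear_eq_zero b hcomp hx₀
  set C : ℝ := ∑ i, c i * b i x₀ with hC
  have hCpos : 0 < C := Finset.sum_pos (fun i _ => mul_pos (hc i) (hx₀ i)) Finset.univ_nonempty
  have hsum : ∀ x, ∑ i, c i * b i x = C := fun x => by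
    have h := LinearMap.congr_fun hlin (x - x₀)
    simp only [LinearMap.sum_apply, LinearMap.smul_apply, LinearMap.zero_apply, smul_eq_mul,
      ← vsub_eq_sub x x₀, AffineMap.linearMap_vsub] at h
    simp only [vsub_eq_sub, mul_sub, Finset.sum_sub_distrib] at h
    linarith
  obtain ⟨w⟩ := AffineBasis.exists_affineBasis_of_finiteDimensional (ι := Fin (N + 1)) (k := ℝ)
    (P := V) (by simp [hV])
  let f : E →ᵃ[ℝ] V :=
    ∑ i, (LinearMap.toSpanSingleton ℝ V (w i)).toAffineMap.comp ((c i / C) • b i)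
  have hf : ∀ x, f x = ∑ i, (c i / C * b i x) • w i := fun x => by
    have : f x = ∑ i, ((LinearMap.toSpanSingleton ℝ V (w i)).toAffineMap.comp
        ((c i / C) • b i)) x := by
      simp only [f]
      exact map_sum (⟨⟨fun g : E →ᵃ[ℝ] V => g x, rfl⟩, fun _ _ => rfl⟩ : (E →ᵃ[ℝ] V) →+ V) _ _
    rw [this]
    rfl
  have hcoord : ∀ i x, w.coord i (f x) = c i / C * b i x := fun i x => by
    have h1 : ∑ i, c i / C * b i x = 1 := by
      simp only [div_mul_eq_mul_div, ← Finset.sum_div, hsum, div_self hCpos.ne']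
    rw [hf, ← Finset.affineCombination_eq_linear_combination Finset.univ w _ h1]
    exact w.coord_apply_combination_of_mem (Finset.mem_univ i) h1
  have hpos : ∀ i x, 0 ≤ w.coord i (f x) ↔ 0 ≤ b i x := fun i x => by
    rw [hcoord]
    exact mul_nonneg_iff_of_pos_left (div_pos (hc i) hCpos)
  have hinj : Function.Injective f := by
    intro x y hxy
    by_contra hne
    have hlin0 : ∀ i, (b i).linear (x - y) = 0 := fun i => by
      have h : c i / C * b i x = c i / C * b i y := by rw [← hcoord, ← hcoord, hxy]
      rw [← vsub_eq_sub, AffineMap.linearMap_vsub,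
        mul_left_cancel₀ (div_pos (hc i) hCpos).ne' h, vsub_self]
    obtain ⟨R, hR⟩ := hcomp.isBounded.exists_norm_le
    have hmem : ∀ t : ℝ, t • (x - y) + x₀ ∈ {x | ∀ i, 0 ≤ b i x} := fun t i => by
      rw [← vadd_eq_add, AffineMap.map_vadd, map_smul, hlin0]
      simpa using (hx₀ i).le
    have hxy0 : 0 < ‖x - y‖ := norm_pos_iff.2 (sub_ne_zero.2 hne)
    have h1 := hR _ (hmem ((R + ‖x₀‖ + 1) / ‖x - y‖))
    have hR0 : 0 ≤ R := (norm_nonneg _).trans h1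
    have h2 := norm_sub_le_norm_add ((((R + ‖x₀‖ + 1) / ‖x - y‖)) • (x - y)) x₀
    rw [norm_smul, Real.norm_of_nonneg (by positivity), div_mul_cancel₀ _ hxy0.ne'] at h2
    linarith
  refine ⟨w, w.ind, (⊤ : AffineSubspace ℝ E).map f, ?_, f, hinj, ?_⟩
  · rw [AffineSubspace.map_direction, AffineSubspace.direction_top, Submodule.map_top]
    exact LinearMap.finrank_range_of_inj ((AffineMap.linear_injective_iff f).2 hinj)
  · rw [w.convexHull_eq_nonneg_coord]
    ext v
    constructor
    · rintro ⟨x, hx, rfl⟩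
      exact ⟨⟨x, trivial, rfl⟩, fun i => (hpos i x).2 (hx i)⟩
    · rintro ⟨⟨x, -, rfl⟩, hx⟩
      exact ⟨x, fun i => (hpos i x).1 (hx i), rfl⟩

section Faces

variable {E : Type*} [NormedAddCommGroup E] [NormedSpace ℝ E] {K : Set E}

/-- A linear functional that is maximal over `K` at a point is constant on the face of that
point. -/
theorem eq_of_mem_faceOf {g : E →ₗ[ℝ] ℝ} {A B : E} (hg : ∀ x ∈ K, g x ≤ g A)
    (hB : B ∈ faceOf K A) : g B = g A := by
  obtain ⟨-, rfl | ⟨C, D, hCD, hAB, hCA, -, hDA, -⟩⟩ := hB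
  · rfl
  have hC := hg C (hCD (left_mem_segment ℝ C D))
  have hD := hg D (hCD (right_mem_segment ℝ C D))
  obtain ⟨a, b, ha, hb, hab, hA⟩ := hAB (left_mem_segment ℝ A B)
  obtain ⟨c, d, hc, hd, hcd, rfl⟩ := hAB (right_mem_segment ℝ A B)
  have ha0 : 0 < a := ha.lt_of_ne' fun h => hDA (by simp_all)
  have hb0 : 0 < b := hb.lt_of_ne' fun h => hCA (by simp_all)
  have hgA : a * g C + b * g D = g A := by rw [← hA]; simp
  obtain rfl : a = 1 - b := by linarith
  obtain rfl : c = 1 - d := by linarith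
  have hC' : g C = g A := by nlinarith
  have hD' : g D = g A := by nlinarith
  simp only [map_add, map_smul, smul_eq_mul, hC', hD']
  ring

/-- A point `B` of `K` lies in the affine span of the face of `A` as soon as the segment from `B`
to `A` can be prolonged beyond `A` inside `K`. -/
theorem mem_affineSpan_faceOf (hK : Convex ℝ K) {A B : E} (hA : A ∈ K) (hB : B ∈ K) {ε : ℝ}
    (hε : 0 < ε) (h : A + ε • (A - B) ∈ K) : B ∈ affineSpan ℝ (faceOf K A) := by
  have hAm : A ∈ faceOf K A := ⟨hA, Or.inl rfl⟩
  rcases eq_or_ne A B with rfl | hne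
  · exact subset_affineSpan ℝ _ hAm
  have hsub : A - B ≠ 0 := sub_ne_zero.2 hne
  set M := AffineMap.lineMap A B (1 / 2 : ℝ) with hM
  have hMA : M = A - (1 / 2 : ℝ) • (A - B) := by
    rw [hM, AffineMap.lineMap_apply_module]; module
  have hMm : M ∈ faceOf K A := by
    have hseg : segment ℝ (A + ε • (A - B)) B ⊆ K := hK.segment_subset h hB
    have hAs : A ∈ segment ℝ (A + ε • (A - B)) B := by
      refine ⟨1 / (1 + ε), ε / (1 + ε), by positivity, by positivity, by field_simp, ?_⟩
      have h1 : (1 + ε) ≠ 0 := by positivity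
      rw [div_eq_inv_mul, div_eq_inv_mul, mul_smul, mul_smul, ← smul_add,
        inv_smul_eq_iff₀ h1]
      module
    have hMs : M ∈ segment ℝ (A + ε • (A - B)) B := by
      refine (convex_segment _ _).segment_subset hAs (right_mem_segment ℝ _ _) ?_
      rw [segment_eq_image_lineMap]
      exact ⟨1 / 2, by norm_num, rfl⟩
    refine ⟨hseg hMs, Or.inr ⟨A + ε • (A - B), B, hseg,
      (convex_segment _ _).segment_subset hAs hMs, ?_, ?_, hne.symm, ?_⟩⟩
    · simpa using ⟨hε.ne', hsub⟩
    · intro h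
      have : (ε + 1 / 2) • (A - B) = 0 := by
        have h2 : A + ε • (A - B) - M = 0 := sub_eq_zero.2 h
        rw [← h2, hMA]; module
      exact (smul_ne_zero (by positivity) hsub) this
    · intro h
      have : (1 / 2 : ℝ) • (A - B) = 0 := by
        have h2 : A - (1 / 2 : ℝ) • (A - B) - B = 0 := by rw [← hMA, ← h, sub_self]
        rw [← h2]; module
      exact (smul_ne_zero (by norm_num) hsub) this
  have hBM : B = AffineMap.lineMap A M (2 : ℝ) := by
    rw [AffineMap.lineMap_apply_module, hMA]; module
  rw [hBM]
  exact AffineMap.lineMap_mem _ (subset_affineSpan ℝ _ hAm) (subset_affineSpan ℝ _ hMm)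

/-- The face of an interior point spans the whole space. -/
theorem affineSpan_faceOf_eq_top (hK : Convex ℝ K) {A : E} (hA : A ∈ interior K) :
    affineSpan ℝ (faceOf K A) = ⊤ := by
  have hspan : affineSpan ℝ K = ⊤ :=
    top_le_iff.1 ((isOpen_interior.affineSpan_eq_top ⟨A, hA⟩).ge.trans
      (affineSpan_mono ℝ interior_subset))
  rw [← top_le_iff, ← hspan, affineSpan_le]
  intro B hB
  have hc : Continuous fun t : ℝ => A + t • (A - B) := by fun_prop
  have hev : ∀ᶠ t : ℝ in nhds 0, A + t • (A - B) ∈ K := by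
    refine hc.continuousAt.eventually ?_
    simpa using mem_interior_iff_mem_nhds.1 hA
  obtain ⟨ε, hε, hmem⟩ := Metric.eventually_nhds_iff.1 hev
  refine mem_affineSpan_faceOf hK (interior_subset hA) hB (half_pos hε) (hmem ?_)
  rw [dist_zero_right, Real.norm_of_nonneg (half_pos hε).le]
  exact half_lt_self hε

/-- A convex set has, at each of its points outside its interior, a supporting affine function,
which vanishes on the face of that point. -/
theorem exists_affineMap_eq_zero_on_faceOf (hK : Convex ℝ K) (hint : (interior K).Nonempty)
    {A : E} (hA : A ∉ interior K) :
    ∃ b : E →ᵃ[ℝ] ℝ, (∀ x ∈ K, 0 ≤ b x) ∧ (∀ x ∈ faceOf K A, b x = 0) ∧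
      ∀ x ∈ interior K, 0 < b x := by
  obtain ⟨g, hg⟩ := geometric_hahn_banach_open_point hK.interior isOpen_interior hA
  have hle : ∀ x ∈ K, g x ≤ g A := by
    intro x hx
    have hsub : closure (interior K) ⊆ {x | g x ≤ g A} :=
      closure_minimal (fun y hy => (hg y hy).le) (isClosed_le g.continuous continuous_const)
    rw [hK.closure_interior_eq_closure_of_nonempty_interior hint] at hsub
    exact hsub (subset_closure hx)
  refine ⟨AffineMap.const ℝ E (g A) - g.toLinearMap.toAffineMap, fun x hx => ?_,
    fun x hx => ?_, fun x hx => ?_⟩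
  · simpa using hle x hx
  · simpa [sub_eq_zero] using (eq_of_mem_faceOf (g := g.toLinearMap) hle hx).symm
  · simpa using hg x hx

/-- The face of a boundary point of a convex set has positive codimension. -/
theorem finrank_direction_affineSpan_faceOf_lt [FiniteDimensional ℝ E] (hK : Convex ℝ K)
    (hint : (interior K).Nonempty) {A : E} (hA : A ∉ interior K) :
    Module.finrank ℝ (affineSpan ℝ (faceOf K A)).direction < Module.finrank ℝ E := by
  obtain ⟨b, -, hb0, hbpos⟩ := exists_affineMap_eq_zero_on_faceOf hK hint hA
  obtain ⟨x, hx⟩ := hint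
  refine Submodule.finrank_lt fun htop => ?_
  rcases (faceOf K A).eq_empty_or_nonempty with he | ⟨B, hB⟩
  · rw [he, AffineSubspace.span_empty, AffineSubspace.direction_bot] at htop
    have : Subsingleton E := (Submodule.subsingleton_iff ℝ).1 (subsingleton_of_bot_eq_top htop)
    exact hA (Subsingleton.elim x A ▸ hx)
  · have hspan : affineSpan ℝ (faceOf K A) = ⊤ :=
      (AffineSubspace.direction_eq_top_iff_of_nonempty ⟨B, subset_affineSpan ℝ _ hB⟩).1 htop
    have hle : affineSpan ℝ (faceOf K A) ≤ (affineSpan ℝ {(0 : ℝ)}).comap b :=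
      affineSpan_le.2 fun y hy => by simp [hb0 y hy]
    have hx0 : x ∈ (affineSpan ℝ {(0 : ℝ)}).comap b := hle (hspan ▸ AffineSubspace.mem_top ℝ E x)
    have : b x = 0 := by simpa using hx0
    exact (hbpos x hx).ne' this

/-- Every point of a polytope lies in the affine span of some of its generators, all of which lie
in the affine span of the face of the point. -/
theorem exists_subset_mem_affineSpan_le_affineSpan_faceOf {F : Finset E} {z : E}
    (hz : z ∈ convexHull ℝ (F : Set E)) :
    ∃ T ⊆ F, z ∈ affineSpan ℝ (T : Set E) ∧
      affineSpan ℝ (T : Set E) ≤ affineSpan ℝ (faceOf (convexHull ℝ (F : Set E)) z) := by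
  classical
  obtain ⟨w, hw0, hw1, hwz⟩ := Finset.mem_convexHull'.1 hz
  refine ⟨F.filter fun y => w y ≠ 0, Finset.filter_subset _ _, ?_, ?_⟩
  · refine convexHull_subset_affineSpan _ (Finset.mem_convexHull'.2
      ⟨w, fun y hy => hw0 y (Finset.mem_filter.1 hy).1, ?_, ?_⟩)
    · rw [Finset.sum_filter_ne_zero, hw1]
    · rw [← hwz, Finset.sum_filter_of_ne]
      exact fun y _ h hy => h (by rw [hy, zero_smul])
  · refine affineSpan_le.2 fun t ht => ?_
    obtain ⟨htF, ht0⟩ := Finset.mem_filter.1 (Finset.mem_coe.1 ht)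
    have htpos : 0 < w t := (hw0 t htF).lt_of_ne' ht0
    refine mem_affineSpan_faceOf (convex_convexHull ℝ _) hz
      (subset_convexHull ℝ _ htF) htpos (Finset.mem_convexHull'.2
        ⟨fun y => (1 + w t) * w y - if y = t then w t else 0, fun y hy => ?_, ?_, ?_⟩)
    · dsimp only
      split_ifs with h
      · subst h; nlinarith
      · have := hw0 y hy
        simp only [sub_zero]; positivity
    · rw [Finset.sum_sub_distrib, ← Finset.mul_sum, hw1]
      simp [htF]
    · simp only [sub_smul, mul_smul, ite_smul, zero_smul, Finset.sum_sub_distrib,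
        ← Finset.smul_sum, hwz]
      simp only [Finset.sum_ite_eq', htF, if_true]
      module

/-- Finitely many proper affine subspaces do not cover a nonempty open set. -/
theorem exists_mem_forall_notMem_affineSubspace [FiniteDimensional ℝ E] {U : Set E}
    (hU : IsOpen U) (hne : U.Nonempty) {S : Set (AffineSubspace ℝ E)} (hS : S.Finite)
    (hproper : ∀ s ∈ S, s ≠ ⊤) : ∃ y ∈ U, ∀ s ∈ S, y ∉ s := by
  borelize E
  by_contra! h
  refine (hU.measure_pos Measure.addHaar hne).ne' (measure_mono_null (t := ⋃ s ∈ S, (s : Set E))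
    (fun y hy => ?_) ((measure_biUnion_null_iff hS.countable).2 fun s hs =>
      Measure.addHaar_affineSubspace _ s (hproper s hs)))
  obtain ⟨s, hs, hys⟩ := h y hy
  exact mem_biUnion hs hys

/-- A segment from an interior point of a polytope to a point outside can be chosen to leave the
polytope through a facet. -/
theorem exists_mem_openSegment_finrank_faceOf [FiniteDimensional ℝ E] {F : Finset E}
    (hK : K = convexHull ℝ (F : Set E)) (hint : (interior K).Nonempty) {x : E} (hx : x ∉ K) :
    ∃ y ∈ interior K, ∃ z ∈ K, z ∉ interior K ∧ z ∈ openSegment ℝ y x ∧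
      Module.finrank ℝ (affineSpan ℝ (faceOf K z)).direction = Module.finrank ℝ E - 1 := by
  have hconv : Convex ℝ K := hK ▸ convex_convexHull ℝ _
  have hclosed : IsClosed K := hK ▸ F.finite_toSet.isClosed_convexHull ℝ
  let S : Set (AffineSubspace ℝ E) :=
    (fun T : Finset E => affineSpan ℝ (insert x (T : Set E))) ''
      {T | T ⊆ F ∧ Module.finrank ℝ (affineSpan ℝ (T : Set E)).direction + 1 <
        Module.finrank ℝ E}
  have hS : S.Finite :=
    ((F.powerset.finite_toSet).subset fun T hT => by simpa using hT.1).image _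
  have hproper : ∀ s ∈ S, s ≠ ⊤ := by
    rintro _ ⟨T, ⟨-, hT⟩, rfl⟩ htop
    have h := finrank_vectorSpan_insert_le_set ℝ (T : Set E) x
    dsimp only at htop
    rw [← direction_affineSpan, ← direction_affineSpan, htop, AffineSubspace.direction_top,
      finrank_top] at h
    omega
  obtain ⟨y, hy, hyS⟩ := exists_mem_forall_notMem_affineSubspace isOpen_interior hint hS hproper
  obtain ⟨z, hzseg, hzK, hzint⟩ : ∃ z ∈ segment ℝ y x, z ∈ K ∧ z ∉ interior K := by
    by_contra! h
    obtain ⟨z, -, hz, hz'⟩ := (convex_segment y x).isPreconnected _ _ isOpen_interior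
      hclosed.isOpen_compl (fun z hz => or_iff_not_imp_right.2 fun h' => h z hz (not_not.1 h'))
      ⟨y, left_mem_segment ℝ y x, hy⟩ ⟨x, right_mem_segment ℝ y x, hx⟩
    exact hz' (interior_subset hz)
  have hzx : z ≠ x := fun h => hx (h ▸ hzK)
  have hzy : z ≠ y := fun h => hzint (h ▸ hy)
  have hzopen : z ∈ openSegment ℝ y x := mem_openSegment_of_ne_left_right hzy.symm hzx.symm hzseg
  refine ⟨y, hy, z, hzK, hzint, hzopen, ?_⟩
  have hlt := finrank_direction_affineSpan_faceOf_lt hconv hint hzint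
  obtain ⟨T, hTF, hzT, hle⟩ := exists_subset_mem_affineSpan_le_affineSpan_faceOf (hK ▸ hzK)
  rw [← hK] at hle
  have hmono := Submodule.finrank_mono (AffineSubspace.direction_le hle)
  by_contra hne
  refine hyS _ ⟨T, ⟨hTF, by omega⟩, rfl⟩ ?_
  obtain ⟨a, c, ha, hc, hac, hzac⟩ := hzopen
  have hyline : y = AffineMap.lineMap x z a⁻¹ := by
    rw [AffineMap.lineMap_apply_module, ← hzac, smul_add, smul_smul, smul_smul,
      inv_mul_cancel₀ ha.ne', one_smul, add_left_comm, ← add_smul]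
    have : 1 - a⁻¹ + a⁻¹ * c = 0 := by
      obtain rfl : c = 1 - a := by linarith
      field_simp
      ring
    rw [this, zero_smul, add_zero]
  rw [hyline]
  exact AffineMap.lineMap_mem _ (subset_affineSpan ℝ _ (mem_insert _ _))
    (affineSpan_mono ℝ (subset_insert _ _) hzT)

end Faces

/-- A full-dimensional polytope with `N + 1` facets is cut out by `N + 1` affine inequalities,
all strict on its interior. -/
theorem exists_affineMap_eq_setOf_nonneg {E : Type*} [NormedAddCommGroup E] [NormedSpace ℝ E]
    [FiniteDimensional ℝ E] {N : ℕ} {F : Finset E} {P : Set E}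
    (hP : P = convexHull ℝ (F : Set E)) (hint : (interior P).Nonempty)
    (hfacets : (facesOfDim P (Module.finrank ℝ E - 1)).ncard = N + 1) :
    ∃ b : Fin (N + 1) → E →ᵃ[ℝ] ℝ, P = {x | ∀ i, 0 ≤ b i x} ∧
      ∀ x ∈ interior P, ∀ i, 0 < b i x := by
  have hconv : Convex ℝ P := hP ▸ convex_convexHull ℝ _
  rcases Nat.eq_zero_or_pos (Module.finrank ℝ E) with h0 | hpos
  · have := Module.finrank_zero_iff.1 h0
    refine ⟨fun _ => AffineMap.const ℝ E 1, ?_, fun _ _ _ => by simp⟩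
    rw [Subsingleton.eq_univ_of_nonempty (hint.mono interior_subset)]
    simp
  have hsupp : ∀ s ∈ facesOfDim P (Module.finrank ℝ E - 1), ∃ b : E →ᵃ[ℝ] ℝ,
      (∀ x ∈ P, 0 ≤ b x) ∧ (∀ x ∈ s, b x = 0) ∧ ∀ x ∈ interior P, 0 < b x := by
    rintro _ ⟨A, -, rfl, hdim⟩
    refine exists_affineMap_eq_zero_on_faceOf hconv hint fun hA => ?_
    rw [affineSpan_faceOf_eq_top hconv hA, AffineSubspace.direction_top, finrank_top] at hdim
    omega
  choose! b hbP hb0 hbint using hsupp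
  have hfin : Finite (facesOfDim P (Module.finrank ℝ E - 1)) :=
    (Set.finite_of_ncard_ne_zero (by omega)).to_subtype
  let e := Finite.equivFinOfCardEq (α := facesOfDim P (Module.finrank ℝ E - 1)) hfacets
  refine ⟨fun i => b (e.symm i), Subset.antisymm (fun x hx i => hbP _ (e.symm i).2 x hx) ?_,
    fun x hx i => hbint _ (e.symm i).2 x hx⟩
  intro x hx
  by_contra hxP
  obtain ⟨y, hy, z, hzP, -, ⟨a, c, ha, hc, hac, hzac⟩, hdim⟩ :=
    exists_mem_openSegment_finrank_faceOf hP hint hxP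
  have hs : faceOf P z ∈ facesOfDim P (Module.finrank ℝ E - 1) := ⟨z, hzP, rfl, hdim⟩
  have hz : b (faceOf P z) z = 0 := hb0 _ hs z ⟨hzP, Or.inl rfl⟩
  have hxs : 0 ≤ b (faceOf P z) x := by simpa using hx (e ⟨_, hs⟩)
  have hcombo := Convex.combo_affine_apply (f := b (faceOf P z)) (x := y) (y := x) hac
  rw [hzac, hz] at hcombo
  have := mul_pos ha (hbint _ hs y hy)
  have := mul_nonneg hc.le hxs
  simp only [smul_eq_mul] at hcombo
  linarith

/-- A bounded convex polytope `P ⊆ ℝⁿ` with non-empty interior and exactly `N + 1` faces of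
dimension `n - 1` is affinely equivalent to the intersection of an `N`-dimensional simplex of
`ℝᴺ` with an `n`-dimensional affine subspace of `ℝᴺ`. -/
theorem polytope_affinely_equivalent_to_slice_of_simplex {n N : ℕ}
    (F : Finset (Euc n)) (P : Set (Euc n)) (hP : P = convexHull ℝ (↑F : Set (Euc n)))
    (hint : (interior P).Nonempty)
    (hfacets : (facesOfDim P (n - 1)).ncard = N + 1) :
    ∃ w : Fin (N + 1) → Euc N, AffineIndependent ℝ w ∧
      ∃ A : AffineSubspace ℝ (Euc N), Module.finrank ℝ A.direction = n ∧
        ∃ f : Euc n →ᵃ[ℝ] Euc N, Function.Injective f ∧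
          f '' P = (A : Set (Euc N)) ∩ convexHull ℝ (Set.range w) := by
  obtain ⟨b, hb, hpos⟩ := exists_affineMap_eq_setOf_nonneg hP hint (by simpa using hfacets)
  obtain ⟨x₀, hx₀⟩ := hint
  have hcomp : IsCompact {x | ∀ i, 0 ≤ b i x} :=
    hb ▸ hP ▸ F.finite_toSet.isCompact_convexHull ℝ
  simpa [← hb] using exists_affineMap_image_eq_inter_convexHull (V := Euc N) (by simp) b hcomp
    (hpos x₀ hx₀)
end
end

section
/- Let P be a bounded convex polytope in ℝⁿ with non-empty interior and exactly N+1 faces of dimension n−1. Then the Hilbert geometry (int P, d_P) can be isometrically embedded in a normed vector space of dimension N; that is, there exist a norm ‖·‖ on ℝᴺ and a map f : int P → ℝᴺ with ‖f(x) − f(y)‖ = d_P(x,y) for all x, y ∈ int P. -/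
open Set Filter MeasureTheory

noncomputable section

theorem IsPreconnected.inter_frontier_nonempty_of_isOpen {X : Type*} [TopologicalSpace X]
    {S Ω : Set X} (hS : IsPreconnected S) (hΩ : IsOpen Ω) (h₁ : (S ∩ Ω).Nonempty)
    (h₂ : ¬ S ⊆ Ω) : (S ∩ frontier Ω).Nonempty := by
  by_contra hne
  have key : ∀ x ∈ S, x ∈ closure Ω → x ∈ Ω := fun x hx hxc ↦ by
    by_contra hxΩ
    exact hne ⟨x, hx, hΩ.frontier_eq ▸ ⟨hxc, hxΩ⟩⟩
  obtain ⟨y, hyS, hyΩ⟩ := not_subset.1 h₂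
  obtain ⟨z, -, hzΩ, hz⟩ := hS Ω (closure Ω)ᶜ hΩ isClosed_closure.isOpen_compl
    (fun x hx ↦ (em (x ∈ closure Ω)).imp (key x hx) id) h₁ ⟨y, hyS, fun h ↦ hyΩ (key y hyS h)⟩
  exact hz (subset_closure hzΩ)

/-- An open bounded set is left by every ray that starts in it. -/
theorem exists_ray_mem_frontier {E : Type*} [NormedAddCommGroup E] [NormedSpace ℝ E]
    {Ω : Set E} (hΩ : IsOpen Ω) (hb : Bornology.IsBounded Ω) {p q : E} (hq : q ∈ Ω)
    (hpq : p ≠ q) : ∃ t : ℝ, 1 < t ∧ p + t • (q - p) ∈ frontier Ω := by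
  have hv : 0 < ‖q - p‖ := norm_pos_iff.2 (sub_ne_zero.2 hpq.symm)
  have hS : IsPreconnected ((fun t : ℝ ↦ p + t • (q - p)) '' Ici 1) :=
    isPreconnected_Ici.image _ (by fun_prop)
  obtain ⟨_, ⟨t, ht, rfl⟩, htf⟩ := hS.inter_frontier_nonempty_of_isOpen hΩ
    ⟨q, ⟨1, self_mem_Ici, by simp⟩, hq⟩ <| by
      intro hsub
      obtain ⟨C, hC⟩ := hb.exists_norm_le
      have hC0 : 0 ≤ C := (norm_nonneg q).trans (hC q hq)
      set t : ℝ := (C + ‖p‖) / ‖q - p‖ + 1 with ht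
      have ht1 : 1 ≤ t := le_add_of_nonneg_left (by positivity)
      have h₁ := hC _ (hsub ⟨t, ht1, rfl⟩)
      have h₂ : ‖t • (q - p)‖ ≤ C + ‖p‖ := by
        have := norm_sub_le (p + t • (q - p)) p
        rw [add_sub_cancel_left] at this
        linarith
      rw [norm_smul, Real.norm_of_nonneg (zero_le_one.trans ht1), ht, add_mul,
        div_mul_cancel₀ _ hv.ne'] at h₂
      linarith
  refine ⟨t, lt_of_le_of_ne ht ?_, htf⟩
  rintro rfl
  rw [hΩ.frontier_eq] at htf
  exact htf.2 (by simpa using hq)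

theorem exists_affineMap_pos_of_notMem {E : Type*} [NormedAddCommGroup E] [NormedSpace ℝ E]
    {Ω : Set E} (hΩ : IsOpen Ω) (hc : Convex ℝ Ω) {z : E} (hz : z ∉ Ω) :
    ∃ L : E →ᵃ[ℝ] ℝ, (∀ x ∈ Ω, 0 < L x) ∧ L z = 0 := by
  obtain ⟨f, hf⟩ := geometric_hahn_banach_point_open hc hΩ hz
  refine ⟨f.toLinearMap.toAffineMap - AffineMap.const ℝ E (f z), fun x hx ↦ ?_, ?_⟩
  · simpa using hf x hx
  · simp

/-- A point of a polytope lies in the affine span of those vertices `v` for which the segment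
to `v` starts in the open face of the point. -/
theorem mem_affineSpan_midpoint_mem_faceOf {V : Type*} [AddCommGroup V] [Module ℝ V]
    (F : Finset V) {z : V} (hz : z ∈ convexHull ℝ (F : Set V)) :
    z ∈ affineSpan ℝ {v ∈ (F : Set V) | midpoint ℝ z v ∈ faceOf (convexHull ℝ (F : Set V)) z} := by
  classical
  have hK := convex_convexHull ℝ (F : Set V)
  obtain ⟨w, hw0, hw1, hwz⟩ := Finset.mem_convexHull'.1 hz
  set T := F.filter (fun v ↦ w v ≠ 0)
  have hT1 : ∑ v ∈ T, w v = 1 := (Finset.sum_filter_ne_zero F).trans hw1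
  have hTz : ∑ v ∈ T, w v • v = z := by
    rw [← hwz]
    exact Finset.sum_filter_of_ne fun v _ h h0 ↦ h (by simp [h0])
  suffices hmid : ∀ v ∈ T, midpoint ℝ z v ∈ faceOf (convexHull ℝ (F : Set V)) z by
    have hsum := (convex_convexHull ℝ
      {v ∈ (F : Set V) | midpoint ℝ z v ∈ faceOf (convexHull ℝ (F : Set V)) z}).sum_mem
      (fun v hv ↦ hw0 v (Finset.mem_filter.1 hv).1) hT1
      fun v hv ↦ subset_convexHull ℝ _ ⟨(Finset.mem_filter.1 hv).1, hmid v hv⟩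
    rw [hTz] at hsum
    exact convexHull_subset_affineSpan _ hsum
  intro v hv
  obtain ⟨hvF, hwv⟩ := Finset.mem_filter.1 hv
  have hvK : v ∈ convexHull ℝ (F : Set V) := subset_convexHull ℝ _ hvF
  refine ⟨hK.midpoint_mem hz hvK, ?_⟩
  by_cases hvz : z = v
  · left; simp [hvz]
  right
  have hpos : 0 < w v := lt_of_le_of_ne (hw0 v hvF) (Ne.symm hwv)
  have hsub : z - v ≠ 0 := sub_ne_zero.2 hvz
  set D : V := z + w v • (z - v) with hD
  have hDK : D ∈ convexHull ℝ (F : Set V) := by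
    refine Finset.mem_convexHull'.2
      ⟨fun u ↦ (1 + w v) * w u - (if u = v then w v else 0), fun u hu ↦ ?_, ?_, ?_⟩
    · have := hw0 u hu
      dsimp only
      split_ifs with h
      · subst h; nlinarith
      · rw [sub_zero]; positivity
    · rw [Finset.sum_sub_distrib, ← Finset.mul_sum, hw1, Finset.sum_ite_eq' F v, if_pos hvF]
      ring
    · simp only [sub_smul, ite_smul, zero_smul, mul_smul]
      rw [Finset.sum_sub_distrib, ← Finset.smul_sum, hwz, Finset.sum_ite_eq' F v, if_pos hvF]
      module
  have hzD : z ∈ segment ℝ D v := by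
    refine ⟨1 / (1 + w v), w v / (1 + w v), by positivity, by positivity, by field_simp, ?_⟩
    rw [hD]
    match_scalars <;> field_simp
    ring
  refine ⟨D, v, hK.segment_subset hDK hvK, ?_, ?_, ?_, Ne.symm hvz, ?_⟩
  · refine (convex_segment D v).segment_subset hzD ?_
    exact (convex_segment D v).midpoint_mem hzD (right_mem_segment ℝ D v)
  · intro h
    have : w v • (z - v) = 0 := by simpa [hD] using h
    exact (smul_ne_zero hpos.ne' hsub) this
  · intro h
    have : (w v + 1 / 2) • (z - v) = 0 := by
      rw [midpoint_eq_smul_add] at h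
      have h' := sub_eq_zero.2 h
      rw [← h', hD]
      simp only [invOf_eq_inv]
      module
    exact (smul_ne_zero (by positivity) hsub) this
  · intro h
    have : (1 / 2 : ℝ) • (z - v) = 0 := by
      rw [midpoint_eq_smul_add] at h
      have h' := sub_eq_zero.2 h.symm
      rw [← h']
      simp only [invOf_eq_inv]
      module
    exact (smul_ne_zero (by positivity) hsub) this

/-- An affine function that is nonnegative on a convex set and vanishes at a point vanishes on
the open face of that point. -/
theorem AffineMap.eq_zero_of_mem_faceOf {V : Type*} [AddCommGroup V] [Module ℝ V] {K : Set V}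
    (L : V →ᵃ[ℝ] ℝ) (hL : ∀ x ∈ K, 0 ≤ L x) {A B : V} (hA : L A = 0) (hB : B ∈ faceOf K A) :
    L B = 0 := by
  obtain ⟨-, rfl | ⟨C, D, hCD, hAB, hCA, -, hDA, -⟩⟩ := hB
  · exact hA
  have hA' := hAB (left_mem_segment ℝ A B)
  have hB' := hAB (right_mem_segment ℝ A B)
  have hC0 := hL C (hCD (left_mem_segment ℝ C D))
  have hD0 := hL D (hCD (right_mem_segment ℝ C D))
  rw [segment_eq_image_lineMap] at hA' hB'
  obtain ⟨s, ⟨hs0, hs1⟩, rfl⟩ := hA'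
  obtain ⟨t, -, rfl⟩ := hB'
  have hs0' : 0 < s := lt_of_le_of_ne hs0 (by rintro rfl; simp at hCA)
  have hs1' : s < 1 := lt_of_le_of_ne hs1 (by rintro rfl; simp at hDA)
  rw [AffineMap.apply_lineMap, AffineMap.lineMap_apply_ring] at hA ⊢
  have h₁ : L C = 0 := by nlinarith [mul_nonneg (sub_pos.2 hs1').le hC0, mul_nonneg hs0 hD0]
  have h₂ : L D = 0 := by nlinarith [mul_nonneg (sub_pos.2 hs1').le hC0, mul_nonneg hs0 hD0]
  simp [h₁, h₂]

theorem AffineMap.nonneg_of_pos_on_interior {E : Type*} [NormedAddCommGroup E]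
    [NormedSpace ℝ E] [FiniteDimensional ℝ E] {K : Set E} (hK : Convex ℝ K)
    (hint : (interior K).Nonempty) (L : E →ᵃ[ℝ] ℝ) (hL : ∀ x ∈ interior K, 0 < L x) {x : E}
    (hx : x ∈ K) : 0 ≤ L x := by
  have hcl : x ∈ closure (interior K) := by
    rw [hK.closure_interior_eq_closure_of_nonempty_interior hint]
    exact subset_closure hx
  exact closure_minimal (fun y hy ↦ (hL y hy).le)
    (isClosed_Ici.preimage L.continuous_of_finiteDimensional) hcl

/-- If an affine function vanishes at a point of a polytope with interior point `o` and is
positive at `o`, and no proper affine span of `o` and vertices contains the point, then the open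
face of the point is a facet. -/
theorem finrank_direction_faceOf_of_generic {n : ℕ} (F : Finset (Euc n))
    {o z : Euc n} (hz : z ∈ convexHull ℝ (F : Set (Euc n)))
    (L : Euc n →ᵃ[ℝ] ℝ) (hL : ∀ x ∈ convexHull ℝ (F : Set (Euc n)), 0 ≤ L x) (hLo : 0 < L o)
    (hLz : L z = 0)
    (hgen : ∀ S ⊆ F, affineSpan ℝ (insert o (S : Set (Euc n))) ≠ ⊤ →
      z ∉ affineSpan ℝ (insert o (S : Set (Euc n)))) :
    Module.finrank ℝ
      (affineSpan ℝ (faceOf (convexHull ℝ (F : Set (Euc n))) z)).direction = n - 1 := by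
  classical
  set P := convexHull ℝ (F : Set (Euc n)) with hP
  have hzf : z ∈ faceOf P z := ⟨hz, Or.inl rfl⟩
  rw [direction_affineSpan]
  apply le_antisymm
  · have hle : vectorSpan ℝ (faceOf P z) ≤ LinearMap.ker L.linear := by
      rw [vectorSpan_def, Submodule.span_le]
      rintro _ ⟨a, ha, b, hb, rfl⟩
      rw [SetLike.mem_coe, LinearMap.mem_ker]
      beta_reduce
      rw [AffineMap.linearMap_vsub, L.eq_zero_of_mem_faceOf hL hLz ha,
        L.eq_zero_of_mem_faceOf hL hLz hb, vsub_self]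
    have hlt : LinearMap.ker L.linear < ⊤ := by
      refine lt_top_iff_ne_top.2 fun h ↦ ?_
      have : L.linear (o -ᵥ z) = 0 := LinearMap.mem_ker.1 (h ▸ Submodule.mem_top)
      rw [AffineMap.linearMap_vsub, hLz] at this
      simp at this
      exact hLo.ne' this
    have h₁ := Submodule.finrank_mono hle
    have h₂ := Submodule.finrank_lt hlt.ne
    rw [finrank_euclideanSpace_fin] at h₂
    omega
  · set S := F.filter (fun v ↦ midpoint ℝ z v ∈ faceOf P z) with hS
    have hzS : z ∈ affineSpan ℝ (S : Set (Euc n)) := by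
      simpa [hS] using mem_affineSpan_midpoint_mem_faceOf F hz
    have htop : affineSpan ℝ (insert o (S : Set (Euc n))) = ⊤ := by
      by_contra h
      exact hgen S (Finset.filter_subset _ _) h (affineSpan_mono ℝ (subset_insert _ _) hzS)
    have hspan : vectorSpan ℝ (S : Set (Euc n)) ≤ vectorSpan ℝ (faceOf P z) := by
      have hmem : ∀ v ∈ S, v - z ∈ vectorSpan ℝ (faceOf P z) := fun v hv ↦ by
        have h := vsub_mem_vectorSpan ℝ (Finset.mem_filter.1 hv).2 hzf
        have := Submodule.smul_mem _ (2 : ℝ) h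
        rwa [midpoint_vsub_left, smul_smul, mul_invOf_self, one_smul] at this
      rw [vectorSpan_def, Submodule.span_le]
      rintro _ ⟨a, ha, b, hb, rfl⟩
      simpa using Submodule.sub_mem _ (hmem a ha) (hmem b hb)
    have h₁ := finrank_vectorSpan_insert_le_set ℝ (S : Set (Euc n)) o
    rw [← direction_affineSpan, htop, AffineSubspace.direction_top, finrank_top,
      finrank_euclideanSpace_fin] at h₁
    have h₂ := Submodule.finrank_mono hspan
    omega

/-- Supporting functions of the facets of a polytope cut out its whole boundary. -/
theorem exists_facet_eq_zero_of_mem_frontier {n : ℕ} (F : Finset (Euc n)) {P : Set (Euc n)}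
    (hP : P = convexHull ℝ (F : Set (Euc n))) (hint : (interior P).Nonempty)
    (hfin : (facesOfDim P (n - 1)).Finite) (L : Set (Euc n) → Euc n →ᵃ[ℝ] ℝ)
    (hL : ∀ s, ∀ x ∈ interior P, 0 < L s x)
    (hL0 : ∀ z ∈ frontier (interior P), L (faceOf P z) z = 0)
    {x : Euc n} (hx : x ∈ frontier (interior P)) : ∃ s ∈ facesOfDim P (n - 1), L s x = 0 := by
  have hconv : Convex ℝ P := hP ▸ convex_convexHull ℝ _
  have hclosed : IsClosed P := hP ▸ F.finite_toSet.isClosed_convexHull ℝ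
  have hfr : frontier (interior P) ⊆ P := fun z hz ↦
    closure_minimal interior_subset hclosed hz.1
  have hnn : ∀ s, ∀ z ∈ P, 0 ≤ L s z := fun s z hz ↦
    (L s).nonneg_of_pos_on_interior hconv hint (hL s) hz
  by_contra! hne
  obtain ⟨o, ho⟩ := hint
  set U : Set (Euc n) := ⋂ s ∈ facesOfDim P (n - 1), {y | 0 < L s y}
  have hU : IsOpen U := hfin.isOpen_biInter fun s _ ↦
    isOpen_Ioi.preimage (L s).continuous_of_finiteDimensional
  have hxU : x ∈ U := mem_iInter₂.2 fun s hs ↦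
    lt_of_le_of_ne (hnn s x (hfr hx)) (Ne.symm (hne s hs))
  have hUP : (U \ P).Nonempty := by
    refine sdiff_nonempty.2 fun hsub ↦ ?_
    rw [isOpen_interior.frontier_eq] at hx
    exact hx.2 (interior_maximal hsub hU hxU)
  set bad : Set (Euc n) := ⋃ S ∈ {S : Finset (Euc n) | S ⊆ F ∧
    affineSpan ℝ (insert o (S : Set (Euc n))) ≠ ⊤}, affineSpan ℝ (insert o (S : Set (Euc n)))
  have hbad : volume bad = 0 := by
    refine (measure_biUnion_null_iff ?_).2 fun S hS ↦ Measure.addHaar_affineSubspace _ _ hS.2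
    refine (F.powerset.finite_toSet.subset fun S hS ↦ ?_).countable
    simpa using hS.1
  obtain ⟨y, ⟨hyU, hyP⟩, hybad⟩ : ∃ y ∈ U \ P, y ∉ bad := by
    by_contra! hsub
    exact ((hU.sdiff hclosed).measure_pos volume hUP).ne' (measure_mono_null hsub hbad)
  obtain ⟨z, hzs, hzf⟩ := (convex_segment o y).isPreconnected.inter_frontier_nonempty_of_isOpen
    (isOpen_interior (s := P)) ⟨o, left_mem_segment ℝ o y, ho⟩
    fun h ↦ hyP (interior_subset (h (right_mem_segment ℝ o y)))
  have hzo : z ≠ o := by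
    rintro rfl
    rw [isOpen_interior.frontier_eq] at hzf
    exact hzf.2 ho
  rw [segment_eq_image_lineMap] at hzs
  obtain ⟨t, ⟨ht0, ht1⟩, rfl⟩ := hzs
  have ht : t ≠ 0 := by rintro rfl; simp at hzo
  set z := AffineMap.lineMap o y t
  have hface : faceOf P z ∈ facesOfDim P (n - 1) := by
    refine ⟨z, hfr hzf, rfl, ?_⟩
    have hzP := hfr hzf
    have hnn' := hnn (faceOf P z)
    rw [hP] at hzP ⊢
    refine finrank_direction_faceOf_of_generic F hzP (L (faceOf P z)) (hP ▸ hnn')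
      (hL _ o ho) (hL0 z hzf) fun S hS hSt hzS ↦ hybad (mem_biUnion ⟨hS, hSt⟩ ?_)
    have hoS : o ∈ affineSpan ℝ (insert o (S : Set (Euc n))) :=
      subset_affineSpan ℝ _ (mem_insert _ _)
    have := AffineMap.lineMap_mem t⁻¹ hoS hzS
    rwa [AffineMap.lineMap_lineMap_right, mul_comm, mul_inv_cancel₀ ht,
      AffineMap.lineMap_apply_one] at this
  have hzpos : 0 < L (faceOf P z) z := by
    have h₁ := hL (faceOf P z) o ho
    have h₂ : 0 < L (faceOf P z) y := mem_iInter₂.1 hyU _ hface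
    exact (convex_Ioi (0 : ℝ)).affine_preimage (L (faceOf P z))
      |>.segment_subset h₁ h₂ (lineMap_mem_segment ℝ o y ⟨ht0, ht1⟩)
  exact hzpos.ne' (hL0 z hzf)

/-- A polytope with `N + 1` facets has `N + 1` affine functions, positive in its interior, whose
zero sets cover its boundary. -/
theorem exists_affineMaps_of_ncard_facets {n N : ℕ} (F : Finset (Euc n)) {P : Set (Euc n)}
    (hP : P = convexHull ℝ (F : Set (Euc n))) (hint : (interior P).Nonempty)
    (hfacets : (facesOfDim P (n - 1)).ncard = N + 1) :
    ∃ L : Fin (N + 1) → Euc n →ᵃ[ℝ] ℝ, (∀ i, ∀ x ∈ interior P, 0 < L i x) ∧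
      ∀ x ∈ frontier (interior P), ∃ i, L i x = 0 := by
  have hconv : Convex ℝ P := hP ▸ convex_convexHull ℝ _
  have hclosed : IsClosed P := hP ▸ F.finite_toSet.isClosed_convexHull ℝ
  have hfin : (facesOfDim P (n - 1)).Finite := finite_of_ncard_ne_zero (by omega)
  have hex : ∀ s : Set (Euc n), ∃ L : Euc n →ᵃ[ℝ] ℝ, (∀ x ∈ interior P, 0 < L x) ∧
      ∀ z ∈ frontier (interior P), faceOf P z = s → L z = 0 := by
    intro s
    by_cases h : ∃ z ∈ frontier (interior P), faceOf P z = s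
    · obtain ⟨z, hz, rfl⟩ := h
      have hzint : z ∉ interior P := (isOpen_interior.frontier_eq.subset hz).2
      obtain ⟨L, hL, hLz⟩ := exists_affineMap_pos_of_notMem isOpen_interior hconv.interior
        hzint
      refine ⟨L, hL, fun z' hz' hzz' ↦ L.eq_zero_of_mem_faceOf
        (fun x hx ↦ L.nonneg_of_pos_on_interior hconv hint hL hx) hLz (hzz' ▸ ⟨?_, Or.inl rfl⟩)⟩
      exact closure_minimal interior_subset hclosed hz'.1
    · exact ⟨AffineMap.const ℝ _ 1, fun x _ ↦ by simp, fun z hz hzs ↦ (h ⟨z, hz, hzs⟩).elim⟩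
  choose L hL hL0 using hex
  have : Finite (facesOfDim P (n - 1)) := hfin
  let e := Finite.equivFinOfCardEq ((Nat.card_coe_set_eq _).trans hfacets)
  refine ⟨fun i ↦ L (e.symm i), fun i ↦ hL _, fun x hx ↦ ?_⟩
  obtain ⟨s, hs, hsx⟩ := exists_facet_eq_zero_of_mem_frontier F hP hint hfin L hL
    (fun z hz ↦ hL0 _ z hz rfl) hx
  exact ⟨e ⟨s, hs⟩, by simpa using hsx⟩

/-- The sup norm of all pairwise differences. -/
theorem norm_sub_pairs_eq_add {ι : Type*} [Fintype ι] {w : ι → ℝ} {α β : ℝ}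
    (hα : IsGreatest (range w) α) (hβ : IsGreatest (range fun i ↦ -w i) β) :
    ‖fun p : ι × ι ↦ w p.1 - w p.2‖ = α + β := by
  have h₁ : ∀ i, w i ≤ α := fun i ↦ hα.2 (mem_range_self i)
  have h₂ : ∀ i, -w i ≤ β := fun i ↦ hβ.2 (mem_range_self i)
  obtain ⟨i, hi⟩ := hα.1
  obtain ⟨j, hj⟩ := hβ.1
  apply le_antisymm
  · refine (pi_norm_le_iff_of_nonneg (by linarith [h₁ i, h₂ i])).2 fun p ↦ ?_
    rw [Real.norm_eq_abs, abs_le]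
    constructor <;> linarith [h₁ p.1, h₂ p.1, h₁ p.2, h₂ p.2]
  · have := norm_le_pi_norm (fun p : ι × ι ↦ w p.1 - w p.2) (i, j)
    have h := le_abs_self (w i - w j)
    simp only [Real.norm_eq_abs] at this
    simp only at hj
    linarith

/-- Functions positive on `Ω` whose zero sets cover `∂Ω` determine where a ray leaves `Ω`. -/
theorem isGreatest_log_div_sub_one {E : Type*} [NormedAddCommGroup E] [NormedSpace ℝ E]
    [FiniteDimensional ℝ E] {ι : Type*} {Ω : Set E} {L : ι → E →ᵃ[ℝ] ℝ}
    (hL : ∀ i, ∀ x ∈ Ω, 0 < L i x) (hL0 : ∀ x ∈ frontier Ω, ∃ i, L i x = 0)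
    {p q : E} (hp : p ∈ Ω) (hq : q ∈ Ω) {t : ℝ} (ht : 1 < t)
    (hb : p + t • (q - p) ∈ frontier Ω) :
    IsGreatest (range fun i ↦ Real.log (L i p) - Real.log (L i q)) (Real.log (t / (t - 1))) := by
  have hval : ∀ i, L i (p + t • (q - p)) = L i p + t * (L i q - L i p) := fun i ↦ by
    have := (L i).map_vadd p (t • (q - p))
    rw [vadd_eq_add, vadd_eq_add, add_comm] at this
    rw [this, map_smul, ← vsub_eq_sub q p, AffineMap.linearMap_vsub]
    simp [add_comm]
  have ht1 : 0 < t - 1 := sub_pos.2 ht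
  constructor
  · obtain ⟨i, hi⟩ := hL0 _ hb
    refine ⟨i, ?_⟩
    have hpi := hL i p hp
    have hqi := hL i q hq
    rw [hval] at hi
    simp only
    rw [← Real.log_div hpi.ne' hqi.ne']
    congr 1
    rw [div_eq_div_iff hqi.ne' ht1.ne']
    linarith
  · rintro _ ⟨i, rfl⟩
    have hpi := hL i p hp
    have hqi := hL i q hq
    have hi : 0 ≤ L i (p + t • (q - p)) := closure_minimal (fun y hy ↦ (hL i y hy).le)
      (isClosed_Ici.preimage (L i).continuous_of_finiteDimensional) hb.1
    rw [hval] at hi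
    simp only
    rw [← Real.log_div hpi.ne' hqi.ne']
    refine Real.log_le_log (div_pos hpi hqi) ?_
    rw [div_le_div_iff₀ hqi ht1]
    linarith

/-- The Hilbert distance in terms of functions positive on the domain whose zero sets cover the
boundary. -/
theorem IsHilbertDist.eq_half_norm_log {n : ℕ} {ι : Type*} [Fintype ι] {Ω : Set (Euc n)}
    {d : Euc n → Euc n → ℝ} (hd : IsHilbertDist Ω d) (hΩ : IsOpen Ω)
    (hbdd : Bornology.IsBounded Ω) {L : ι → Euc n →ᵃ[ℝ] ℝ}
    (hL : ∀ i, ∀ x ∈ Ω, 0 < L i x) (hL0 : ∀ x ∈ frontier Ω, ∃ i, L i x = 0)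
    {p q : Euc n} (hp : p ∈ Ω) (hq : q ∈ Ω) :
    d p q = 1 / 2 * ‖fun k : ι × ι ↦ (Real.log (L k.1 p) - Real.log (L k.1 q)) -
      (Real.log (L k.2 p) - Real.log (L k.2 q))‖ := by
  rcases eq_or_ne p q with rfl | hpq
  · have : (fun k : ι × ι ↦ (Real.log (L k.1 p) - Real.log (L k.1 p)) -
      (Real.log (L k.2 p) - Real.log (L k.2 p))) = 0 := by ext; simp
    rw [hd.1 p hp, this, norm_zero, mul_zero]
  obtain ⟨t, ht, htb⟩ := exists_ray_mem_frontier hΩ hbdd hq hpq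
  obtain ⟨s, hs, hsa⟩ := exists_ray_mem_frontier hΩ hbdd hp hpq.symm
  have hα := isGreatest_log_div_sub_one hL hL0 hp hq ht htb
  have hβ := isGreatest_log_div_sub_one hL hL0 hq hp hs hsa
  rw [norm_sub_pairs_eq_add hα (by simpa only [neg_sub] using hβ),
    hd.2 p hp q hq hpq _ _ hsa htb ⟨1 - s, t, by linarith, ht, by module, rfl⟩]
  have hv : 0 < ‖q - p‖ := norm_pos_iff.2 (sub_ne_zero.2 hpq.symm)
  have e₁ : q - (q + s • (p - q)) = s • (q - p) := by module
  have e₂ : p - (q + s • (p - q)) = (s - 1) • (q - p) := by module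
  have e₃ : p - (p + t • (q - p)) = -(t • (q - p)) := by module
  have e₄ : q - (p + t • (q - p)) = -((t - 1) • (q - p)) := by module
  rw [e₁, e₂, e₃, e₄, norm_neg, norm_neg]
  simp only [norm_smul]
  rw [mul_div_mul_right _ _ hv.ne', mul_div_mul_right _ _ hv.ne']
  rw [Real.norm_of_nonneg (by linarith : 0 ≤ s), Real.norm_of_nonneg (by linarith : 0 ≤ s - 1),
    Real.norm_of_nonneg (by linarith : 0 ≤ t), Real.norm_of_nonneg (by linarith : 0 ≤ t - 1),
    Real.log_mul (div_pos (by linarith) (by linarith)).ne'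
      (div_pos (by linarith) (by linarith)).ne', add_comm]

/-- All differences of coordinates of the vector `(0, v)`. -/
def consZeroDiff (N : ℕ) : (Fin N → ℝ) →ₗ[ℝ] (Fin (N + 1) × Fin (N + 1) → ℝ) where
  toFun v k := (Fin.cons 0 v : Fin (N + 1) → ℝ) k.1 - (Fin.cons 0 v : Fin (N + 1) → ℝ) k.2
  map_add' v w := by
    ext ⟨i, j⟩
    cases i using Fin.cases <;> cases j using Fin.cases <;> simp <;> ring
  map_smul' c v := by
    ext ⟨i, j⟩
    cases i using Fin.cases <;> cases j using Fin.cases <;> simp [mul_sub]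

theorem consZeroDiff_injective (N : ℕ) : Function.Injective (consZeroDiff N) := by
  intro v w h
  ext i
  simpa [consZeroDiff] using congrFun h (i.succ, 0)

theorem isNorm_half_norm_comp {m : ℕ} {E : Type*} [NormedAddCommGroup E] [NormedSpace ℝ E]
    (T : (Fin m → ℝ) →ₗ[ℝ] E) (hT : Function.Injective T) :
    IsNorm fun v ↦ 1 / 2 * ‖T v‖ := by
  refine ⟨fun x ↦ by positivity, fun x ↦ ?_, fun c x ↦ ?_, fun x y ↦ ?_⟩
  · simp [map_eq_zero_iff T hT]
  · beta_reduce
    rw [map_smul, norm_smul, Real.norm_eq_abs]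
    ring
  · beta_reduce
    rw [map_add]
    linarith [norm_add_le (T x) (T y)]

/-- The Hilbert geometry of a bounded convex polytope `P ⊆ ℝⁿ` with non-empty interior and
exactly `N + 1` faces of dimension `n - 1` embeds isometrically in a normed vector space of
dimension `N`. -/
theorem polytope_embeds_in_normed_space_of_dim_facets {n N : ℕ}
    (F : Finset (Euc n)) (P : Set (Euc n)) (hP : P = convexHull ℝ (↑F : Set (Euc n)))
    (hint : (interior P).Nonempty)
    (hfacets : (facesOfDim P (n - 1)).ncard = N + 1)
    (d : Euc n → Euc n → ℝ) (hd : IsHilbertDist (interior P) d) :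
    ∃ Nm : (Fin N → ℝ) → ℝ, IsNorm Nm ∧
      ∃ f : Euc n → (Fin N → ℝ),
        ∀ x ∈ interior P, ∀ y ∈ interior P, Nm (f x - f y) = d x y := by
  obtain ⟨L, hL, hL0⟩ := exists_affineMaps_of_ncard_facets F hP hint hfacets
  have hbdd : Bornology.IsBounded (interior P) :=
    (hP ▸ isBounded_convexHull.2 F.finite_toSet.isBounded :
      Bornology.IsBounded P).subset interior_subset
  refine ⟨_, isNorm_half_norm_comp _ (consZeroDiff_injective N),
    fun x i ↦ Real.log (L i.succ x) - Real.log (L 0 x), fun x hx y hy ↦ ?_⟩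
  rw [hd.eq_half_norm_log isOpen_interior hbdd hL hL0 hx hy]
  congr 2
  ext ⟨i, j⟩
  cases i using Fin.cases <;> cases j using Fin.cases <;> simp [consZeroDiff] <;> ring
end
end

section
/- Let (Ω, d_Ω) be a Hilbert geometry that embeds isometrically into a finite-dimensional normed vector space (V, ‖·‖), and let N be the maximal cardinality of a 1-separated subset of the unit sphere of (V, ‖·‖) (a set in which any two distinct points are at distance at least 1). Then the boundary ∂Ω cannot contain N+1 distinct extremal points x¹_∞, …, x^{N+1}_∞ such that no supporting hyperplane at any of these points contains the line through any two of them; in particular, Ω is a polytope. -/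
open Set Filter MeasureTheory

noncomputable section

section HilbertGeometry

variable {n : ℕ} {Ω : Set (Euc n)} {d : Euc n → Euc n → ℝ}

/-- The point `o + (1 - ε) (x - o)` at Euclidean proportion `ε` from `x` on the segment `[o, x]`. -/
def radialPoint (o x : Euc n) (ε : ℝ) : Euc n := o + (1 - ε) • (x - o)

theorem IsConvexDomain.frontier_notMem (hΩ : IsConvexDomain Ω) {x : Euc n}
    (hx : x ∈ frontier Ω) : x ∉ Ω := by
  rw [hΩ.2.1.frontier_eq] at hx
  exact hx.2

theorem IsConvexDomain.radialPoint_mem (hΩ : IsConvexDomain Ω) {o x : Euc n} (ho : o ∈ Ω)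
    (hx : x ∈ closure Ω) {ε : ℝ} (h0 : 0 < ε) (h1 : ε < 1) : radialPoint o x ε ∈ Ω := by
  have h := hΩ.2.2.2.combo_interior_closure_mem_interior
    (hΩ.2.1.interior_eq.symm ▸ ho) hx h0 (sub_nonneg.2 h1.le) (by ring)
  rw [hΩ.2.1.interior_eq] at h
  convert h using 1
  unfold radialPoint
  module

/-- A ray issued from a point of a convex domain leaves the domain through its frontier. -/
theorem IsConvexDomain.exists_add_smul_mem_frontier (hΩ : IsConvexDomain Ω) {p v : Euc n}
    (hp : p ∈ Ω) (hv : v ≠ 0) : ∃ t : ℝ, 0 < t ∧ p + t • v ∈ frontier Ω := by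
  have hcont : Continuous fun t : ℝ => p + |t| • v := by fun_prop
  obtain ⟨R, hR⟩ := hΩ.2.2.1.subset_closedBall p
  have hv' : 0 < ‖v‖ := norm_pos_iff.2 hv
  have hR0 : 0 ≤ R := by simpa using hR hp
  obtain ⟨t, ht⟩ : (frontier ((fun t : ℝ => p + |t| • v) ⁻¹' Ω)).Nonempty := by
    refine nonempty_frontier_iff.2 ⟨⟨0, by simpa using hp⟩, fun h => ?_⟩
    have hmem : p + |(R + 1) / ‖v‖| • v ∈ Ω := by
      have := mem_univ ((R + 1) / ‖v‖)
      rwa [← h] at this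
    have := hR hmem
    rw [mem_closedBall_iff_norm, add_sub_cancel_left, norm_smul, Real.norm_eq_abs, abs_abs,
      abs_of_nonneg (by positivity), div_mul_cancel₀ _ hv'.ne'] at this
    linarith
  have ht' := hcont.frontier_preimage_subset Ω ht
  refine ⟨|t|, abs_pos.2 ?_, ht'⟩
  rintro rfl
  exact hΩ.frontier_notMem ht' (by simpa using hp)

theorem IsHilbertDist.eq_log_s16 (hd : IsHilbertDist Ω d) {p q : Euc n} (hp : p ∈ Ω) (hq : q ∈ Ω)
    (hpq : p ≠ q) {s t : ℝ} (hs : s < 0) (ht : 1 < t) (ha : p + s • (q - p) ∈ frontier Ω)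
    (hb : p + t • (q - p) ∈ frontier Ω) :
    d p q = 1 / 2 * Real.log ((1 - s) / -s * (t / (t - 1))) := by
  have hn : 0 < ‖q - p‖ := norm_pos_iff.2 (sub_ne_zero.2 hpq.symm)
  have h1 : ‖q - (p + s • (q - p))‖ = (1 - s) * ‖q - p‖ := by
    rw [show q - (p + s • (q - p)) = (1 - s) • (q - p) by module, norm_smul,
      Real.norm_of_nonneg (by linarith)]
  have h2 : ‖p - (p + s • (q - p))‖ = -s * ‖q - p‖ := by
    rw [show p - (p + s • (q - p)) = (-s) • (q - p) by module, norm_smul,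
      Real.norm_of_nonneg (by linarith)]
  have h3 : ‖p - (p + t • (q - p))‖ = t * ‖q - p‖ := by
    rw [show p - (p + t • (q - p)) = -(t • (q - p)) by module, norm_neg, norm_smul,
      Real.norm_of_nonneg (by linarith)]
  have h4 : ‖q - (p + t • (q - p))‖ = (t - 1) * ‖q - p‖ := by
    rw [show q - (p + t • (q - p)) = -((t - 1) • (q - p)) by module, norm_neg, norm_smul,
      Real.norm_of_nonneg (by linarith)]
  rw [hd.2 p hp q hq hpq _ _ ha hb ⟨s, t, hs, ht, rfl, rfl⟩, h1, h2, h3, h4,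
    mul_div_mul_right _ _ hn.ne', mul_div_mul_right _ _ hn.ne']

/-- The distance from `o` to the point `radialPoint o x ε` is `½ log (1/ε)` up to a bounded
error. -/
theorem IsHilbertDist.radial_bounds (hΩ : IsConvexDomain Ω) (hd : IsHilbertDist Ω d)
    {o x : Euc n} (ho : o ∈ Ω) (hx : x ∈ frontier Ω) :
    ∃ C : ℝ, ∀ ε : ℝ, 0 < ε → ε < 1 →
      -(1 / 2) * Real.log ε ≤ d (radialPoint o x ε) o ∧
      d (radialPoint o x ε) o ≤ -(1 / 2) * Real.log ε + C := by
  have hxo : x - o ≠ 0 := sub_ne_zero.2 fun h => hΩ.frontier_notMem hx (h ▸ ho)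
  obtain ⟨r, hr, hfr⟩ := hΩ.exists_add_smul_mem_frontier ho (neg_ne_zero.2 hxo)
  refine ⟨1 / 2 * Real.log (1 + 1 / r), fun ε h0 h1 => ?_⟩
  have h1' : 0 < 1 - ε := sub_pos.2 h1
  have hne : radialPoint o x ε ≠ o := by
    simp [radialPoint, hxo, h1'.ne']
  have key := hd.eq_log_s16 (hΩ.radialPoint_mem ho hx.1 h0 h1) ho hne
    (s := -(ε / (1 - ε))) (t := 1 + r / (1 - ε)) (neg_lt_zero.2 (by positivity))
    (by linarith [div_pos hr h1'])
    (by
      convert hx using 1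
      rw [radialPoint, show o - (o + (1 - ε) • (x - o)) = -((1 - ε) • (x - o)) by module,
        smul_neg, neg_smul, neg_neg, smul_smul, div_mul_cancel₀ _ h1'.ne']
      module)
    (by
      convert hfr using 1
      rw [radialPoint, show o - (o + (1 - ε) • (x - o)) = -((1 - ε) • (x - o)) by module,
        smul_neg, smul_smul, add_mul, div_mul_cancel₀ _ h1'.ne']
      module)
  have hval : (1 - -(ε / (1 - ε))) / - -(ε / (1 - ε)) *
      ((1 + r / (1 - ε)) / (1 + r / (1 - ε) - 1)) = ε⁻¹ * (1 + (1 - ε) / r) := by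
    rw [add_sub_cancel_left]
    field_simp
    ring
  have hlow : 1 ≤ 1 + (1 - ε) / r := le_add_of_nonneg_right (by positivity)
  rw [key, hval, Real.log_mul (by positivity) (by positivity), Real.log_inv]
  have hupp : 1 + (1 - ε) / r ≤ 1 + 1 / r := by gcongr; linarith
  constructor
  · linarith [Real.log_nonneg hlow]
  · linarith [Real.log_le_log (by linarith) hupp]

/-- The line through two radial points leaves the domain, beyond the first of them, after a
proportion at most linear in `ε`, if some supporting hyperplane at `x` misses `y`. -/
theorem exit_ratio_le {φ : StrongDual ℝ (Euc n)} {o x y : Euc n}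
    (hφ : ∀ w ∈ closure Ω, φ w ≤ φ x) (hy : φ y < φ x) {ε s : ℝ}
    (hε : ε ≤ 1 / 2) (hs : 0 < s)
    (ha : radialPoint o x ε - s • (radialPoint o y ε - radialPoint o x ε) ∈ closure Ω) :
    s ≤ 2 * (φ (x - o) / φ (x - y)) * ε := by
  have hxy : 0 < φ (x - y) := by simpa using hy
  have h := hφ _ ha
  simp only [radialPoint, map_sub, map_add, map_smul, smul_eq_mul] at h hxy ⊢
  rw [← mul_div_assoc, div_mul_eq_mul_div, le_div_iff₀ hxy]
  nlinarith [mul_nonneg (mul_pos hs hxy).le (sub_nonneg.2 hε)]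

/-- If two boundary points admit supporting hyperplanes, each missing the other point, then
the Gromov product along the rays pointing to them is bounded. -/
theorem IsHilbertDist.le_dist_radial (hΩ : IsConvexDomain Ω) (hd : IsHilbertDist Ω d)
    {o x y : Euc n} (ho : o ∈ Ω) (hx : x ∈ closure Ω) (hy : y ∈ closure Ω)
    {φ ψ : StrongDual ℝ (Euc n)} (hφ : ∀ w ∈ closure Ω, φ w ≤ φ x) (hφy : φ y < φ x)
    (hψ : ∀ w ∈ closure Ω, ψ w ≤ ψ y) (hψx : ψ x < ψ y) :
    ∃ C : ℝ, ∀ ε : ℝ, 0 < ε → ε ≤ 1 / 2 →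
      -Real.log ε - C ≤ d (radialPoint o x ε) (radialPoint o y ε) := by
  set K := 2 * (φ (x - o) / φ (x - y))
  set K' := 2 * (ψ (y - o) / ψ (y - x))
  refine ⟨1 / 2 * Real.log (K * K'), fun ε h0 h1 => ?_⟩
  have hp := hΩ.radialPoint_mem ho hx h0 (by linarith)
  have hq := hΩ.radialPoint_mem ho hy h0 (by linarith)
  have hne : radialPoint o x ε ≠ radialPoint o y ε := by
    intro h
    have h' := congrArg φ h
    simp only [radialPoint, map_sub, map_add, map_smul, smul_eq_mul] at h'
    nlinarith
  obtain ⟨s, hs, ha⟩ := hΩ.exists_add_smul_mem_frontier hp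
    (neg_ne_zero.2 (sub_ne_zero.2 hne.symm))
  obtain ⟨t, ht, hb⟩ := hΩ.exists_add_smul_mem_frontier hq (sub_ne_zero.2 hne.symm)
  have hsK : s ≤ K * ε := exit_ratio_le hφ hφy h1 hs (by
    have := ha.1
    rwa [smul_neg, ← sub_eq_add_neg] at this)
  have htK : t ≤ K' * ε := exit_ratio_le hψ hψx h1 ht (by
    have := hb.1
    rwa [show radialPoint o y ε + t • (radialPoint o y ε - radialPoint o x ε) =
      radialPoint o y ε - t • (radialPoint o x ε - radialPoint o y ε) by module] at this)
  have key := hd.eq_log_s16 hp hq hne (s := -s) (t := 1 + t) (by linarith) (by linarith)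
    (by rwa [neg_smul, ← smul_neg])
    (by convert hb using 1; module)
  have hKε : 0 < K * ε := hs.trans_le hsK
  have hKε' : 0 < K' * ε := ht.trans_le htK
  have hK0 : 0 < K := pos_of_mul_pos_left hKε h0.le
  have hK0' : 0 < K' := pos_of_mul_pos_left hKε' h0.le
  have hratio : (K * ε)⁻¹ * (K' * ε)⁻¹ ≤ (1 - -s) / - -s * ((1 + t) / (1 + t - 1)) := by
    rw [neg_neg, sub_neg_eq_add, add_sub_cancel_left, div_eq_mul_inv, div_eq_mul_inv]
    have e1 : (K * ε)⁻¹ ≤ s⁻¹ := inv_anti₀ hs hsK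
    have e2 : (K' * ε)⁻¹ ≤ t⁻¹ := inv_anti₀ ht htK
    have e3 : s⁻¹ ≤ (1 + s) * s⁻¹ := le_mul_of_one_le_left (by positivity) (by linarith)
    have e4 : t⁻¹ ≤ (1 + t) * t⁻¹ := le_mul_of_one_le_left (by positivity) (by linarith)
    exact mul_le_mul (e1.trans e3) (e2.trans e4) (by positivity) (by positivity)
  have hlog := Real.log_le_log (by positivity) hratio
  rw [← mul_inv, Real.log_inv, show K * ε * (K' * ε) = K * K' * (ε * ε) by ring,
    Real.log_mul (by positivity) (by positivity), Real.log_mul h0.ne' h0.ne'] at hlog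
  rw [key]
  linarith

theorem one_le_norm_normalize_sub {V : Type*} [NormedAddCommGroup V] [NormedSpace ℝ V]
    {a b : V} {L A B C : ℝ} (hL : 0 < L) (ha : L ≤ ‖a‖) (ha' : ‖a‖ ≤ L + A) (hb : L ≤ ‖b‖)
    (hb' : ‖b‖ ≤ L + B) (hab : 2 * L - C ≤ ‖a - b‖) (hLC : A + B + C ≤ L) :
    1 ≤ ‖‖a‖⁻¹ • a - ‖b‖⁻¹ • b‖ := by
  have ha0 : 0 < ‖a‖ := hL.trans_le ha
  have hb0 : 0 < ‖b‖ := hL.trans_le hb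
  set u := ‖a‖⁻¹ • a with hu
  set v := ‖b‖⁻¹ • b with hv
  have hau : a = ‖a‖ • u := by rw [hu, smul_inv_smul₀ ha0.ne']
  have hbv : b = ‖b‖ • v := by rw [hv, smul_inv_smul₀ hb0.ne']
  have hu1 : ‖u‖ = 1 := by rw [hu, norm_smul, norm_inv, norm_norm, inv_mul_cancel₀ ha0.ne']
  have hv1 : ‖v‖ = 1 := by rw [hv, norm_smul, norm_inv, norm_norm, inv_mul_cancel₀ hb0.ne']
  have hdecomp : a - b = L • (u - v) + (‖a‖ - L) • u - (‖b‖ - L) • v := by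
    conv_lhs => rw [hau, hbv]
    module
  have h1 : ‖a - b‖ ≤ L * ‖u - v‖ + (‖a‖ - L) + (‖b‖ - L) := by
    conv_lhs => rw [hdecomp]
    refine (norm_sub_le _ _).trans (add_le_add ((norm_add_le _ _).trans (add_le_add ?_ ?_)) ?_)
    · rw [norm_smul, Real.norm_of_nonneg hL.le]
    · rw [norm_smul, hu1, mul_one, Real.norm_of_nonneg (by linarith)]
    · rw [norm_smul, hv1, mul_one, Real.norm_of_nonneg (by linarith)]
  by_contra! hlt
  nlinarith

/-- A finite family of boundary points, each with a supporting hyperplane missing the others,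
has at most as many members as there are points in a `1`-separated subset of the unit sphere. -/
theorem IsHilbertDist.card_le_of_supporting (hΩ : IsConvexDomain Ω) (hd : IsHilbertDist Ω d)
    {V : Type*} [NormedAddCommGroup V] [NormedSpace ℝ V] {f : Euc n → V}
    (hf : ∀ x ∈ Ω, ∀ y ∈ Ω, ‖f x - f y‖ = d x y) {N : ℕ}
    (hN : ∀ s : Finset V, (↑s : Set V) ⊆ Metric.sphere (0 : V) 1 →
      (∀ u ∈ s, ∀ v ∈ s, u ≠ v → 1 ≤ ‖u - v‖) → s.card ≤ N)
    {ι : Type*} [Fintype ι] {x : ι → Euc n} (hx : ∀ i, x i ∈ frontier Ω)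
    (hsupp : ∀ i, ∃ φ : StrongDual ℝ (Euc n), (∀ w ∈ closure Ω, φ w ≤ φ (x i)) ∧
      ∀ j, j ≠ i → φ (x j) < φ (x i)) :
    Fintype.card ι ≤ N := by
  classical
  obtain ⟨o, ho⟩ := hΩ.1
  choose φ hφ hφ' using hsupp
  choose C hC using fun i => hd.radial_bounds hΩ ho (hx i)
  have hD : ∀ i j, ∃ D : ℝ, i ≠ j → ∀ ε : ℝ, 0 < ε → ε ≤ 1 / 2 →
      -Real.log ε - D ≤ d (radialPoint o (x i) ε) (radialPoint o (x j) ε) := by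
    intro i j
    by_cases hij : i = j
    · exact ⟨0, fun h => absurd hij h⟩
    · obtain ⟨D, hD⟩ := hd.le_dist_radial hΩ ho (hx i).1 (hx j).1 (hφ i)
        (hφ' i j (Ne.symm hij)) (hφ j) (hφ' j i hij)
      exact ⟨D, fun _ => hD⟩
  choose D hD using hD
  have hlim : Tendsto (fun ε : ℝ => -(1 / 2) * Real.log ε) (nhdsWithin 0 (Ioi 0)) atTop :=
    Real.tendsto_log_nhdsGT_zero.const_mul_atBot_of_neg (by norm_num)
  have hev : ∀ᶠ ε : ℝ in nhdsWithin 0 (Ioi 0), (0 < ε ∧ ε ≤ 1 / 2) ∧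
      0 < -(1 / 2) * Real.log ε ∧ ∀ i j, C i + C j + D i j ≤ -(1 / 2) * Real.log ε := by
    refine Filter.Eventually.and ?_ ((hlim.eventually_gt_atTop 0).and ?_)
    · filter_upwards [Ioc_mem_nhdsGT (show (0 : ℝ) < 1 / 2 by norm_num)] with ε hε using hε
    · exact eventually_all.2 fun i => eventually_all.2 fun j => hlim.eventually_ge_atTop _
  obtain ⟨ε, ⟨h0, h1⟩, hL, hLC⟩ := hev.exists
  set L := -(1 / 2) * Real.log ε with hLdef
  have hmem : ∀ i, radialPoint o (x i) ε ∈ Ω := fun i =>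
    hΩ.radialPoint_mem ho (hx i).1 h0 (by linarith)
  let w : ι → V := fun i => f (radialPoint o (x i) ε) - f o
  have hw : ∀ i, L ≤ ‖w i‖ ∧ ‖w i‖ ≤ L + C i := fun i => by
    rw [hf _ (hmem i) _ ho]
    exact hC i ε h0 (by linarith)
  have hsep : ∀ i j, i ≠ j → 1 ≤ ‖‖w i‖⁻¹ • w i - ‖w j‖⁻¹ • w j‖ := fun i j hij => by
    refine one_le_norm_normalize_sub hL (hw i).1 (hw i).2 (hw j).1 (hw j).2 (C := D i j) ?_
      (hLC i j)
    rw [sub_sub_sub_cancel_right, hf _ (hmem i) _ (hmem j)]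
    linarith [hD i j hij ε h0 h1]
  have hinj : Function.Injective fun i => ‖w i‖⁻¹ • w i := fun i j hij => by
    by_contra hne
    have := hsep i j hne
    rw [sub_eq_zero.2 hij, norm_zero] at this
    linarith
  have hcard := hN (Finset.univ.image fun i => ‖w i‖⁻¹ • w i) ?_ ?_
  · rwa [Finset.card_image_of_injective _ hinj, Finset.card_univ] at hcard
  · intro v hv
    obtain ⟨i, -, rfl⟩ := Finset.mem_image.1 (Finset.mem_coe.1 hv)
    have : ‖w i‖ ≠ 0 := (hL.trans_le (hw i).1).ne'
    rw [mem_sphere_zero_iff_norm, norm_smul, norm_inv, norm_norm, inv_mul_cancel₀ this]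
  · intro u hu v hv huv
    obtain ⟨i, -, rfl⟩ := Finset.mem_image.1 hu
    obtain ⟨j, -, rfl⟩ := Finset.mem_image.1 hv
    exact hsep i j fun h => huv (by rw [h])

end HilbertGeometry

section ExposedPoints

variable {E : Type*} [NormedAddCommGroup E] [InnerProductSpace ℝ E]

/-- A point of a set farthest from a given point is exposed. -/
theorem mem_exposedPoints_of_forall_dist_le {K : Set E} {c x : E} (hx : x ∈ K)
    (h : ∀ y ∈ K, ‖y - c‖ ≤ ‖x - c‖) : x ∈ K.exposedPoints ℝ := by
  have key : ∀ y ∈ K, ‖y - x‖ ^ 2 ≤ 2 * (inner ℝ (x - c) x - inner ℝ (x - c) y) := by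
    intro y hy
    have h1 : ‖y - c‖ ^ 2 = ‖x - c‖ ^ 2 + 2 * inner ℝ (x - c) (y - x) + ‖y - x‖ ^ 2 := by
      rw [← norm_add_sq_real]
      congr 2
      abel
    have h2 : ‖y - c‖ ^ 2 ≤ ‖x - c‖ ^ 2 := by gcongr; exact h y hy
    rw [inner_sub_right] at h1
    linarith
  refine ⟨hx, innerSL ℝ (x - c), fun y hy => ⟨?_, fun hxy => ?_⟩⟩
  · simp only [innerSL_apply_apply]
    linarith [key y hy, sq_nonneg ‖y - x‖]
  · simp only [innerSL_apply_apply] at hxy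
    have : ‖y - x‖ ^ 2 ≤ 0 := by linarith [key y hy]
    exact sub_eq_zero.1 (norm_eq_zero.1 (pow_eq_zero_iff two_ne_zero |>.1
      (le_antisymm this (sq_nonneg _))))

/-- A compact convex set with finitely many exposed points is their convex hull. -/
theorem convexHull_exposedPoints_of_finite [CompleteSpace E] {K : Set E} (hK : IsCompact K)
    (hconv : Convex ℝ K) (hfin : (K.exposedPoints ℝ).Finite) :
    convexHull ℝ (K.exposedPoints ℝ) = K := by
  refine (convexHull_min (fun _ h => h.1) hconv).antisymm fun z hz => ?_
  by_contra hz'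
  obtain ⟨φ, u, hu, huz⟩ := geometric_hahn_banach_closed_point (convex_convexHull ℝ _)
    (hfin.isClosed_convexHull (𝕜 := ℝ)) hz'
  obtain ⟨R, hR⟩ := hK.isBounded.exists_norm_le
  set v := (InnerProductSpace.toDual ℝ E).symm φ
  have hv : ∀ w, inner ℝ w v = φ w := fun w => by
    rw [real_inner_comm, InnerProductSpace.toDual_symm_apply]
  set l := (R ^ 2 + 1) / (2 * (φ z - u)) with hl
  have hzu : 0 < φ z - u := sub_pos.2 huz
  have hl0 : 0 < l := by positivity
  have hlu : 2 * l * (φ z - u) = R ^ 2 + 1 := by rw [hl]; field_simp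
  obtain ⟨x, hx, hmax⟩ := hK.exists_isMaxOn ⟨z, hz⟩
    (f := fun y => ‖y - (-(l • v))‖) (by fun_prop)
  have hxe : x ∈ K.exposedPoints ℝ := mem_exposedPoints_of_forall_dist_le hx fun y hy => hmax hy
  have hxu := hu x (subset_convexHull ℝ _ hxe)
  have hsq : ∀ y, ‖y - (-(l • v))‖ ^ 2 = ‖y‖ ^ 2 + 2 * l * φ y + ‖l • v‖ ^ 2 := fun y => by
    rw [sub_neg_eq_add, norm_add_sq_real, inner_smul_right, hv]
    ring
  have hle : ‖z - (-(l • v))‖ ^ 2 ≤ ‖x - (-(l • v))‖ ^ 2 := by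
    gcongr
    exact hmax hz
  rw [hsq, hsq] at hle
  have hxR : ‖x‖ ^ 2 ≤ R ^ 2 := by gcongr; exact hR x hx
  nlinarith [sq_nonneg ‖z‖, mul_pos hl0 (sub_pos.2 hxu)]

end ExposedPoints

/-- A point where a non-constant linear functional attains its maximum over a set is not an
interior point of that set. -/
theorem notMem_interior_of_lt {E : Type*} [NormedAddCommGroup E] [NormedSpace ℝ E] {K : Set E}
    {x y : E} {φ : StrongDual ℝ E} (hφ : ∀ w ∈ K, φ w ≤ φ x) (hy : φ y < φ x) :
    x ∉ interior K := by
  intro hx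
  have hcont : Tendsto (fun t : ℝ => x + t • (x - y)) (nhdsWithin 0 (Ioi 0)) (nhds x) := by
    have : Continuous fun t : ℝ => x + t • (x - y) := by fun_prop
    simpa using (this.tendsto 0).mono_left nhdsWithin_le_nhds
  obtain ⟨t, ht, ht0⟩ := ((hcont.eventually (mem_interior_iff_mem_nhds.1 hx)).and
    self_mem_nhdsWithin).exists
  have := hφ _ ht
  simp only [map_add, map_smul, map_sub, smul_eq_mul] at this
  nlinarith [mul_pos (show (0 : ℝ) < t from ht0) (sub_pos.2 hy)]

/-- **Colbois–Verovic argument.**  Suppose the Hilbert geometry `(Ω, d_Ω)` embeds isometrically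
into a finite-dimensional normed vector space `(V, ‖·‖)`, and let `N` be the maximal
cardinality of a `1`-separated subset of the unit sphere of `V`.  Then the boundary `∂Ω`
cannot contain `N + 1` distinct extremal points such that no supporting hyperplane at any of
these points contains the line through any two of them; in particular, `Ω` is a polytope. -/
theorem embedded_hilbert_geometry_few_extreme_points {n : ℕ}
    (Ω : Set (Euc n)) (hΩ : IsConvexDomain Ω)
    (d : Euc n → Euc n → ℝ) (hd : IsHilbertDist Ω d)
    (V : Type*) [NormedAddCommGroup V] [NormedSpace ℝ V] [FiniteDimensional ℝ V]
    (f : Euc n → V) (hf : ∀ x ∈ Ω, ∀ y ∈ Ω, ‖f x - f y‖ = d x y)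
    (N : ℕ)
    (hNreached : ∃ s : Finset V, (↑s : Set V) ⊆ Metric.sphere (0 : V) 1 ∧
      (∀ u ∈ s, ∀ v ∈ s, u ≠ v → 1 ≤ ‖u - v‖) ∧ s.card = N)
    (hNmax : ∀ s : Finset V, (↑s : Set V) ⊆ Metric.sphere (0 : V) 1 →
      (∀ u ∈ s, ∀ v ∈ s, u ≠ v → 1 ≤ ‖u - v‖) → s.card ≤ N) :
    (¬ ∃ x : Fin (N + 1) → Euc n, Function.Injective x ∧
        (∀ i, x i ∈ frontier Ω ∧ x i ∈ Set.extremePoints ℝ (closure Ω)) ∧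
        (∀ (i : Fin (N + 1)) (g : Euc n →ᵃ[ℝ] ℝ), g.linear ≠ 0 →
          (∀ w ∈ closure Ω, 0 ≤ g w) → g (x i) = 0 →
          ∀ j k : Fin (N + 1), j ≠ k → ¬ (g (x j) = 0 ∧ g (x k) = 0))) ∧
    ∃ F : Finset (Euc n), Ω = interior (convexHull ℝ (↑F : Set (Euc n))) := by
  refine ⟨?_, ?_⟩
  · rintro ⟨x, -, hx, hsupp⟩
    have hcard := hd.card_le_of_supporting hΩ hf hNmax (fun i => (hx i).1) fun i => ?_
    · simp at hcard
    · obtain ⟨φ, hφ⟩ := geometric_hahn_banach_open_point hΩ.2.2.2 hΩ.2.1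
        (hΩ.frontier_notMem (hx i).1)
      have hφ' : ∀ w ∈ closure Ω, φ w ≤ φ (x i) := fun w hw =>
        closure_minimal (fun a ha => (hφ a ha).le) (isClosed_le φ.continuous continuous_const) hw
      refine ⟨φ, hφ', fun j hj => lt_of_le_of_ne (hφ' _ (hx j).1.1) fun heq => ?_⟩
      let g : Euc n →ᵃ[ℝ] ℝ := AffineMap.const ℝ (Euc n) (φ (x i)) - φ.toLinearMap.toAffineMap
      have hg : ∀ w, g w = φ (x i) - φ w := fun w => rfl
      refine hsupp i g (fun h0 => ?_) (fun w hw => ?_) (by simp [hg]) j i hj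
        ⟨by simp [hg, heq], by simp [hg]⟩
      · obtain ⟨o, ho⟩ := hΩ.1
        have h := g.linearMap_vsub o (x i)
        rw [h0, LinearMap.zero_apply, vsub_eq_sub, hg, hg, sub_self, sub_zero] at h
        linarith [hφ o ho]
      · rw [hg]
        exact sub_nonneg.2 (hφ' w hw)
  · have hcompact : IsCompact (closure Ω) := hΩ.2.2.1.isCompact_closure
    have hfin : ((closure Ω).exposedPoints ℝ).Finite := by
      by_contra hinf
      obtain ⟨s, hs, hscard⟩ := Set.Infinite.exists_subset_card_eq hinf (N + 2)
      have hexp : ∀ i : s, ∃ φ : StrongDual ℝ (Euc n), (∀ w ∈ closure Ω, φ w ≤ φ i) ∧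
          ∀ j : s, j ≠ i → φ j < φ i := fun i => by
        obtain ⟨-, φ, hφ⟩ := hs i.2
        refine ⟨φ, fun w hw => (hφ w hw).1, fun j hj => ?_⟩
        have hj' := hφ j (hs j.2).1
        exact lt_of_le_of_ne hj'.1 fun h => hj (Subtype.ext (hj'.2 h.ge))
      have hcard := hd.card_le_of_supporting hΩ hf hNmax (x := fun i : s => (i : Euc n))
        (fun i => ?_) hexp
      · simp [hscard] at hcard
      · obtain ⟨φ, hφ, hlt⟩ := hexp i
        have : Nontrivial s := by
          rw [← Fintype.one_lt_card_iff_nontrivial, Fintype.card_coe, hscard]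
          omega
        obtain ⟨j, hj⟩ := exists_ne i
        exact ⟨(hs i.2).1,
          notMem_interior_of_lt (fun w hw => hφ w (subset_closure hw)) (hlt j hj)⟩
    refine ⟨hfin.toFinset, ?_⟩
    rw [hfin.coe_toFinset, convexHull_exposedPoints_of_finite hcompact hΩ.2.2.2.closure hfin,
      hΩ.2.2.2.interior_closure_eq_interior_of_nonempty_interior
        (hΩ.2.1.interior_eq.symm ▸ hΩ.1), hΩ.2.1.interior_eq]
end
end

section
/- Let (Ω, d_Ω) be a Hilbert geometry, let x_∞ and y_∞ be two distinct extremal points of ∂Ω such that no supporting hyperplane of Ω at x_∞ or at y_∞ contains the line through x_∞ and y_∞, let o ∈ Ω, and let x(t) and y(t) (t ≥ 0) be unit-speed geodesic rays of (Ω, d_Ω) starting at o and converging to x_∞ and y_∞ respectively. Then lim_{t→∞} d_Ω(x(t), y(t)) / (2t) = 1. -/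
open Set Filter MeasureTheory

noncomputable section

theorem exists_frontier_point_beyond {n : ℕ} {Ω : Set (Euc n)} (hΩ : IsConvexDomain Ω)
    {p q : Euc n} (hq : q ∈ Ω) (hpq : p ≠ q) :
    ∃ t : ℝ, 1 < t ∧ p + t • (q - p) ∈ frontier Ω := by
  obtain ⟨-, hopen, hbdd, -⟩ := hΩ
  have hcont : Continuous fun t : ℝ => p + t • (q - p) := by fun_prop
  set T : Set ℝ := (fun t : ℝ => p + t • (q - p)) ⁻¹' closure Ω with hT
  have hN : 0 < ‖q - p‖ := norm_pos_iff.2 (sub_ne_zero.2 hpq.symm)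
  have hone : (1 : ℝ) ∈ T := by
    simpa [hT] using subset_closure hq
  have hTcompact : IsCompact T := by
    refine Metric.isCompact_of_isClosed_isBounded (isClosed_closure.preimage hcont) ?_
    obtain ⟨C, hC⟩ := hbdd.closure.exists_norm_le
    refine (isBounded_iff_forall_norm_le).2 ⟨(C + ‖p‖) / ‖q - p‖, fun t ht => ?_⟩
    rw [le_div_iff₀ hN, ← norm_smul]
    calc ‖t • (q - p)‖ = ‖(p + t • (q - p)) - p‖ := by simp
      _ ≤ ‖p + t • (q - p)‖ + ‖p‖ := norm_sub_le _ _
      _ ≤ C + ‖p‖ := by gcongr; exact hC _ ht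
  obtain ⟨t, htT, hmax⟩ := hTcompact.exists_isGreatest ⟨1, hone⟩
  have hnot : p + t • (q - p) ∉ Ω := by
    intro hmem
    have hnhds : ∀ᶠ u in nhds t, p + u • (q - p) ∈ Ω :=
      hcont.continuousAt.eventually (hopen.mem_nhds hmem)
    obtain ⟨ε, hε, hball⟩ := Metric.eventually_nhds_iff.1 hnhds
    have hlt : t + ε / 2 ∈ T := subset_closure (hball (by
      rw [Real.dist_eq, add_sub_cancel_left, abs_of_pos (by positivity)]; linarith))
    linarith [hmax hlt]
  refine ⟨t, lt_of_le_of_ne (hmax hone) ?_, htT, by rwa [hopen.interior_eq]⟩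
  rintro rfl
  exact hnot (by simpa using hq)

theorem exists_frontier_points {n : ℕ} {Ω : Set (Euc n)} (hΩ : IsConvexDomain Ω)
    {p q : Euc n} (hp : p ∈ Ω) (hq : q ∈ Ω) (hpq : p ≠ q) :
    ∃ s t : ℝ, s < 0 ∧ 1 < t ∧ p + s • (q - p) ∈ frontier Ω ∧ p + t • (q - p) ∈ frontier Ω := by
  obtain ⟨t, ht, htf⟩ := exists_frontier_point_beyond hΩ hq hpq
  obtain ⟨u, hu, huf⟩ := exists_frontier_point_beyond hΩ hp hpq.symm
  refine ⟨1 - u, t, by linarith, ht, ?_, htf⟩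
  convert huf using 1
  module

theorem exists_affine_support {n : ℕ} {Ω : Set (Euc n)} (hΩ : IsConvexDomain Ω)
    {z : Euc n} (hz : z ∉ Ω) :
    ∃ g : Euc n →ᵃ[ℝ] ℝ, g.linear ≠ 0 ∧ g z = 0 ∧ ∀ w ∈ Ω, 0 < g w := by
  obtain ⟨⟨w₀, hw₀⟩, hopen, -, hconv⟩ := hΩ
  obtain ⟨φ, hφ⟩ := geometric_hahn_banach_open_point hconv hopen hz
  let g : Euc n →ᵃ[ℝ] ℝ :=
    AffineMap.const ℝ (Euc n) (φ z) - (φ : Euc n →ₗ[ℝ] ℝ).toAffineMap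
  have hg : ∀ w, g w = φ z - φ w := fun w => by simp [g]
  refine ⟨g, fun h => ?_, by simp [hg], fun w hw => by rw [hg]; linarith [hφ w hw]⟩
  have h0 : g.linear (w₀ - z) = g w₀ - g z := g.linearMap_vsub w₀ z
  rw [h, hg, hg, LinearMap.zero_apply] at h0
  linarith [hφ w₀ hw₀]

theorem AffineMap.apply_add_smul_sub {n : ℕ} (g : Euc n →ᵃ[ℝ] ℝ) (p q : Euc n) (t : ℝ) :
    g (p + t • (q - p)) = g p + t * (g q - g p) := by
  have h := g.apply_lineMap p q t
  rw [AffineMap.lineMap_apply_module', AffineMap.lineMap_apply_module', smul_eq_mul] at h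
  rw [add_comm p, h, add_comm]

theorem AffineMap.nonneg_on_closure {n : ℕ} {Ω : Set (Euc n)} {g : Euc n →ᵃ[ℝ] ℝ}
    (hg : ∀ w ∈ Ω, 0 < g w) {w : Euc n} (hw : w ∈ closure Ω) : 0 ≤ g w :=
  closure_minimal (fun v hv => (hg v hv).le)
    (isClosed_Ici.preimage g.continuous_of_finiteDimensional) hw

namespace IsHilbertDist

variable {n : ℕ} {Ω : Set (Euc n)} {d : Euc n → Euc n → ℝ}

theorem eq_log_s17 (hd : IsHilbertDist Ω d) {p q : Euc n} (hp : p ∈ Ω) (hq : q ∈ Ω) (hpq : p ≠ q)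
    {s t : ℝ} (hs : s < 0) (ht : 1 < t) (ha : p + s • (q - p) ∈ frontier Ω)
    (hb : p + t • (q - p) ∈ frontier Ω) :
    d p q = (1 / 2) * Real.log ((1 - s) / (-s) * (t / (t - 1))) := by
  have hN : ‖q - p‖ ≠ 0 := norm_ne_zero_iff.2 (sub_ne_zero.2 hpq.symm)
  rw [hd.2 p hp q hq hpq _ _ ha hb ⟨s, t, hs, ht, rfl, rfl⟩]
  have h₁ : q - (p + s • (q - p)) = (1 - s) • (q - p) := by module
  have h₂ : p - (p + s • (q - p)) = (-s) • (q - p) := by module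
  have h₃ : p - (p + t • (q - p)) = (-t) • (q - p) := by module
  have h₄ : q - (p + t • (q - p)) = (-(t - 1)) • (q - p) := by module
  rw [h₁, h₂, h₃, h₄]
  simp only [norm_smul, Real.norm_eq_abs, abs_neg]
  rw [abs_of_pos (by linarith : 0 < 1 - s), abs_of_neg hs, abs_of_pos (by linarith : 0 < t),
    abs_of_pos (by linarith : 0 < t - 1), mul_div_mul_right _ _ hN, mul_div_mul_right _ _ hN]

theorem log_le_s17 (hΩ : IsConvexDomain Ω) (hd : IsHilbertDist Ω d) {f g : Euc n →ᵃ[ℝ] ℝ}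
    (hf : ∀ w ∈ Ω, 0 < f w) (hg : ∀ w ∈ Ω, 0 < g w) {p q : Euc n} (hp : p ∈ Ω) (hq : q ∈ Ω) :
    (1 / 2) * Real.log (f q / f p * (g p / g q)) ≤ d p q := by
  have hfp := hf p hp
  have hfq := hf q hq
  have hgp := hg p hp
  have hgq := hg q hq
  rcases eq_or_ne p q with rfl | hpq
  · rw [hd.1 p hp, div_self hfp.ne', div_self hgp.ne']
    simp
  obtain ⟨s, t, hs, ht, ha, hb⟩ := exists_frontier_points hΩ hp hq hpq
  rw [hd.eq_log_s17 hp hq hpq hs ht ha hb]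
  have hfa := AffineMap.nonneg_on_closure hf ha.1
  have hgb := AffineMap.nonneg_on_closure hg hb.1
  rw [AffineMap.apply_add_smul_sub] at hfa hgb
  have h₁ : f q / f p ≤ (1 - s) / (-s) := by
    rw [div_le_div_iff₀ hfp (by linarith)]; linarith
  have h₂ : g p / g q ≤ t / (t - 1) := by
    rw [div_le_div_iff₀ hgq (by linarith)]; linarith
  gcongr
  exact div_nonneg (by linarith) (by linarith)

theorem exists_eq_log_s17 (hΩ : IsConvexDomain Ω) (hd : IsHilbertDist Ω d) {p q : Euc n}
    (hp : p ∈ Ω) (hq : q ∈ Ω) :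
    ∃ f g : Euc n →ᵃ[ℝ] ℝ, (∀ w ∈ Ω, 0 < f w) ∧ (∀ w ∈ Ω, 0 < g w) ∧
      d p q = (1 / 2) * Real.log (f q / f p * (g p / g q)) := by
  rcases eq_or_ne p q with rfl | hpq
  · exact ⟨AffineMap.const ℝ _ 1, AffineMap.const ℝ _ 1, by simp, by simp, by simp [hd.1 p hp]⟩
  obtain ⟨s, t, hs, ht, ha, hb⟩ := exists_frontier_points hΩ hp hq hpq
  have hnot : ∀ {z}, z ∈ frontier Ω → z ∉ Ω := fun hz h => by
    rw [hΩ.2.1.frontier_eq] at hz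
    exact hz.2 h
  obtain ⟨f, -, hfa, hf⟩ := exists_affine_support hΩ (hnot ha)
  obtain ⟨g, -, hgb, hg⟩ := exists_affine_support hΩ (hnot hb)
  refine ⟨f, g, hf, hg, ?_⟩
  rw [AffineMap.apply_add_smul_sub] at hfa hgb
  have h₁ : f q / f p = (1 - s) / (-s) := by
    rw [div_eq_div_iff (hf p hp).ne' (by linarith)]; linarith
  have h₂ : g p / g q = t / (t - 1) := by
    rw [div_eq_div_iff (hg q hq).ne' (by linarith)]; linarith
  rw [h₁, h₂, hd.eq_log_s17 hp hq hpq hs ht ha hb]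

theorem comm_le (hΩ : IsConvexDomain Ω) (hd : IsHilbertDist Ω d) {p q : Euc n}
    (hp : p ∈ Ω) (hq : q ∈ Ω) : d p q ≤ d q p := by
  obtain ⟨f, g, hf, hg, h⟩ := hd.exists_eq_log_s17 hΩ hp hq
  rw [h, mul_comm (f q / f p)]
  exact hd.log_le_s17 hΩ hg hf hq hp

theorem comm (hΩ : IsConvexDomain Ω) (hd : IsHilbertDist Ω d) {p q : Euc n}
    (hp : p ∈ Ω) (hq : q ∈ Ω) : d p q = d q p :=
  le_antisymm (hd.comm_le hΩ hp hq) (hd.comm_le hΩ hq hp)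

theorem triangle (hΩ : IsConvexDomain Ω) (hd : IsHilbertDist Ω d) {p q r : Euc n}
    (hp : p ∈ Ω) (hq : q ∈ Ω) (hr : r ∈ Ω) : d p r ≤ d p q + d q r := by
  obtain ⟨f, g, hf, hg, h⟩ := hd.exists_eq_log_s17 hΩ hp hr
  have hfp := hf p hp
  have hfq := hf q hq
  have hfr := hf r hr
  have hgp := hg p hp
  have hgq := hg q hq
  have hgr := hg r hr
  have hmul : f r / f p * (g p / g r) =
      (f q / f p * (g p / g q)) * (f r / f q * (g q / g r)) := by
    field_simp
  rw [h, hmul, Real.log_mul (by positivity) (by positivity), mul_add]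
  exact add_le_add (hd.log_le_s17 hΩ hf hg hp hq) (hd.log_le_s17 hΩ hf hg hq hr)

theorem add_midpoint (hΩ : IsConvexDomain Ω) (hd : IsHilbertDist Ω d) {p q : Euc n}
    (hp : p ∈ Ω) (hq : q ∈ Ω) : d p (midpoint ℝ p q) + d (midpoint ℝ p q) q = d p q := by
  rcases eq_or_ne p q with rfl | hpq
  · simp [hd.1 p hp]
  have hm : midpoint ℝ p q ∈ Ω := hΩ.2.2.2.midpoint_mem hp hq
  have hm_eq : midpoint ℝ p q = (1 / 2 : ℝ) • (p + q) := by
    rw [midpoint_eq_smul_add]; norm_num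
  obtain ⟨s, t, hs, ht, ha, hb⟩ := exists_frontier_points hΩ hp hq hpq
  have ha₁ : p + (2 * s) • (midpoint ℝ p q - p) ∈ frontier Ω := by
    convert ha using 1; rw [hm_eq]; module
  have hb₁ : p + (2 * t) • (midpoint ℝ p q - p) ∈ frontier Ω := by
    convert hb using 1; rw [hm_eq]; module
  have ha₂ : midpoint ℝ p q + (2 * s - 1) • (q - midpoint ℝ p q) ∈ frontier Ω := by
    convert ha using 1; rw [hm_eq]; module
  have hb₂ : midpoint ℝ p q + (2 * t - 1) • (q - midpoint ℝ p q) ∈ frontier Ω := by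
    convert hb using 1; rw [hm_eq]; module
  have hpm : p ≠ midpoint ℝ p q := by simpa [left_eq_midpoint_iff] using hpq
  have hmq : midpoint ℝ p q ≠ q := by simpa [midpoint_eq_right_iff] using hpq
  rw [hd.eq_log_s17 hp hm hpm (by linarith) (by linarith) ha₁ hb₁,
    hd.eq_log_s17 hm hq hmq (by linarith) (by linarith) ha₂ hb₂, hd.eq_log_s17 hp hq hpq hs ht ha hb]
  have h₁ : 1 - s ≠ 0 := by linarith
  have h₂ : 1 - 2 * s ≠ 0 := by linarith
  have h₃ : t - 1 ≠ 0 := by linarith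
  have h₄ : 2 * t - 1 ≠ 0 := by linarith
  have h₅ : t ≠ 0 := by linarith
  have h₆ : s ≠ 0 := hs.ne
  have h₇ : 1 - (2 * s - 1) = 2 * (1 - s) := by ring
  have h₈ : 2 * t - 1 - 1 = 2 * (t - 1) := by ring
  have h₉ : -(2 * s - 1) = 1 - 2 * s := by ring
  have h₁₀ : -(2 * s) ≠ 0 := by linarith
  rw [← mul_add, h₇, h₈, h₉, ← Real.log_mul
    (mul_ne_zero (div_ne_zero h₂ h₁₀) (div_ne_zero (by linarith) h₄))
    (mul_ne_zero (div_ne_zero (by linarith) h₂) (div_ne_zero h₄ (by linarith)))]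
  congr 2
  field_simp

/-- The two extra points are the reflections of `m` and `m'` in each other. -/
theorem le_log_two (hΩ : IsConvexDomain Ω) (hd : IsHilbertDist Ω d) {m m' : Euc n}
    (hm : m ∈ Ω) (hm' : m' ∈ Ω) (h₁ : m + (2 : ℝ) • (m' - m) ∈ Ω)
    (h₂ : m' + (2 : ℝ) • (m - m') ∈ Ω) : d m m' ≤ Real.log 2 := by
  obtain ⟨f, g, hf, hg, h⟩ := hd.exists_eq_log_s17 hΩ hm hm'
  have hf₂ := hf _ h₂
  have hg₁ := hg _ h₁
  rw [AffineMap.apply_add_smul_sub] at hf₂ hg₁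
  have hfm := hf m hm
  have hfm' := hf m' hm'
  have hgm := hg m hm
  have hgm' := hg m' hm'
  have hf' : f m' / f m ≤ 2 := by rw [div_le_iff₀ hfm]; linarith
  have hg' : g m / g m' ≤ 2 := by rw [div_le_iff₀ hgm']; linarith
  have hle : Real.log (f m' / f m * (g m / g m')) ≤ Real.log (2 * 2) := by gcongr
  rw [Real.log_mul two_ne_zero two_ne_zero] at hle
  rw [h]
  linarith

end IsHilbertDist

/-- Let `x_∞` and `y_∞` be two distinct extremal points of `∂Ω` such that no supporting
hyperplane of `Ω` at `x_∞` or `y_∞` contains the line through `x_∞` and `y_∞`, and let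
`x(t)`, `y(t)` be unit-speed geodesic rays of `(Ω, d_Ω)` from a point `o ∈ Ω` converging to
`x_∞` and `y_∞` respectively.  Then `d_Ω(x(t), y(t)) / (2t) → 1` as `t → ∞`. -/
theorem hilbert_rays_to_extreme_points_diverge_linearly {n : ℕ}
    (Ω : Set (Euc n)) (hΩ : IsConvexDomain Ω)
    (d : Euc n → Euc n → ℝ) (hd : IsHilbertDist Ω d)
    (xinf yinf : Euc n) (hne : xinf ≠ yinf)
    (hx : xinf ∈ frontier Ω ∧ xinf ∈ Set.extremePoints ℝ (closure Ω))
    (hy : yinf ∈ frontier Ω ∧ yinf ∈ Set.extremePoints ℝ (closure Ω))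
    (hsupp : ∀ g : Euc n →ᵃ[ℝ] ℝ, g.linear ≠ 0 → (∀ w ∈ closure Ω, 0 ≤ g w) →
      (g xinf = 0 ∨ g yinf = 0) → ¬ (g xinf = 0 ∧ g yinf = 0))
    (o : Euc n) (ho : o ∈ Ω)
    (γx γy : ℝ → Euc n)
    (hγxΩ : ∀ t : ℝ, 0 ≤ t → γx t ∈ Ω) (hγyΩ : ∀ t : ℝ, 0 ≤ t → γy t ∈ Ω)
    (hγx0 : γx 0 = o) (hγy0 : γy 0 = o)
    (hγxgeo : ∀ s t : ℝ, 0 ≤ s → 0 ≤ t → d (γx s) (γx t) = |s - t|)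
    (hγygeo : ∀ s t : ℝ, 0 ≤ s → 0 ≤ t → d (γy s) (γy t) = |s - t|)
    (hγxlim : Filter.Tendsto γx Filter.atTop (nhds xinf))
    (hγylim : Filter.Tendsto γy Filter.atTop (nhds yinf)) :
    Filter.Tendsto (fun t : ℝ => d (γx t) (γy t) / (2 * t)) Filter.atTop (nhds 1) := by
  have hm : midpoint ℝ xinf yinf ∈ Ω := by
    by_contra hm
    obtain ⟨g, hlin, hgm, hg⟩ := exists_affine_support hΩ hm
    have hgc : ∀ w ∈ closure Ω, 0 ≤ g w := fun w hw => AffineMap.nonneg_on_closure hg hw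
    have hsum : g xinf + g yinf = 0 := by
      rw [AffineMap.map_midpoint, midpoint_eq_smul_add, smul_eq_mul] at hgm
      exact (mul_eq_zero.1 hgm).resolve_left (by norm_num)
    have hgx := hgc xinf hx.1.1
    have hgy := hgc yinf hy.1.1
    have hx0 : g xinf = 0 := by linarith
    exact hsupp g hlin hgc (Or.inl hx0) ⟨hx0, by linarith⟩
  set m := midpoint ℝ xinf yinf with hm_def
  have hmid : Tendsto (fun t => midpoint ℝ (γx t) (γy t)) atTop (nhds m) := by
    simp only [hm_def, midpoint_eq_smul_add]
    exact (hγxlim.add hγylim).const_smul _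
  have hlim₁ : Tendsto (fun t => m + (2 : ℝ) • (midpoint ℝ (γx t) (γy t) - m)) atTop
      (nhds m) := by
    simpa using ((hmid.sub_const m).const_smul (2 : ℝ)).const_add m
  have hlim₂ : Tendsto (fun t => midpoint ℝ (γx t) (γy t) +
      (2 : ℝ) • (m - midpoint ℝ (γx t) (γy t))) atTop (nhds m) := by
    simpa using hmid.add ((hmid.const_sub m).const_smul (2 : ℝ))
  have hnhds := hΩ.2.1.mem_nhds hm
  set K := d o m + Real.log 2 with hK
  have hupper : ∀ t, 0 ≤ t → d (γx t) (γy t) ≤ 2 * t := fun t ht => by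
    have h₁ := hγxgeo t 0 ht le_rfl
    have h₂ := hγygeo 0 t le_rfl ht
    rw [hγx0, sub_zero, abs_of_nonneg ht] at h₁
    rw [hγy0, zero_sub, abs_neg, abs_of_nonneg ht] at h₂
    linarith [hd.triangle hΩ (hγxΩ t ht) ho (hγyΩ t ht)]
  have hlower : ∀ᶠ t in atTop, 2 * t - 2 * K ≤ d (γx t) (γy t) := by
    filter_upwards [hlim₁ hnhds, hlim₂ hnhds, eventually_ge_atTop 0] with t h₁ h₂ ht
    have hxt := hγxΩ t ht
    have hyt := hγyΩ t ht
    have hmt : midpoint ℝ (γx t) (γy t) ∈ Ω := hΩ.2.2.2.midpoint_mem hxt hyt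
    have hdx := hγxgeo 0 t le_rfl ht
    have hdy := hγygeo 0 t le_rfl ht
    rw [hγx0, zero_sub, abs_neg, abs_of_nonneg ht] at hdx
    rw [hγy0, zero_sub, abs_neg, abs_of_nonneg ht] at hdy
    have hom : d o (midpoint ℝ (γx t) (γy t)) ≤ K :=
      (hd.triangle hΩ ho hm hmt).trans (by linarith [hd.le_log_two hΩ hm hmt h₁ h₂])
    have hadd := hd.add_midpoint hΩ hxt hyt
    have htx := hd.triangle hΩ ho hmt hxt
    have hty := hd.triangle hΩ ho hmt hyt
    rw [hd.comm hΩ hmt hxt] at htx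
    linarith
  have hlimit : Tendsto (fun t : ℝ => 1 - K / t) atTop (nhds 1) := by
    simpa using (tendsto_id.const_div_atTop K).const_sub 1
  refine tendsto_of_tendsto_of_tendsto_of_le_of_le' hlimit tendsto_const_nhds ?_ ?_
  · filter_upwards [hlower, eventually_gt_atTop 0] with t h ht
    rw [le_div_iff₀ (by positivity)]
    calc (1 - K / t) * (2 * t) = 2 * t - 2 * K := by field_simp
      _ ≤ _ := h
  · filter_upwards [eventually_gt_atTop 0] with t ht
    rw [div_le_one (by positivity)]
    exact hupper t ht.le
end
end

section
/- Let P be a bounded convex polytope in ℝⁿ with non-empty interior and let (int P, d_P) be its Hilbert geometry. Then (int P, d_P) is bi-Lipschitz equivalent to the Euclidean space (ℝⁿ, ‖·‖): there exist a bijection Φ : int P → ℝⁿ and a constant A ≥ 1 such that (1/A)·‖Φ(x) − Φ(y)‖ ≤ d_P(x,y) ≤ A·‖Φ(x) − Φ(y)‖ for all x, y ∈ int P. -/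
open Set Filter MeasureTheory

noncomputable section

open scoped Topology RealInnerProductSpace

section Auxiliary

variable {E : Type*} [NormedAddCommGroup E] [InnerProductSpace ℝ E]
variable {ι : Type*}

/-- A linear map that is injective at the origin of a closed cone is bounded below on it. -/
lemma exists_norm_le_of_closed_cone {V W : Type*} [NormedAddCommGroup V] [NormedSpace ℝ V]
    [ProperSpace V] [NormedAddCommGroup W] [NormedSpace ℝ W] (L : V →L[ℝ] W) {K : Set V}
    (hK : IsClosed K) (hcone : ∀ t ∈ K, ∀ r : ℝ, 0 ≤ r → r • t ∈ K)
    (hker : ∀ z ∈ K, L z = 0 → z = 0) :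
    ∃ C : ℝ, 0 ≤ C ∧ ∀ t ∈ K, ‖t‖ ≤ C * ‖L t‖ := by
  have hcomp : IsCompact (K ∩ Metric.sphere (0 : V) 1) := (isCompact_sphere 0 1).inter_left hK
  have hnormalize : ∀ t ∈ K, t ≠ 0 → ‖t‖⁻¹ • t ∈ K ∩ Metric.sphere (0 : V) 1 := fun t ht h0 =>
    ⟨hcone t ht _ (by positivity), by simp [norm_smul, h0]⟩
  rcases (K ∩ Metric.sphere (0 : V) 1).eq_empty_or_nonempty with hemp | hne
  · refine ⟨0, le_rfl, fun t ht => ?_⟩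
    by_cases h0 : t = 0
    · simp [h0]
    · exact absurd (hnormalize t ht h0) (by simp [hemp])
  · obtain ⟨z, hz, hmin⟩ := hcomp.exists_isMinOn hne L.continuous.norm.continuousOn
    have hz1 : ‖z‖ = 1 := by simpa using hz.2
    have hLz : 0 < ‖L z‖ := by
      rw [norm_pos_iff]
      intro h
      simp [hker z hz.1 h] at hz1
    refine ⟨‖L z‖⁻¹, by positivity, fun t ht => ?_⟩
    by_cases h0 : t = 0
    · simp [h0]
    · have h := hmin (hnormalize t ht h0)
      have ht0 : 0 < ‖t‖ := norm_pos_iff.2 h0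
      simp only [mem_ofPred_eq, map_smul, norm_smul, norm_inv, norm_norm] at h
      rw [inv_mul_eq_div, le_div_iff₀ ht0] at h
      rw [inv_mul_eq_div, le_div_iff₀ hLz]
      linarith

/-- The closed cone of vectors conforming to a sign pattern. -/
def signCone (σ : ι → SignType) : Set (ι → ℝ) :=
  {t | ∀ j, (σ j = 1 → 0 ≤ t j) ∧ (σ j = -1 → t j ≤ 0) ∧ (σ j = 0 → t j = 0)}

lemma isClosed_signCone (σ : ι → SignType) : IsClosed (signCone σ) := by
  have hrw : signCone σ = ⋂ j, {t : ι → ℝ | (σ j = 1 → 0 ≤ t j) ∧ (σ j = -1 → t j ≤ 0) ∧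
      (σ j = 0 → t j = 0)} := by
    ext; simp [signCone]
  rw [hrw]
  refine isClosed_iInter fun j => ?_
  cases h : σ j
  · simpa using isClosed_eq (continuous_apply j) continuous_const
  · simpa using isClosed_le (continuous_apply j) continuous_const
  · simpa using isClosed_le continuous_const (continuous_apply j)

/-- A uniform bound for weighted least squares, in the style of Dikin, Stewart and Todd: the
constant depends only on the vectors `a j`, not on the positive weights relating `t j` to
`⟪a j, v⟫`. -/
lemma exists_norm_le_of_sign_eq [Fintype ι] (a : ι → E) :
    ∃ C : ℝ, 0 ≤ C ∧ ∀ (t : ι → ℝ) (v : E),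
      (∀ j, SignType.sign (t j) = SignType.sign ⟪a j, v⟫) → ‖t‖ ≤ C * ‖∑ j, t j • a j‖ := by
  classical
  let L : (ι → ℝ) →L[ℝ] E :=
    ∑ j, (ContinuousLinearMap.proj (R := ℝ) (φ := fun _ : ι => ℝ) j).smulRight (a j)
  have hL : ∀ t, L t = ∑ j, t j • a j := fun t => by simp [L]
  have key : ∀ σ : ι → SignType, ∃ C : ℝ, 0 ≤ C ∧
      ((∀ z ∈ signCone σ, L z = 0 → z = 0) → ∀ t ∈ signCone σ, ‖t‖ ≤ C * ‖L t‖) := by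
    intro σ
    by_cases hσ : ∀ z ∈ signCone σ, L z = 0 → z = 0
    · obtain ⟨C, hC, h⟩ := exists_norm_le_of_closed_cone L (isClosed_signCone σ)
        (fun t ht r hr j => ⟨fun h => mul_nonneg hr ((ht j).1 h),
          fun h => mul_nonpos_of_nonneg_of_nonpos hr ((ht j).2.1 h),
          fun h => by simp [(ht j).2.2 h]⟩) hσ
      exact ⟨C, hC, fun _ => h⟩
    · exact ⟨0, le_rfl, fun h => absurd h hσ⟩
  choose C hC0 hC using key
  refine ⟨∑ σ, C σ, Finset.sum_nonneg fun σ _ => hC0 σ, fun t v htv => ?_⟩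
  let σ : ι → SignType := fun j => SignType.sign (t j)
  have ht : t ∈ signCone σ := fun j =>
    ⟨fun h => (sign_eq_one_iff.1 h).le, fun h => (sign_eq_neg_one_iff.1 h).le,
      fun h => sign_eq_zero_iff.1 h⟩
  have hker : ∀ z ∈ signCone σ, L z = 0 → z = 0 := by
    intro z hz hLz
    have hnonneg : ∀ j, 0 ≤ z j * ⟪a j, v⟫ := by
      intro j
      rcases lt_trichotomy ⟪a j, v⟫ 0 with h | h | h
      · exact mul_nonneg_of_nonpos_of_nonpos
          ((hz j).2.1 ((htv j).trans (sign_eq_neg_one_iff.2 h))) h.le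
      · simp [h]
      · exact mul_nonneg ((hz j).1 ((htv j).trans (sign_eq_one_iff.2 h))) h.le
    have hsum : ∑ j, z j * ⟪a j, v⟫ = 0 := by
      have : ⟪L z, v⟫ = 0 := by simp [hLz]
      simpa [hL, sum_inner, real_inner_smul_left] using this
    funext j
    have hj := (Finset.sum_eq_zero_iff_of_nonneg fun j _ => hnonneg j).1 hsum j (Finset.mem_univ j)
    rcases mul_eq_zero.1 hj with h | h
    · exact h
    · exact (hz j).2.2 ((htv j).trans (sign_eq_zero_iff.2 h))
  rw [← hL]
  refine (hC σ hker t ht).trans ?_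
  gcongr
  exact Finset.single_le_sum (f := C) (fun σ _ => hC0 σ) (Finset.mem_univ σ)

/-- A bounded open set is left through its frontier along every ray. -/
lemma exists_pos_add_smul_mem_frontier {V : Type*} [NormedAddCommGroup V] [NormedSpace ℝ V]
    {Ω : Set V} (hΩ : IsOpen Ω) (hb : Bornology.IsBounded Ω) {x u : V} (hx : x ∈ Ω)
    (hu : u ≠ 0) : ∃ t : ℝ, 0 < t ∧ x + t • u ∈ frontier Ω := by
  by_contra! hcon
  have hpre : IsPreconnected ((fun t : ℝ => x + t • u) '' Ici 0) :=
    isPreconnected_Ici.image _ (by fun_prop)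
  have hsub : (fun t : ℝ => x + t • u) '' Ici 0 ⊆ Ω := by
    refine hpre.subset_left_of_subset_union hΩ isClosed_closure.isOpen_compl
      (disjoint_left.2 fun y hy hy' => hy' (subset_closure hy)) ?_ ⟨x, ⟨0, by simp⟩, hx⟩
    rintro _ ⟨t, ht, rfl⟩
    rcases (mem_Ici.1 ht).eq_or_lt with rfl | ht
    · left; simpa using hx
    · by_contra h
      simp only [mem_union, mem_compl_iff, not_or, not_not] at h
      exact hcon t ht ⟨h.2, by rw [hΩ.interior_eq]; exact h.1⟩
  obtain ⟨R, hR⟩ := hb.exists_norm_le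
  have hun : 0 < ‖u‖ := norm_pos_iff.2 hu
  have hR0 : 0 ≤ R := (norm_nonneg x).trans (hR x hx)
  have h := hR _ (hsub ⟨(R + ‖x‖ + 1) / ‖u‖, by simp only [mem_Ici]; positivity, rfl⟩)
  have h2 : ‖((R + ‖x‖ + 1) / ‖u‖) • u‖ = R + ‖x‖ + 1 := by
    rw [norm_smul, Real.norm_of_nonneg (by positivity), div_mul_cancel₀ _ hun.ne']
  have h3 := norm_sub_le (x + ((R + ‖x‖ + 1) / ‖u‖) • u) x
  rw [add_sub_cancel_left, h2] at h3
  simp only at h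
  linarith

/-- The polar of a finite set has finitely many extreme points. -/
lemma finite_extremePoints_polar (F : Finset E) :
    {a : E | ∀ v ∈ F, ⟪a, v⟫ ≤ 1}.extremePoints ℝ |>.Finite := by
  classical
  refine Set.Finite.of_finite_image (f := fun a => F.filter fun v => ⟪a, v⟫ = 1)
    ((F.powerset.finite_toSet).subset ?_) ?_
  · rintro _ ⟨a, -, rfl⟩
    exact Finset.mem_coe.2 (Finset.mem_powerset.2 (Finset.filter_subset _ _))
  · intro a ha b hb hab
    have hact : ∀ v ∈ F, ⟪a, v⟫ = 1 → ⟪b, v⟫ = 1 := fun v hv h => by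
      have : v ∈ F.filter fun v => ⟪b, v⟫ = 1 :=
        (Finset.ext_iff.1 hab v).1 (Finset.mem_filter.2 ⟨hv, h⟩)
      exact (Finset.mem_filter.1 this).2
    have hev : ∀ w : E, (∀ v ∈ F, ⟪a, v⟫ = 1 → ⟪w, v⟫ = 0) →
        ∀ᶠ ε : ℝ in 𝓝[>] 0, ∀ v ∈ F, ⟪a + ε • w, v⟫ ≤ 1 := by
      intro w hw
      rw [Filter.eventually_all_finset]
      intro v hv
      rcases (ha.1 v hv).eq_or_lt with h | h
      · filter_upwards with ε
        simp [inner_add_left, real_inner_smul_left, hw v hv h, h]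
      · have hc : Tendsto (fun ε : ℝ => ⟪a + ε • w, v⟫) (𝓝 0) (𝓝 ⟪a + (0 : ℝ) • w, v⟫) :=
          Continuous.tendsto (by fun_prop) 0
        have := hc.eventually_lt_const (u := 1) (by simpa using h)
        exact (this.filter_mono nhdsWithin_le_nhds).mono fun _ h => h.le
    have h0 : ∀ v ∈ F, ⟪a, v⟫ = 1 → ⟪b - a, v⟫ = 0 := fun v hv h => by
      rw [inner_sub_left, hact v hv h, h, sub_self]
    obtain ⟨ε, ⟨h1, h2⟩, hε⟩ := (((hev (b - a) h0).and (hev (-(b - a)) fun v hv h => by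
      rw [inner_neg_left, h0 v hv h, neg_zero])).and self_mem_nhdsWithin).exists
    have := ha.2 h1 h2 ⟨1 / 2, 1 / 2, by norm_num, by norm_num, by norm_num, by module⟩
    have hz : ε • (b - a) = 0 := by simpa using this
    rcases smul_eq_zero.1 hz with h | h
    · exact absurd h (ne_of_gt hε)
    · exact (sub_eq_zero.1 h).symm

/-- Half-space description of a polytope around an interior point. -/
lemma exists_halfspaces_convexHull [FiniteDimensional ℝ E] (F : Finset E) {c : E}
    (hc : c ∈ interior (convexHull ℝ (F : Set E))) :
    ∃ S : Finset E, ∀ x, x ∈ convexHull ℝ (F : Set E) ↔ ∀ a ∈ S, ⟪a, x - c⟫ ≤ 1 := by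
  classical
  set P := convexHull ℝ (F : Set E) with hP
  set Q : Set E := {a | ∀ v ∈ F.image (· - c), ⟪a, v⟫ ≤ 1} with hQ
  have hmemQ : ∀ a, a ∈ Q ↔ ∀ v ∈ F, ⟪a, v - c⟫ ≤ 1 := fun a => by simp [hQ]
  have hhalf : ∀ v : E, Convex ℝ {a : E | ⟪a, v⟫ ≤ 1} := fun v =>
    convex_halfSpace_le ⟨fun a b => inner_add_left a b v, fun r a => real_inner_smul_left a v r⟩ 1
  have hconv : ∀ a, Convex ℝ {x : E | ⟪a, x - c⟫ ≤ 1} := fun a => by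
    simpa only [inner_sub_right, sub_le_iff_le_add] using convex_halfSpace_le (𝕜 := ℝ)
      ⟨inner_add_right a, fun r x => real_inner_smul_right a x r⟩ (1 + ⟪a, c⟫)
  have hQP : ∀ a ∈ Q, ∀ x ∈ P, ⟪a, x - c⟫ ≤ 1 := fun a ha x hx =>
    convexHull_min (fun v hv => (hmemQ a).1 ha v hv) (hconv a) hx
  have hQclosed : IsClosed Q := by
    simp only [hQ, ofPred_forall]
    exact isClosed_biInter fun v _ => isClosed_le (by fun_prop) continuous_const
  have hQconv : Convex ℝ Q := by
    simp only [hQ, ofPred_forall]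
    exact convex_iInter₂ fun v _ => hhalf v
  have hQcomp : IsCompact Q := by
    obtain ⟨r, hr, hball⟩ := Metric.isOpen_iff.1 isOpen_interior c hc
    refine Metric.isCompact_of_isClosed_isBounded hQclosed
      ((Metric.isBounded_closedBall (x := (0 : E)) (r := 2 / r)).subset fun a ha => ?_)
    rw [mem_closedBall_zero_iff]
    by_cases h0 : a = 0
    · simp only [h0, norm_zero]; positivity
    · have hn : 0 < ‖a‖ := norm_pos_iff.2 h0
      have hmem : c + (r / 2 / ‖a‖) • a ∈ P := interior_subset (hball (by
        rw [mem_ball_iff_norm, add_sub_cancel_left, norm_smul, Real.norm_of_nonneg (by positivity),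
          div_mul_cancel₀ _ hn.ne']
        linarith))
      have h := hQP a ha _ hmem
      rw [add_sub_cancel_left, real_inner_smul_right, real_inner_self_eq_norm_sq] at h
      rw [le_div_iff₀ hr]
      field_simp at h
      linarith
  have hfin := finite_extremePoints_polar (F.image (· - c))
  refine ⟨hfin.toFinset, fun x => ⟨fun hx a ha => hQP a ?_ x hx, fun hx => ?_⟩⟩
  · exact extremePoints_subset ((hfin.mem_toFinset).1 ha)
  · have hxQ : ∀ a ∈ Q, ⟪a, x - c⟫ ≤ 1 := by
      intro a ha
      rw [← closure_convexHull_extremePoints hQcomp hQconv] at ha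
      have hcl : IsClosed {a : E | ⟪a, x - c⟫ ≤ 1} := isClosed_le (by fun_prop) continuous_const
      exact closure_minimal (convexHull_min (fun b hb => hx b ((hfin.mem_toFinset).2 hb))
        (hhalf (x - c))) hcl ha
    by_contra hxP
    obtain ⟨f, u, hfu, hux⟩ := geometric_hahn_banach_closed_point (convex_convexHull ℝ (F : Set E))
      (F.finite_toSet.isCompact_convexHull (𝕜 := ℝ)).isClosed hxP
    have hr : 0 < u - f c := sub_pos.2 (hfu c (interior_subset hc))
    let g : E := (InnerProductSpace.toDual ℝ E).symm f
    have hg : ∀ y, ⟪g, y⟫ = f y := fun y => InnerProductSpace.toDual_symm_apply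
    have hmem : (u - f c)⁻¹ • g ∈ Q := (hmemQ _).2 fun v hv => by
      rw [real_inner_smul_left, hg, map_sub, inv_mul_le_one₀ hr]
      linarith [hfu v (subset_convexHull ℝ _ hv)]
    have h := hxQ _ hmem
    rw [real_inner_smul_left, hg, map_sub, inv_mul_le_one₀ hr] at h
    linarith

/-- The affine functional `x ↦ 1 - ⟪a i, x - c⟫`. -/
def slack (a : ι → E) (c : E) (i : ι) (x : E) : ℝ := 1 - ⟪a i, x - c⟫

lemma continuous_slack (a : ι → E) (c : E) (i : ι) : Continuous (slack a c i) := by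
  unfold slack
  fun_prop

lemma slack_sub_slack (a : ι → E) (c : E) (i : ι) (x y : E) :
    slack a c i x - slack a c i y = ⟪a i, y - x⟫ := by
  simp only [slack, inner_sub_right]
  ring

lemma slack_add_smul_sub (a : ι → E) (c : E) (i : ι) (x y z : E) (r : ℝ) :
    slack a c i (x + r • (y - z)) = slack a c i x + r * (slack a c i y - slack a c i z) := by
  simp only [slack, inner_sub_right, inner_add_right, real_inner_smul_right]
  ring

/-- The tangent-line inequality for the convex function `u ↦ u * log u - u`. -/
lemma mul_log_sub_self_sub_le {u v : ℝ} (hu : 0 < u) (hv : 0 ≤ v) :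
    (u * Real.log u - u) - (v * Real.log v - v) ≤ Real.log u * (u - v) := by
  rcases hv.eq_or_lt with rfl | hv
  · simp only [Real.log_zero]
    linarith
  · have h := Real.log_le_sub_one_of_pos (div_pos hu hv)
    rw [Real.log_div hu.ne' hv.ne'] at h
    have h2 := mul_le_mul_of_nonneg_left h hv.le
    have h3 : v * (u / v - 1) = u - v := by field_simp
    linarith

lemma log_mul_sub_le {u p v : ℝ} (hu : 0 < u) (hp : 0 < p) (h : u ∈ segment ℝ v p) :
    Real.log u * (p - v) ≤ Real.log p * (p - v) := by
  rcases le_total v p with hvp | hvp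
  · rw [segment_eq_Icc hvp] at h
    exact mul_le_mul_of_nonneg_right (Real.log_le_log hu h.2) (sub_nonneg.2 hvp)
  · rw [segment_symm, segment_eq_Icc hvp] at h
    exact mul_le_mul_of_nonpos_right (Real.log_le_log hp h.1) (sub_nonpos.2 hvp)

/-- The gradient of the entropy of the slacks of a compact polyhedron is onto. -/
lemma exists_sum_log_slack_smul_eq [Fintype ι] (a : ι → E) (c : E)
    (hcomp : IsCompact {x | ∀ i, 0 ≤ slack a c i x}) (ξ : E) :
    ∃ x, (∀ i, 0 < slack a c i x) ∧ ∑ i, Real.log (slack a c i x) • a i = ξ := by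
  classical
  have hc1 : ∀ i, slack a c i c = 1 := fun i => by simp [slack]
  obtain ⟨x, hx, hmin⟩ := hcomp.exists_isMinOn ⟨c, fun i => by simp [hc1]⟩
    (f := fun x => ∑ i, (slack a c i x * Real.log (slack a c i x) - slack a c i x) + ⟪ξ, x⟫)
    (by
      refine Continuous.continuousOn (Continuous.add (continuous_finsetSum _ fun i _ => ?_)
        (by fun_prop))
      exact (Real.continuous_mul_log.comp (continuous_slack a c i)).sub (continuous_slack a c i))
  have hvar : ∀ p, (∀ i, 0 < slack a c i p) → 0 ≤
      ∑ i, Real.log (slack a c i p) * (slack a c i p - slack a c i x) + ⟪ξ, p - x⟫ := by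
    intro p hp
    have h := hmin (show p ∈ {x | ∀ i, 0 ≤ slack a c i x} from fun i => (hp i).le)
    simp only [mem_ofPred_eq] at h
    have h2 := Finset.sum_le_sum fun i (_ : i ∈ Finset.univ) =>
      mul_log_sub_self_sub_le (hp i) (hx i)
    rw [Finset.sum_sub_distrib] at h2
    rw [inner_sub_right]
    linarith
  have hpos : ∀ i, 0 < slack a c i x := by
    intro b
    by_contra hb
    have hb0 : slack a c b x = 0 := le_antisymm (not_lt.1 hb) (hx b)
    obtain ⟨s, hs0, hs1, hs⟩ : ∃ s : ℝ, 0 < s ∧ s ≤ 1 ∧ Real.log s < -⟪ξ, c - x⟫ :=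
      ⟨Real.exp (-|⟪ξ, c - x⟫| - 1), Real.exp_pos _,
        Real.exp_le_one_iff.2 (by linarith [abs_nonneg ⟪ξ, c - x⟫]),
        by rw [Real.log_exp]; linarith [le_abs_self ⟪ξ, c - x⟫]⟩
    have hsl : ∀ i, slack a c i (x + s • (c - x)) = (1 - s) * slack a c i x + s * 1 := fun i => by
      rw [slack_add_smul_sub, hc1]
      ring
    have hp : ∀ i, 0 < slack a c i (x + s • (c - x)) := fun i => by
      rw [hsl]
      have := mul_nonneg (sub_nonneg.2 hs1) (hx i)
      linarith
    have h := hvar _ hp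
    have hterm : ∀ i, Real.log (slack a c i (x + s • (c - x))) *
        (slack a c i (x + s • (c - x)) - slack a c i x) ≤
        s * (if i = b then Real.log s else 0) := by
      intro i
      have hsub : slack a c i (x + s • (c - x)) - slack a c i x = s * (1 - slack a c i x) := by
        rw [hsl]
        ring
      rw [hsub, mul_left_comm]
      refine mul_le_mul_of_nonneg_left ?_ hs0.le
      split_ifs with hib
      · subst hib
        simp [hsl, hb0]
      · have := log_mul_sub_le (hp i) one_pos (v := slack a c i x)
          ⟨1 - s, s, by linarith, hs0.le, by ring, by simp [hsl]⟩
        simpa using this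
    have hsum := Finset.sum_le_sum fun i (_ : i ∈ Finset.univ) => hterm i
    rw [← Finset.mul_sum, Finset.sum_ite_eq' Finset.univ b, if_pos (Finset.mem_univ b)] at hsum
    rw [add_sub_cancel_left, real_inner_smul_right] at h
    nlinarith
  refine ⟨x, hpos, ?_⟩
  set G : E → E := fun y => ∑ i, Real.log (slack a c i y) • a i with hG
  have hGc : ContinuousAt G x := tendsto_finsetSum _ fun i _ =>
    ((continuous_slack a c i).continuousAt.log (hpos i).ne').smul continuousAt_const
  set g := ξ - G x with hg
  have hline : Tendsto (fun ε : ℝ => x - ε • g) (𝓝[>] 0) (𝓝 x) := by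
    have : Tendsto (fun ε : ℝ => x - ε • g) (𝓝 0) (𝓝 (x - (0 : ℝ) • g)) :=
      Continuous.tendsto (by fun_prop) 0
    rw [zero_smul, sub_zero] at this
    exact this.mono_left nhdsWithin_le_nhds
  have hlim : Tendsto (fun ε : ℝ => ⟪ξ - G (x - ε • g), g⟫) (𝓝[>] 0) (𝓝 ⟪ξ - G x, g⟫) :=
    (tendsto_const_nhds.sub (hGc.tendsto.comp hline)).inner tendsto_const_nhds
  have hle : ∀ᶠ ε : ℝ in 𝓝[>] 0, ⟪ξ - G (x - ε • g), g⟫ ≤ 0 := by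
    have hev : ∀ᶠ ε : ℝ in 𝓝[>] 0, ∀ i, 0 < slack a c i (x - ε • g) :=
      hline.eventually (eventually_all.2 fun i =>
        (continuous_slack a c i).continuousAt.eventually (lt_mem_nhds (hpos i)))
    filter_upwards [hev, self_mem_nhdsWithin] with ε hε hε0
    have h := hvar _ hε
    have hsum : ∑ i, Real.log (slack a c i (x - ε • g)) *
        (slack a c i (x - ε • g) - slack a c i x) = ε * ⟪G (x - ε • g), g⟫ := by
      simp only [hG, sum_inner, real_inner_smul_left, Finset.mul_sum, slack_sub_slack,
        sub_sub_cancel, real_inner_smul_right]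
      exact Finset.sum_congr rfl fun i _ => by ring
    have hξ : ⟪ξ, x - ε • g - x⟫ = -(ε * ⟪ξ, g⟫) := by
      rw [sub_sub_cancel_left, inner_neg_right, real_inner_smul_right]
    rw [hsum, hξ] at h
    rw [inner_sub_left]
    have hε1 : 0 < ε := hε0
    by_contra! hcon
    nlinarith [mul_pos hε1 hcon]
  have hfinal : ⟪g, g⟫ ≤ 0 := le_of_tendsto hlim hle
  have : g = 0 := real_inner_self_nonpos.1 hfinal
  exact (sub_eq_zero.1 this).symm

/-- The exit parameter of a ray from a polyhedron, read off from the logarithms of the slacks. -/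
lemma log_slack_sub_le_of_mem_frontier [Finite ι] (a : ι → E) (c : E) {p q : E} {r : ℝ}
    (hp : ∀ i, 0 < slack a c i p) (hq : ∀ i, 0 < slack a c i q) (hr : 0 < r)
    (hb : q + r • (q - p) ∈ frontier {x | ∀ i, 0 < slack a c i x}) :
    (∀ i, Real.log (slack a c i p) - Real.log (slack a c i q) ≤ Real.log ((1 + r) / r)) ∧
      ∃ i, Real.log (slack a c i p) - Real.log (slack a c i q) = Real.log ((1 + r) / r) := by
  have hopen : IsOpen {x | ∀ i, 0 < slack a c i x} := by
    simp only [ofPred_forall]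
    exact isOpen_iInter_of_finite fun i => isOpen_lt continuous_const (continuous_slack a c i)
  have hclosed : IsClosed {x | ∀ i, 0 ≤ slack a c i x} := by
    simp only [ofPred_forall]
    exact isClosed_iInter fun i => isClosed_le continuous_const (continuous_slack a c i)
  have hnonneg : ∀ i, 0 ≤ slack a c i (q + r • (q - p)) :=
    closure_minimal (fun x hx i => (hx i).le) hclosed hb.1
  have hne : ∃ i, slack a c i (q + r • (q - p)) ≤ 0 := by
    have := hb.2
    rw [hopen.interior_eq] at this
    simpa using this
  have hle : ∀ i, slack a c i p / slack a c i q ≤ (1 + r) / r := fun i => by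
    rw [div_le_div_iff₀ (hq i) hr]
    have := hnonneg i
    rw [slack_add_smul_sub] at this
    linarith
  refine ⟨fun i => ?_, ?_⟩
  · rw [← Real.log_div (hp i).ne' (hq i).ne']
    exact Real.log_le_log (div_pos (hp i) (hq i)) (hle i)
  · obtain ⟨i, hi⟩ := hne
    refine ⟨i, ?_⟩
    rw [← Real.log_div (hp i).ne' (hq i).ne']
    congr 1
    refine le_antisymm (hle i) ?_
    rw [div_le_div_iff₀ hr (hq i)]
    rw [slack_add_smul_sub] at hi
    linarith

end Auxiliary

/-- The Hilbert distance of a bounded polyhedron is comparable to the supremum distance of the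
logarithms of the slacks. -/
lemma IsHilbertDist.log_slack_bounds {n : ℕ} {ι : Type*} [Fintype ι] (a : ι → Euc n) (c : Euc n)
    {d : Euc n → Euc n → ℝ} (hb : Bornology.IsBounded {x | ∀ i, 0 < slack a c i x})
    (hd : IsHilbertDist {x | ∀ i, 0 < slack a c i x} d) {x y : Euc n}
    (hx : ∀ i, 0 < slack a c i x) (hy : ∀ i, 0 < slack a c i y) (hxy : x ≠ y) :
    0 < d x y ∧
      ‖fun i => Real.log (slack a c i x) - Real.log (slack a c i y)‖ ≤ 2 * d x y ∧
      d x y ≤ ‖fun i => Real.log (slack a c i x) - Real.log (slack a c i y)‖ := by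
  have hopen : IsOpen {x | ∀ i, 0 < slack a c i x} := by
    simp only [ofPred_forall]
    exact isOpen_iInter_of_finite fun i => isOpen_lt continuous_const (continuous_slack a c i)
  obtain ⟨r, hr, hrb⟩ := exists_pos_add_smul_mem_frontier hopen hb hy (sub_ne_zero.2 hxy.symm)
  obtain ⟨s, hs, hsb⟩ := exists_pos_add_smul_mem_frontier hopen hb hx (sub_ne_zero.2 hxy)
  have hn : 0 < ‖y - x‖ := norm_pos_iff.2 (sub_ne_zero.2 hxy.symm)
  have hdist := hd.2 x hx y hy hxy _ _ hsb hrb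
    ⟨-s, 1 + r, by linarith, by linarith, by module, by module⟩
  have e1 : y - (x + s • (x - y)) = (1 + s) • (y - x) := by module
  have e2 : x - (x + s • (x - y)) = s • (y - x) := by module
  have e3 : x - (y + r • (y - x)) = -((1 + r) • (y - x)) := by module
  have e4 : y - (y + r • (y - x)) = -(r • (y - x)) := by module
  rw [e1, e2, e3, e4, norm_neg, norm_neg, norm_smul, norm_smul, norm_smul, norm_smul,
    mul_div_mul_right _ _ hn.ne', mul_div_mul_right _ _ hn.ne',
    Real.norm_of_nonneg hr.le, Real.norm_of_nonneg hs.le,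
    Real.norm_of_nonneg (by linarith : 0 ≤ 1 + r), Real.norm_of_nonneg (by linarith : 0 ≤ 1 + s),
    Real.log_mul (by positivity) (by positivity)] at hdist
  have hlr : 0 < Real.log ((1 + r) / r) := Real.log_pos ((one_lt_div hr).2 (by linarith))
  have hls : 0 < Real.log ((1 + s) / s) := Real.log_pos ((one_lt_div hs).2 (by linarith))
  obtain ⟨hr1, i, hi⟩ := log_slack_sub_le_of_mem_frontier a c hx hy hr hrb
  obtain ⟨hs1, j, hj⟩ := log_slack_sub_le_of_mem_frontier a c hy hx hs hsb
  refine ⟨by linarith, ?_, ?_⟩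
  · refine (pi_norm_le_iff_of_nonneg (by linarith)).2 fun k => ?_
    rw [Real.norm_eq_abs, abs_le]
    constructor <;> linarith [hr1 k, hs1 k]
  · have h1 := norm_le_pi_norm
      (fun i => Real.log (slack a c i x) - Real.log (slack a c i y)) i
    have h2 := norm_le_pi_norm
      (fun i => Real.log (slack a c i x) - Real.log (slack a c i y)) j
    rw [Real.norm_eq_abs] at h1 h2
    linarith [(abs_le.1 h1).2, (abs_le.1 h2).1]

/-- The interior of a polytope as a bounded polyhedron. -/
lemma exists_interior_convexHull_eq_slack_pos {n : ℕ} (F : Finset (Euc n)) {c : Euc n}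
    (hc : c ∈ interior (convexHull ℝ (F : Set (Euc n)))) :
    ∃ S : Finset (Euc n),
      convexHull ℝ (F : Set (Euc n)) =
        {x | ∀ i : S, 0 ≤ slack (fun i : S => (i : Euc n)) c i x} ∧
      interior (convexHull ℝ (F : Set (Euc n))) =
        {x | ∀ i : S, 0 < slack (fun i : S => (i : Euc n)) c i x} := by
  obtain ⟨S, hS⟩ := exists_halfspaces_convexHull F hc
  have hP : convexHull ℝ (F : Set (Euc n)) =
      {x | ∀ i : S, 0 ≤ slack (fun i : S => (i : Euc n)) c i x} := by
    ext x
    simp [hS, slack]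
  refine ⟨S, hP, ?_⟩
  apply Subset.antisymm
  · intro x hx i
    have htend : Tendsto (fun ε : ℝ => x + ε • (x - c)) (𝓝[>] 0) (𝓝 x) := by
      have : Tendsto (fun ε : ℝ => x + ε • (x - c)) (𝓝 0) (𝓝 (x + (0 : ℝ) • (x - c))) :=
        Continuous.tendsto (by fun_prop) 0
      rw [zero_smul, add_zero] at this
      exact this.mono_left nhdsWithin_le_nhds
    obtain ⟨ε, hε, hε0⟩ := ((htend.eventually (mem_interior_iff_mem_nhds.1 hx)).and
      self_mem_nhdsWithin).exists
    have hε1 : 0 < ε := hε0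
    rw [hP] at hε
    have h := hε i
    have hc1 : slack (fun i : S => (i : Euc n)) c i c = 1 := by simp [slack]
    rw [slack_add_smul_sub, hc1] at h
    by_contra! hcon
    nlinarith
  · refine interior_maximal (fun x hx => ?_) ?_
    · rw [hP]
      exact fun i => (hx i).le
    · simp only [ofPred_forall]
      exact isOpen_iInter_of_finite fun i =>
        isOpen_lt continuous_const (continuous_slack _ c i)

/-- **Bernig / Vernicos / Colbois–Vernicos–Verovic.**  The Hilbert geometry of a bounded convex
polytope `P ⊆ ℝⁿ` with non-empty interior is bi-Lipschitz equivalent to the Euclidean space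
`(ℝⁿ, ‖·‖)`: there are a bijection `Φ : int P → ℝⁿ` and a constant `A ≥ 1` with
`(1/A)·‖Φx − Φy‖ ≤ d_P(x,y) ≤ A·‖Φx − Φy‖` for all `x, y ∈ int P`. -/
theorem polytope_biLipschitz_to_euclidean {n : ℕ}
    (F : Finset (Euc n)) (P : Set (Euc n)) (hP : P = convexHull ℝ (↑F : Set (Euc n)))
    (hint : (interior P).Nonempty)
    (d : Euc n → Euc n → ℝ) (hd : IsHilbertDist (interior P) d) :
    ∃ Φ : Euc n → Euc n, Set.BijOn Φ (interior P) Set.univ ∧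
      ∃ A : ℝ, 1 ≤ A ∧ ∀ x ∈ interior P, ∀ y ∈ interior P,
        (1 / A) * ‖Φ x - Φ y‖ ≤ d x y ∧ d x y ≤ A * ‖Φ x - Φ y‖ := by
  subst hP
  obtain ⟨c, hc⟩ := hint
  obtain ⟨S, hS, hSint⟩ := exists_interior_convexHull_eq_slack_pos F hc
  have hcomp : IsCompact (convexHull ℝ (F : Set (Euc n))) :=
    F.finite_toSet.isCompact_convexHull (𝕜 := ℝ)
  have hb : Bornology.IsBounded (interior (convexHull ℝ (F : Set (Euc n)))) :=
    hcomp.isBounded.subset interior_subset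
  rw [hS] at hcomp
  rw [hSint] at hd hb ⊢
  set a : S → Euc n := fun i => i
  set G : Euc n → Euc n := fun x => ∑ i, Real.log (slack a c i x) • a i with hG
  obtain ⟨C, hC0, hC⟩ := exists_norm_le_of_sign_eq a
  have hsub : ∀ x y, G x - G y =
      ∑ i, (Real.log (slack a c i x) - Real.log (slack a c i y)) • a i := fun x y => by
    simp only [hG, ← Finset.sum_sub_distrib, sub_smul]
  have hlower : ∀ x y, (∀ i, 0 < slack a c i x) → (∀ i, 0 < slack a c i y) →
      ‖fun i => Real.log (slack a c i x) - Real.log (slack a c i y)‖ ≤ C * ‖G x - G y‖ := by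
    intro x y hx hy
    rw [hsub]
    refine hC _ (y - x) fun i => ?_
    rw [← slack_sub_slack a c i x y]
    rcases lt_trichotomy (slack a c i x) (slack a c i y) with h | h | h
    · rw [_root_.sign_neg (sub_neg.2 h), _root_.sign_neg (sub_neg.2 (Real.log_lt_log (hx i) h))]
    · simp [h]
    · rw [_root_.sign_pos (sub_pos.2 h), _root_.sign_pos (sub_pos.2 (Real.log_lt_log (hy i) h))]
  have hupper : ∀ x y, ‖G x - G y‖ ≤
      (∑ i, ‖a i‖) * ‖fun i => Real.log (slack a c i x) - Real.log (slack a c i y)‖ := by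
    intro x y
    rw [hsub, Finset.sum_mul]
    refine (norm_sum_le _ _).trans (Finset.sum_le_sum fun i _ => ?_)
    rw [norm_smul, mul_comm]
    exact mul_le_mul_of_nonneg_left
      (norm_le_pi_norm (fun i => Real.log (slack a c i x) - Real.log (slack a c i y)) i)
      (norm_nonneg _)
  have hM : 0 ≤ ∑ i, ‖a i‖ := Finset.sum_nonneg fun i _ => norm_nonneg _
  refine ⟨G, ⟨mapsTo_univ _ _, fun x hx y hy hxy => ?_, fun ξ _ => ?_⟩,
    1 + 2 * (∑ i, ‖a i‖) + C, by linarith, fun x hx y hy => ?_⟩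
  · by_contra hne
    obtain ⟨hpos, -, hle⟩ := hd.log_slack_bounds a c hb hx hy hne
    have h := hlower x y hx hy
    rw [hxy, sub_self, norm_zero, mul_zero] at h
    linarith
  · obtain ⟨x, hx, hxξ⟩ := exists_sum_log_slack_smul_eq a c hcomp ξ
    exact ⟨x, hx, hxξ⟩
  · have hA : 0 < 1 + 2 * (∑ i, ‖a i‖) + C := by linarith
    by_cases hne : x = y
    · subst hne
      simp [hd.1 x hx]
    obtain ⟨hpos, h1, h2⟩ := hd.log_slack_bounds a c hb hx hy hne
    have h3 := hlower x y hx hy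
    have h4 := hupper x y
    constructor
    · rw [one_div, inv_mul_le_iff₀ hA]
      have h5 := mul_le_mul_of_nonneg_left h1 hM
      nlinarith [mul_nonneg hC0 hpos.le]
    · nlinarith [norm_nonneg (G x - G y), mul_nonneg hM (norm_nonneg (G x - G y))]
end
end
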